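/- arXiv:math/0610538 — 4 statements merged into one kernel-verified Lean document; each statement's English description precedes it below -/
import Mathlib

section
/- Let α, β, γ be binary strings of length n, each containing exactly k ones. Then the number of puzzles of size n with boundary (α, β, γ) equals the Littlewood–Richardson coefficient c^{λ(γ)}_{λ(α),λ(β)}. -/
/-!  The puzzle Littlewood–Richardson rule of Knutson and Tao: the number of
puzzles of size `n` with boundary `(α, β, γ)` equals the Littlewood–Richardson
coefficient `c^{λ(γ)}_{λ(α), λ(β)}`.  Binary strings of length `n` with `k`
ones are identified with partitions in the `k × (n-k)` rectangle, the string
of `λ` having `1`s exactly in the (1-based) positions `n-k+i-λ_i`. -/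

open scoped Classical

/-- The cell `(i, j)` lies in the skew Young diagram `ν/λ`. -/
def InSkew (lam nu : ℕ → ℕ) (x : ℕ × ℕ) : Prop :=
  lam x.1 ≤ x.2 ∧ x.2 < nu x.1

/-- Reading order: rows top to bottom, each row right to left. -/
def ReadBefore (r c : ℕ) (x : ℕ × ℕ) : Prop :=
  x.1 < r ∨ (x.1 = r ∧ c ≤ x.2)

/-- `T` is a Littlewood–Richardson skew tableau of shape `ν/λ` and content `μ`. -/
def IsLRSkewTableau (lam mu nu : ℕ → ℕ) (T : ℕ × ℕ → ℕ) : Prop :=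
  (∀ x : ℕ × ℕ, 0 < T x ↔ InSkew lam nu x) ∧
  (∀ i j j', lam i ≤ j → j ≤ j' → j' < nu i → T (i, j) ≤ T (i, j')) ∧
  (∀ i i' j, i < i' → InSkew lam nu (i, j) → InSkew lam nu (i', j) →
    T (i, j) < T (i', j)) ∧
  (∀ m, 0 < m →
    Nat.card {x : ℕ × ℕ // InSkew lam nu x ∧ T x = m} = mu (m - 1)) ∧
  (∀ m, 0 < m → ∀ r c : ℕ,
    Nat.card {x : ℕ × ℕ // ReadBefore r c x ∧ InSkew lam nu x ∧ T x = m + 1} ≤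
      Nat.card {x : ℕ × ℕ // ReadBefore r c x ∧ InSkew lam nu x ∧ T x = m})

/-- The Littlewood–Richardson coefficient `c^ν_{λ,μ}`. -/
noncomputable def lrCoeff (lam mu nu : ℕ → ℕ) : ℕ :=
  if ∀ i, lam i ≤ nu i then
    Nat.card {T : ℕ × ℕ → ℕ // IsLRSkewTableau lam mu nu T}
  else 0

/-- `lam` is a partition contained in a `k × (n-k)` rectangle:
a weakly decreasing sequence of at most `k` nonzero parts, each at most `n-k`. -/
def IsRectPartition (n k : ℕ) (lam : ℕ → ℕ) : Prop :=
  Antitone lam ∧ (∀ i, lam i ≤ n - k) ∧ (∀ i, k ≤ i → lam i = 0)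


/-!  **Puzzles of Knutson and Tao.**

The triangle of size `n` is subdivided into `n²` unit triangles arranged in
rows `r = 0, …, n-1` (row `r` containing the upward unit triangles
`(r,0), …, (r,r)` and the downward unit triangles `(r,0), …, (r,r-1)`).
Edge labels live in `Fin 3`, where `0`, `1` are the honest labels and `2`
stands for the composite label `10`.

The labels are recorded by three functions:
* `L r j` — the left (northwest-parallel) edge of the upward triangle `(r,j)`;
* `R r j` — the right (northeast-parallel) edge of the upward triangle `(r,j)`;
* `C r j` — the bottom (horizontal) edge of the upward triangle `(r,j)`.

The downward triangle `(r,j)` (for `j < r`) then has top edge `C (r-1) j`,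
left edge `R r j` and right edge `L r (j+1)`.

The allowed unit pieces, up to rotation but not reflection, are:
all edges `0`; all edges `1`; and edges `1, 0, 10` in clockwise order.
Reading clockwise around an upward triangle gives (left, right, bottom), and
around a downward triangle (top, right, left), which yields the two validity
predicates below. -/

/-- Valid labels for an upward triangle with left, right, bottom edges `l, r, b`. -/
def ValidUp (l r b : Fin 3) : Prop :=
  (l = 0 ∧ r = 0 ∧ b = 0) ∨ (l = 1 ∧ r = 1 ∧ b = 1) ∨
  (l = 1 ∧ r = 0 ∧ b = 2) ∨ (l = 2 ∧ r = 1 ∧ b = 0) ∨ (l = 0 ∧ r = 2 ∧ b = 1)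

/-- Valid labels for a downward triangle with top, left, right edges `t, l, r`. -/
def ValidDown (t l r : Fin 3) : Prop :=
  (t = 0 ∧ l = 0 ∧ r = 0) ∨ (t = 1 ∧ l = 1 ∧ r = 1) ∨
  (t = 1 ∧ l = 2 ∧ r = 0) ∨ (t = 2 ∧ l = 0 ∧ r = 1) ∨ (t = 0 ∧ l = 1 ∧ r = 2)

/-- `(L, R, C)` is a puzzle of size `n` with boundary `(a, b, c)`:
every upward and downward unit triangle is a valid piece, labels vanish
outside the triangle (so that counting is well defined), and the boundary
strings are `a` along the northwest side, `b` along the northeast side and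
`c` along the south side, each read left to right.  (Left to right along the
northwest side means from the bottom corner up to the apex, so `a i` is the
left edge of the upward triangle `(n-1-i, 0)`; along the northeast side it
means from the apex down, so `b r` is the right edge of `(r,r)`; along the
south side `c j` is the bottom edge of `(n-1, j)`.) -/
def IsPuzzle (n : ℕ) (L R C : ℕ → ℕ → Fin 3) (a b c : ℕ → Fin 3) : Prop :=
  (∀ r j, ¬ (j ≤ r ∧ r < n) → L r j = 0 ∧ R r j = 0 ∧ C r j = 0) ∧
  (∀ r j, j ≤ r → r < n → ValidUp (L r j) (R r j) (C r j)) ∧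
  (∀ r j, 0 < r → r < n → j < r → ValidDown (C (r - 1) j) (R r j) (L r (j + 1))) ∧
  (∀ r, r < n → L r 0 = a (n - 1 - r) ∧ R r r = b r ∧ C (n - 1) r = c r)

/-- The number of puzzles of size `n` with boundary `(a, b, c)`. -/
noncomputable def puzzleCount (n : ℕ) (a b c : ℕ → Fin 3) : ℕ :=
  Nat.card { p : (ℕ → ℕ → Fin 3) × (ℕ → ℕ → Fin 3) × (ℕ → ℕ → Fin 3) //
    IsPuzzle n p.1 p.2.1 p.2.2 a b c }

/-- The binary string (with values in `Fin 3`, using only `0` and `1`)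
associated to a partition `λ` in the `k × (n-k)` rectangle: its `1`s are
exactly at the `0`-based positions `n-k+i-λ_{i+1}` for `i < k`. -/
def strOf (n k : ℕ) (lam : ℕ → ℕ) : ℕ → Fin 3 := fun p =>
  if ∃ i, i < k ∧ p = n - k + i - lam i then 1 else 0

/-! ### Words in the labels `0, 1, 10` -/

/-- The number of nonzero letters of a word. -/
def wordCount : List (Fin 3) → ℕ
  | [] => 0
  | z :: w => if z = 0 then wordCount w else wordCount w + 1

/-- The length of the run of zeros just before the `i`-th nonzero letter
(the final run if `i` is the number of nonzero letters). -/
def wordGap : List (Fin 3) → ℕ → ℕ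
  | [], _ => 0
  | z :: w, 0 => if z = 0 then wordGap w 0 + 1 else 0
  | z :: w, i + 1 => if z = 0 then wordGap w (i + 1) else wordGap w i

/-- The indicator of the `i`-th nonzero letter being `10`. -/
def wordMark : List (Fin 3) → ℕ → ℕ
  | [], _ => 0
  | z :: w, 0 => if z = 0 then wordMark w 0 else z.val - 1
  | z :: w, i + 1 => if z = 0 then wordMark w (i + 1) else wordMark w i

@[simp] lemma wordCount_nil : wordCount [] = 0 := rfl
@[simp] lemma wordGap_nil (i : ℕ) : wordGap [] i = 0 := by simp [wordGap]
@[simp] lemma wordMark_nil (i : ℕ) : wordMark [] i = 0 := by simp [wordMark]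
@[simp] lemma wordCount_zero (w) : wordCount (0 :: w) = wordCount w := by simp [wordCount]
@[simp] lemma wordGap_zero_zero (w) : wordGap (0 :: w) 0 = wordGap w 0 + 1 := by simp [wordGap]
@[simp] lemma wordGap_zero_succ (w) (i : ℕ) : wordGap (0 :: w) (i + 1) = wordGap w (i + 1) := by
  simp [wordGap]
@[simp] lemma wordMark_zero (w) (i : ℕ) : wordMark (0 :: w) i = wordMark w i := by
  cases i <;> simp [wordMark]

lemma wordCount_letter {z : Fin 3} (hz : z ≠ 0) (w) :
    wordCount (z :: w) = wordCount w + 1 := by simp [wordCount, hz]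
lemma wordGap_letter_zero {z : Fin 3} (hz : z ≠ 0) (w) : wordGap (z :: w) 0 = 0 := by
  simp [wordGap, hz]
lemma wordGap_letter_succ {z : Fin 3} (hz : z ≠ 0) (w) (i : ℕ) :
    wordGap (z :: w) (i + 1) = wordGap w i := by simp [wordGap, hz]
lemma wordMark_letter_zero {z : Fin 3} (hz : z ≠ 0) (w) :
    wordMark (z :: w) 0 = z.val - 1 := by simp [wordMark, hz]
lemma wordMark_letter_succ {z : Fin 3} (hz : z ≠ 0) (w) (i : ℕ) :
    wordMark (z :: w) (i + 1) = wordMark w i := by simp [wordMark, hz]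

lemma wordMark_eq_zero (w : List (Fin 3)) (i : ℕ) (hi : wordCount w ≤ i) :
    wordMark w i = 0 := by
  induction w generalizing i with
  | nil => simp
  | cons z w ih =>
    by_cases hz : z = 0
    · subst hz; simpa using ih i (by simpa using hi)
    · rw [wordCount_letter hz] at hi
      obtain ⟨j, rfl⟩ : ∃ j, i = j + 1 := ⟨i - 1, by omega⟩
      rw [wordMark_letter_succ hz]; exact ih j (by omega)

/-- A word is determined by its number of letters, its gaps and its marks. -/
lemma word_ext {w v : List (Fin 3)} (hc : wordCount w = wordCount v)
    (hg : ∀ i, wordGap w i = wordGap v i) (hm : ∀ i, wordMark w i = wordMark v i) : w = v := by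
  induction w generalizing v with
  | nil =>
    cases v with
    | nil => rfl
    | cons y v =>
      by_cases hy : y = 0
      · subst hy; simpa using hg 0
      · rw [wordCount_letter hy] at hc; simp at hc
  | cons z w ih =>
    by_cases hz : z = 0
    · subst hz
      cases v with
      | nil => simpa using hg 0
      | cons y v =>
        by_cases hy : y = 0
        · subst hy
          rw [ih (by simpa using hc) (fun i => ?_) (fun i => by simpa using hm i)]
          cases i with
          | zero => simpa using hg 0
          | succ i => simpa using hg (i + 1)
        · have := hg 0
          rw [wordGap_letter_zero hy] at this; simp at this
    · cases v with
      | nil => rw [wordCount_letter hz] at hc; simp at hc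
      | cons y v =>
        by_cases hy : y = 0
        · subst hy
          have := hg 0
          rw [wordGap_letter_zero hz] at this; simp at this
        · have h0 := hm 0
          rw [wordMark_letter_zero hz, wordMark_letter_zero hy] at h0
          have hzy : z = y := by
            have h1 : z.val ≠ 0 := fun h => hz (Fin.ext h)
            have h2 : y.val ≠ 0 := fun h => hy (Fin.ext h)
            apply Fin.ext; omega
          subst hzy
          rw [ih (by simpa [wordCount_letter hz] using hc)
            (fun i => by simpa [wordGap_letter_succ hz] using hg (i + 1))
            (fun i => by simpa [wordMark_letter_succ hz] using hm (i + 1))]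

lemma exists_word (G : ℕ) (g d : ℕ → ℕ) (hd : ∀ i, d i ≤ 1)
    (hd0 : ∀ i, G ≤ i → d i = 0) (hg0 : ∀ i, G < i → g i = 0) :
    ∃ w, wordCount w = G ∧ (∀ i, wordGap w i = g i) ∧ ∀ i, wordMark w i = d i := by
  have pad : ∀ (e : ℕ) (w : List (Fin 3)), ∃ v, wordCount v = wordCount w ∧
      wordGap v 0 = wordGap w 0 + e ∧ (∀ i, wordGap v (i + 1) = wordGap w (i + 1)) ∧
      ∀ i, wordMark v i = wordMark w i := by
    intro e w
    induction e with
    | zero => exact ⟨w, rfl, rfl, fun _ => rfl, fun _ => rfl⟩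
    | succ e ih =>
      obtain ⟨v, h1, h2, h3, h4⟩ := ih
      exact ⟨0 :: v, by simpa using h1, by simp [h2, add_assoc], by simpa using h3,
        by simpa using h4⟩
  induction G generalizing g d with
  | zero =>
    obtain ⟨v, h1, h2, h3, h4⟩ := pad (g 0) []
    refine ⟨v, by simpa using h1, fun i => ?_, fun i => by simpa [hd0 i] using h4 i⟩
    cases i with
    | zero => simpa using h2
    | succ i => simpa [hg0 (i + 1)] using h3 i
  | succ G ih =>
    obtain ⟨w, w1, w2, w3⟩ := ih (fun i => g (i + 1)) (fun i => d (i + 1))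
      (fun i => hd _) (fun i hi => hd0 _ (by omega)) (fun i hi => hg0 _ (by omega))
    obtain ⟨z, hz, hzd⟩ : ∃ z : Fin 3, z ≠ 0 ∧ z.val - 1 = d 0 := by
      have := hd 0
      interval_cases d 0
      · exact ⟨1, by decide, rfl⟩
      · exact ⟨2, by decide, rfl⟩
    obtain ⟨v, h1, h2, h3, h4⟩ := pad (g 0) (z :: w)
    refine ⟨v, by rw [h1, wordCount_letter hz, w1], fun i => ?_, fun i => ?_⟩
    · cases i with
      | zero => simpa [wordGap_letter_zero hz] using h2
      | succ i => simpa [wordGap_letter_succ hz, w2] using h3 i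
    · rw [h4]
      cases i with
      | zero => rw [wordMark_letter_zero hz, hzd]
      | succ i => rw [wordMark_letter_succ hz, w3]

/-- The nonzero letters of a word sit at the positions prescribed by its gaps. -/
lemma getElem?_ne_zero_iff (w : List (Fin 3)) (p : ℕ) :
    (∃ z, w[p]? = some z ∧ z ≠ 0) ↔
      ∃ i < wordCount w, p = i + ∑ j ∈ Finset.range (i + 1), wordGap w j := by
  induction w generalizing p with
  | nil => simp
  | cons z w ih =>
    by_cases hz : z = 0
    · subst hz
      have hs : ∀ i, ∑ j ∈ Finset.range (i + 1), wordGap (0 :: w) j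
          = ∑ j ∈ Finset.range (i + 1), wordGap w j + 1 := by
        intro i
        rw [Finset.sum_range_succ', Finset.sum_range_succ' (fun j => wordGap w j)]
        simp [add_assoc]
      simp only [hs, wordCount_zero]
      cases p with
      | zero => simp
      | succ p =>
        simp only [List.getElem?_cons_succ, ih]
        exact exists_congr fun i => and_congr_right fun _ => by omega
    · have hs : ∀ i, ∑ j ∈ Finset.range (i + 1), wordGap (z :: w) j
          = ∑ j ∈ Finset.range i, wordGap w j := by
        intro i
        rw [Finset.sum_range_succ']
        simp [wordGap_letter_succ hz, wordGap_letter_zero hz]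
      simp only [hs, wordCount_letter hz]
      cases p with
      | zero =>
        simp only [List.getElem?_cons_zero, Option.some.injEq]
        exact ⟨fun _ => ⟨0, by omega, by simp⟩, fun _ => ⟨z, rfl, hz⟩⟩
      | succ p =>
        simp only [List.getElem?_cons_succ, ih]
        constructor
        · rintro ⟨i, hi, rfl⟩
          exact ⟨i + 1, by omega, by omega⟩
        · rintro ⟨i, hi, h⟩
          obtain ⟨j, rfl⟩ : ∃ j, i = j + 1 := by
            cases i with
            | zero => simp at h
            | succ j => exact ⟨j, rfl⟩
          exact ⟨j, by omega, by omega⟩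

/-! ### Strips of a puzzle -/

/-- `Strip c x w w'` says that the unit triangles between the consecutive lines `w` and `w'`
parallel to the northeast side can be labeled, with end labels `x` and `c`. -/
inductive Strip (c : Fin 3) : Fin 3 → List (Fin 3) → List (Fin 3) → Prop
  | nil {x y} : ValidUp x y c → Strip c x [] [y]
  | cons {x y t z x' w w'} : ValidUp x y t → ValidDown t z x' → Strip c x' w w' →
      Strip c x (z :: w) (y :: w')

/-- The relation between the gaps and marks of two consecutive lines. -/
def Linked (c x δ : ℕ) (w w' : List (Fin 3)) : Prop :=
  wordCount w' = wordCount w + c ∧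
  (∃ X : ℕ → ℕ, X 0 = x ∧
    (∀ i, X i + wordMark w' i = X (i + 1) + wordMark w i ∧ X i + wordMark w' i ≤ 1) ∧
    ∀ i, wordCount w' ≤ i → X i = c) ∧
  wordGap w' 0 + wordMark w' 0 = wordGap w 0 + δ ∧
  ∀ i, wordGap w' (i + 1) + wordMark w' (i + 1) = wordGap w (i + 1) + wordMark w i

lemma linked_zero_left {c x δ : ℕ} {w w' : List (Fin 3)} :
    Linked c x δ (0 :: w) w' ↔ Linked c x (δ + 1) w w' := by
  simp only [Linked, wordCount_zero, wordMark_zero, wordGap_zero_zero, wordGap_zero_succ]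
  rw [show wordGap w 0 + 1 + δ = wordGap w 0 + (δ + 1) by omega]

lemma linked_zero_right {c x δ : ℕ} {w w' : List (Fin 3)} :
    Linked c x (δ + 1) w (0 :: w') ↔ Linked c x δ w w' := by
  simp only [Linked, wordCount_zero, wordMark_zero, wordGap_zero_zero, wordGap_zero_succ]
  rw [show wordGap w' 0 + 1 + wordMark w' 0 = wordGap w 0 + (δ + 1) ↔
    wordGap w' 0 + wordMark w' 0 = wordGap w 0 + δ by omega]

lemma linked_letter {c x δ : ℕ} {z y : Fin 3} (hz : z ≠ 0) (hy : y ≠ 0)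
    {w w' : List (Fin 3)} :
    Linked c x δ (z :: w) (y :: w') ↔ y.val - 1 = δ ∧ x + (y.val - 1) ≤ 1 ∧
      ∃ x', x + (y.val - 1) = x' + (z.val - 1) ∧ Linked c x' (z.val - 1) w w' := by
  simp only [Linked, wordCount_letter hz, wordCount_letter hy, wordGap_letter_zero hz,
    wordGap_letter_zero hy, wordGap_letter_succ hz, wordGap_letter_succ hy,
    wordMark_letter_zero hy, wordMark_letter_succ hy]
  constructor
  · rintro ⟨h1, ⟨X, hx, hX, hc⟩, h3, h4⟩
    have h0 := hX 0
    simp only [wordMark_letter_zero hz, wordMark_letter_zero hy, hx] at h0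
    refine ⟨by omega, by omega, X 1, by simpa using h0.1, by omega,
      ⟨fun i => X (i + 1), rfl, fun i => ?_, fun i hi => hc _ (by omega)⟩, ?_, fun i => ?_⟩
    · simpa [wordMark_letter_succ hz, wordMark_letter_succ hy] using hX (i + 1)
    · simpa [wordMark_letter_zero hz] using h4 0
    · simpa [wordMark_letter_succ hz] using h4 (i + 1)
  · rintro ⟨h1, h2, x', h3, h4, ⟨X, hx, hX, hc⟩, h5, h6⟩
    refine ⟨by omega, ⟨fun i => if i = 0 then x else X (i - 1), by simp, fun i => ?_,
      fun i hi => ?_⟩, by omega, fun i => ?_⟩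
    · cases i with
      | zero => simpa [wordMark_letter_zero hz, wordMark_letter_zero hy, hx, h3] using h3 ▸ h2
      | succ i => simpa [wordMark_letter_succ hz, wordMark_letter_succ hy] using hX i
    · dsimp only; rw [if_neg (by omega)]; exact hc _ (by omega)
    · cases i with
      | zero => simpa [wordMark_letter_zero hz] using h5
      | succ i => simpa [wordMark_letter_succ hz] using h6 i

lemma linked_one_one {c x δ : ℕ} {w w' : List (Fin 3)} :
    Linked c x δ (1 :: w) (1 :: w') ↔ δ = 0 ∧ x ≤ 1 ∧ Linked c x 0 w w' := by
  rw [linked_letter (by decide) (by decide)]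
  simp [eq_comm]

lemma linked_one_two {c x δ : ℕ} {w w' : List (Fin 3)} :
    Linked c x δ (1 :: w) (2 :: w') ↔ δ = 1 ∧ x = 0 ∧ Linked c 1 0 w w' := by
  rw [linked_letter (by decide) (by decide)]
  simp only [Fin.val_one, Fin.val_two, Nat.add_one_sub_one, Nat.sub_self, add_zero]
  constructor
  · rintro ⟨h1, h2, x', h3, h4⟩
    obtain rfl : x = 0 := by omega
    exact ⟨h1.symm, rfl, by simpa [← h3] using h4⟩
  · rintro ⟨rfl, rfl, h⟩
    exact ⟨rfl, le_rfl, 1, rfl, h⟩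

lemma linked_two_one {c x δ : ℕ} {w w' : List (Fin 3)} :
    Linked c x δ (2 :: w) (1 :: w') ↔ δ = 0 ∧ x = 1 ∧ Linked c 0 1 w w' := by
  rw [linked_letter (by decide) (by decide)]
  simp only [Fin.val_one, Fin.val_two, Nat.add_one_sub_one, Nat.sub_self, add_zero]
  constructor
  · rintro ⟨h1, h2, x', h3, h4⟩
    obtain rfl : x' = 0 := by omega
    exact ⟨h1.symm, by omega, h4⟩
  · rintro ⟨rfl, rfl, h⟩
    exact ⟨rfl, le_rfl, 0, rfl, h⟩

lemma linked_two_two {c x δ : ℕ} {w w' : List (Fin 3)} :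
    Linked c x δ (2 :: w) (2 :: w') ↔ δ = 1 ∧ x = 0 ∧ Linked c 0 1 w w' := by
  rw [linked_letter (by decide) (by decide)]
  simp only [Fin.val_two, Nat.add_one_sub_one]
  constructor
  · rintro ⟨h1, h2, x', h3, h4⟩
    obtain rfl : x' = 0 := by omega
    exact ⟨h1.symm, by omega, h4⟩
  · rintro ⟨rfl, rfl, h⟩
    exact ⟨rfl, le_rfl, 0, rfl, h⟩

/-- The part of the word `w'` not yet accounted for when a strip is in state `s`. -/
def LinkedAt (c s : Fin 3) (w w' : List (Fin 3)) : Prop :=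
  (s = 0 ∧ Linked c 0 1 w w') ∨ (s = 1 ∧ Linked c 1 0 w w') ∨
    (s = 2 ∧ ∃ v, w' = 1 :: v ∧ Linked c 0 0 w v)

lemma LinkedAt.of_strip {c s : Fin 3} (hc : c ≠ 2) {w w' : List (Fin 3)}
    (h : Strip c s w w') : LinkedAt c s w w' := by
  have e1 : ((1 : Fin 3) : ℕ) = 1 := rfl
  have e2 : ((2 : Fin 3) : ℕ) = 2 := rfl
  have n1 : (1 : Fin 3) ≠ 0 := by decide
  have n2 : (2 : Fin 3) ≠ 0 := by decide
  induction h with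
  | nil hv =>
    rcases hv with ⟨rfl, rfl, rfl⟩ | ⟨rfl, rfl, rfl⟩ | ⟨rfl, rfl, rfl⟩ | ⟨rfl, rfl, rfl⟩ |
      ⟨rfl, rfl, rfl⟩
    · refine Or.inl ⟨rfl, by simp, ⟨fun _ => 0, by simp⟩, by simp, by simp⟩
    · refine Or.inr (Or.inl ⟨rfl, by simp [wordCount], ⟨fun _ => 1, rfl, ?_, by simp⟩,
        by simp [wordGap, wordMark], by simp [wordGap, wordMark]⟩)
      rintro (_ | i) <;> simp [wordMark]
    · exact absurd rfl hc
    · exact Or.inr (Or.inr ⟨rfl, [], rfl, by simp, ⟨fun _ => 0, by simp⟩, by simp, by simp⟩)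
    · refine Or.inl ⟨rfl, by simp [wordCount], ⟨fun i => if i = 0 then 0 else 1, rfl, ?_, ?_⟩,
        by simp [wordGap, wordMark], by simp [wordGap, wordMark]⟩
      · rintro (_ | i) <;> simp [wordMark]
      · intro i hi
        rw [wordCount_letter n2] at hi
        dsimp only; rw [if_neg (by omega)]; rfl
  | cons hu hd _ ih =>
    rcases hu with ⟨rfl, rfl, rfl⟩ | ⟨rfl, rfl, rfl⟩ | ⟨rfl, rfl, rfl⟩ | ⟨rfl, rfl, rfl⟩ |
      ⟨rfl, rfl, rfl⟩ <;>
    rcases hd with ⟨h, rfl, rfl⟩ | ⟨h, rfl, rfl⟩ | ⟨h, rfl, rfl⟩ | ⟨h, rfl, rfl⟩ |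
      ⟨h, rfl, rfl⟩ <;>
    first
    | exact absurd h (by decide)
    | skip
    all_goals
      simp only [LinkedAt, Fin.isValue, zero_ne_one, one_ne_zero, Fin.reduceEq, true_and,
        false_and, or_false, false_or] at ih ⊢
      first
      | obtain ⟨v, rfl, ih⟩ := ih
        simpa [linked_zero_right (δ := 0), linked_one_one] using ih
      | simpa [linked_zero_left, linked_zero_right (δ := 0), linked_zero_right (δ := 1),
          linked_one_one, linked_one_two, linked_two_one, linked_two_two] using ih

lemma linked_nil {c x δ : ℕ} (hc : c ≤ 1) (hx : x + δ ≤ 1) {v : List (Fin 3)}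
    (h : Linked c x δ [] v) :
    (c = 0 ∧ x = 0 ∧ v = List.replicate δ 0) ∨ (c = 1 ∧ x = 0 ∧ δ = 1 ∧ v = [2]) ∨
      (c = 1 ∧ x = 1 ∧ δ = 0 ∧ v = [1]) := by
  obtain ⟨h1, ⟨X, hX0, hX, hXc⟩, h3, h4⟩ := h
  simp only [wordCount_nil, zero_add, wordMark_nil, wordGap_nil, add_zero] at h1 hX h3 h4
  have hm : ∀ i, c ≤ i → wordMark v i = 0 := fun i hi => wordMark_eq_zero v i (by omega)
  have hg : ∀ i, wordGap v (i + 1) = 0 := fun i => by have := h4 i; omega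
  interval_cases c
  · refine Or.inl ⟨rfl, by rw [← hX0, hXc 0 (by omega)], ?_⟩
    have h0 := hm 0 le_rfl
    have : δ ≤ 1 := by omega
    interval_cases δ
    · refine word_ext (by simpa using h1) (fun i => ?_) (fun i => by simpa using hm i)
      cases i with
      | zero => simp; omega
      | succ i => simpa using hg i
    · refine word_ext (by simpa using h1) (fun i => ?_) (fun i => by simpa using hm i)
      cases i with
      | zero => simp; omega
      | succ i => simpa using hg i
  · have hx1 := hX 0
    rw [hX0, hXc 1 (by omega)] at hx1
    right
    have hx' : x ≤ 1 := by omega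
    interval_cases x
    · refine Or.inl ⟨rfl, rfl, by omega, word_ext (by simpa [wordCount] using h1)
        (fun i => ?_) (fun i => ?_)⟩
      · cases i with
        | zero => simp [wordGap]; omega
        | succ i => simpa [wordGap] using hg i
      · cases i with
        | zero => simp [wordMark]; omega
        | succ i => simpa [wordMark] using hm (i + 1) (by omega)
    · refine Or.inr ⟨rfl, rfl, by omega, word_ext (by simpa [wordCount] using h1)
        (fun i => ?_) (fun i => ?_)⟩
      · cases i with
        | zero => simp [wordGap]; omega
        | succ i => simpa [wordGap] using hg i
      · cases i with
        | zero => simp [wordMark]; omega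
        | succ i => simpa [wordMark] using hm (i + 1) (by omega)

lemma Linked.head_zero {c x δ : ℕ} {w v : List (Fin 3)} (h : Linked c x (δ + 1) w v)
    (hx : 1 ≤ x + δ) : ∃ v', v = 0 :: v' := by
  obtain ⟨-, ⟨X, hX0, hX, -⟩, h3, -⟩ := h
  have h0 := (hX 0).2
  have hg : wordGap v 0 ≠ 0 := by omega
  cases v with
  | nil => simp at hg
  | cons y v =>
    by_cases hy : y = 0
    · exact ⟨v, by rw [hy]⟩
    · exact absurd (wordGap_letter_zero hy v) hg

lemma Linked.head_one {c x : ℕ} {z : Fin 3} {w v : List (Fin 3)}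
    (h : Linked c x 0 (z :: w) v) (hz : z ≠ 0) : ∃ v', v = 1 :: v' := by
  obtain ⟨h1, -, h3, -⟩ := h
  rw [wordCount_letter hz] at h1
  rw [wordGap_letter_zero hz] at h3
  cases v with
  | nil => simp at h1; omega
  | cons y v =>
    have hy : y = 0 ∨ y = 1 ∨ y = 2 := by fin_cases y <;> simp
    rcases hy with rfl | rfl | rfl
    · simp at h3
    · exact ⟨v, rfl⟩
    · simp [wordMark] at h3

lemma Linked.head_cases {c x : ℕ} {z : Fin 3} {w v : List (Fin 3)}
    (h : Linked c x 1 (z :: w) v) :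
    (∃ v', v = 0 :: v') ∨ (∃ v', v = 1 :: v') ∨ ∃ v', v = 2 :: v' := by
  obtain ⟨-, -, h3, -⟩ := h
  cases v with
  | nil => simp at h3
  | cons y v => fin_cases y <;> simp

lemma LinkedAt.strip {c s : Fin 3} (hc : c ≠ 2) {w w' : List (Fin 3)}
    (h : LinkedAt c s w w') : Strip c s w w' := by
  have n1 : (1 : Fin 3) ≠ 0 := by decide
  have n2 : (2 : Fin 3) ≠ 0 := by decide
  have hc01 : c = 0 ∨ c = 1 := by
    fin_cases c <;> simp at hc ⊢
  have hc1 : (c : ℕ) ≤ 1 := by rcases hc01 with rfl | rfl <;> decide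
  have up00 : ValidUp 0 0 0 := Or.inl ⟨rfl, rfl, rfl⟩
  have up11 : ValidUp 1 1 1 := Or.inr (Or.inl ⟨rfl, rfl, rfl⟩)
  have up10 : ValidUp 1 0 2 := Or.inr (Or.inr (Or.inl ⟨rfl, rfl, rfl⟩))
  have up21 : ValidUp 2 1 0 := Or.inr (Or.inr (Or.inr (Or.inl ⟨rfl, rfl, rfl⟩)))
  have up02 : ValidUp 0 2 1 := Or.inr (Or.inr (Or.inr (Or.inr ⟨rfl, rfl, rfl⟩)))
  have dn00 : ValidDown 0 0 0 := Or.inl ⟨rfl, rfl, rfl⟩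
  have dn11 : ValidDown 1 1 1 := Or.inr (Or.inl ⟨rfl, rfl, rfl⟩)
  have dn12 : ValidDown 1 2 0 := Or.inr (Or.inr (Or.inl ⟨rfl, rfl, rfl⟩))
  have dn20 : ValidDown 2 0 1 := Or.inr (Or.inr (Or.inr (Or.inl ⟨rfl, rfl, rfl⟩)))
  have dn01 : ValidDown 0 1 2 := Or.inr (Or.inr (Or.inr (Or.inr ⟨rfl, rfl, rfl⟩)))
  have c0 : ∀ {c : Fin 3}, (c : ℕ) = 0 → c = 0 := fun h => Fin.ext h
  have c1 : ∀ {c : Fin 3}, (c : ℕ) = 1 → c = 1 := fun h => Fin.ext h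
  induction w generalizing s w' with
  | nil =>
    rcases h with ⟨rfl, hl⟩ | ⟨rfl, hl⟩ | ⟨rfl, v, rfl, hl⟩
    · rcases linked_nil hc1 (by omega) hl with ⟨h, -, rfl⟩ | ⟨h, -, -, rfl⟩ | ⟨_, h, _⟩
      · obtain rfl := c0 h; exact .nil up00
      · obtain rfl := c1 h; exact .nil up02
      · omega
    · rcases linked_nil hc1 (by omega) hl with ⟨_, h, _⟩ | ⟨_, h, _⟩ | ⟨h, -, -, rfl⟩
      · omega
      · omega
      · obtain rfl := c1 h; exact .nil up11
    · rcases linked_nil hc1 (by omega) hl with ⟨h, -, rfl⟩ | ⟨_, _, h, _⟩ | ⟨_, h, _⟩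
      · obtain rfl := c0 h; exact .nil up21
      · omega
      · omega
  | cons z w ih =>
    have hz : z = 0 ∨ z = 1 ∨ z = 2 := by fin_cases z <;> simp
    rcases hz with rfl | rfl | rfl
    · rcases h with ⟨rfl, h⟩ | ⟨rfl, h⟩ | ⟨rfl, v, rfl, h⟩
      · rw [linked_zero_left] at h
        obtain ⟨v, rfl⟩ := h.head_zero (by omega)
        exact .cons up00 dn00 (ih (Or.inl ⟨rfl, linked_zero_right.1 h⟩))
      · rw [linked_zero_left] at h
        obtain ⟨v, rfl⟩ := h.head_zero (by omega)
        exact .cons up10 dn20 (ih (Or.inr (Or.inl ⟨rfl, linked_zero_right.1 h⟩)))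
      · rw [linked_zero_left] at h
        exact .cons up21 dn00 (ih (Or.inl ⟨rfl, h⟩))
    · rcases h with ⟨rfl, h⟩ | ⟨rfl, h⟩ | ⟨rfl, v, rfl, h⟩
      · rcases h.head_cases with ⟨v, rfl⟩ | ⟨v, rfl⟩ | ⟨v, rfl⟩
        · rw [linked_zero_right (δ := 0)] at h
          obtain ⟨v, rfl⟩ := h.head_one n1
          rw [linked_one_one] at h
          exact .cons up00 dn01 (ih (Or.inr (Or.inr ⟨rfl, v, rfl, h.2.2⟩)))
        · exact absurd (linked_one_one.1 h).1 one_ne_zero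
        · exact .cons up02 dn11 (ih (Or.inr (Or.inl ⟨rfl, (linked_one_two.1 h).2.2⟩)))
      · obtain ⟨v, rfl⟩ := h.head_one n1
        exact .cons up11 dn11 (ih (Or.inr (Or.inl ⟨rfl, (linked_one_one.1 h).2.2⟩)))
      · obtain ⟨v, rfl⟩ := h.head_one n1
        exact .cons up21 dn01 (ih (Or.inr (Or.inr ⟨rfl, v, rfl, (linked_one_one.1 h).2.2⟩)))
    · rcases h with ⟨rfl, h⟩ | ⟨rfl, h⟩ | ⟨rfl, v, rfl, h⟩
      · rcases h.head_cases with ⟨v, rfl⟩ | ⟨v, rfl⟩ | ⟨v, rfl⟩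
        · rw [linked_zero_right (δ := 0)] at h
          obtain ⟨v, rfl⟩ := h.head_one n2
          exact absurd (linked_two_one.1 h).2.1 zero_ne_one
        · exact absurd (linked_two_one.1 h).1 one_ne_zero
        · exact .cons up02 dn12 (ih (Or.inl ⟨rfl, (linked_two_two.1 h).2.2⟩))
      · obtain ⟨v, rfl⟩ := h.head_one n2
        exact .cons up11 dn12 (ih (Or.inl ⟨rfl, (linked_two_one.1 h).2.2⟩))
      · obtain ⟨v, rfl⟩ := h.head_one n2
        exact absurd (linked_two_one.1 h).2.1 zero_ne_one

lemma strip_iff {a c : Fin 3} (ha : a ≠ 2) (hc : c ≠ 2) {w w' : List (Fin 3)} :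
    Strip c a w w' ↔ Linked c a (1 - a.val) w w' := by
  have h : Strip c a w w' ↔ LinkedAt c a w w' := ⟨LinkedAt.of_strip hc, LinkedAt.strip hc⟩
  rw [h]
  have ha : a = 0 ∨ a = 1 := by fin_cases a <;> simp at ha ⊢
  rcases ha with rfl | rfl <;> simp [LinkedAt]

lemma word_length (w : List (Fin 3)) :
    w.length = wordCount w + ∑ j ∈ Finset.range (wordCount w + 1), wordGap w j := by
  induction w with
  | nil => simp
  | cons z w ih =>
    rw [List.length_cons, ih]
    by_cases hz : z = 0
    · subst hz
      rw [wordCount_zero, Finset.sum_range_succ', Finset.sum_range_succ' _ (wordCount w)]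
      simp [add_assoc]
    · rw [wordCount_letter hz, Finset.sum_range_succ' _ (wordCount w + 1)]
      simp [wordGap_letter_succ hz, wordGap_letter_zero hz]
      omega

/-! ### Strings of partitions -/

lemma lt_card_filter_range_iff {p : ℕ → Prop} [DecidablePred p] (hp : ∀ i, p (i + 1) → p i)
    (k i : ℕ) :
    i < ((Finset.range k).filter p).card ↔ i < k ∧ p i := by
  induction k with
  | zero => simp
  | succ k ih =>
    rw [Finset.range_add_one, Finset.filter_insert]
    split_ifs with hk
    · have hall : ∀ i ≤ k, p i := fun i hi => Nat.decreasingInduction (fun i _ => hp i) hk hi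
      have : (Finset.range k).filter p = Finset.range k :=
        Finset.filter_true_of_mem fun i hi => hall i (Finset.mem_range.1 hi).le
      rw [Finset.card_insert_of_notMem (by simp), this, Finset.card_range]
      exact ⟨fun h => ⟨h, hall i (by omega)⟩, fun h => h.1⟩
    · rw [ih]
      refine ⟨fun h => ⟨by omega, h.2⟩, fun h => ⟨?_, h.2⟩⟩
      rcases Nat.lt_succ_iff_lt_or_eq.1 h.1 with h' | rfl
      · exact h'
      · exact absurd h.2 hk

/-- The number of ones among the first `m` letters of the string of `lam`. -/
noncomputable def onesBefore (h k : ℕ) (lam : ℕ → ℕ) (m : ℕ) : ℕ :=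
  ((Finset.range k).filter fun i => h + i - lam i < m).card

section Ones

variable {h k : ℕ} {lam : ℕ → ℕ}

lemma IsRectPartition.le (hl : IsRectPartition (h + k) k lam) (i : ℕ) : lam i ≤ h := by
  simpa using hl.2.1 i

lemma lt_onesBefore_iff (hl : IsRectPartition (h + k) k lam) (m i : ℕ) :
    i < onesBefore h k lam m ↔ i < k ∧ h + i - lam i < m := by
  refine lt_card_filter_range_iff (fun i hi => ?_) k i
  have h1 := hl.le i
  have h2 := hl.le (i + 1)
  have h3 := hl.1 (Nat.le_succ i)
  simp only [Nat.succ_eq_add_one] at h3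
  omega

lemma onesBefore_le (h k : ℕ) (lam : ℕ → ℕ) (m : ℕ) : onesBefore h k lam m ≤ k :=
  (Finset.card_filter_le _ _).trans (by simp)

lemma onesBefore_zero (h k : ℕ) (lam : ℕ → ℕ) : onesBefore h k lam 0 = 0 := by
  simp [onesBefore]

lemma onesBefore_of_le (h k : ℕ) (lam : ℕ → ℕ) {m : ℕ} (hm : h + k ≤ m) :
    onesBefore h k lam m = k := by
  rw [onesBefore, Finset.filter_true_of_mem, Finset.card_range]
  intro i hi
  rw [Finset.mem_range] at hi
  omega

lemma strOf_ne_two (n k : ℕ) (lam : ℕ → ℕ) (p : ℕ) : strOf n k lam p ≠ 2 := by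
  unfold strOf; split_ifs <;> decide

lemma onesBefore_succ (hl : IsRectPartition (h + k) k lam) (m : ℕ) :
    onesBefore h k lam (m + 1) = onesBefore h k lam m + (strOf (h + k) k lam m).val := by
  have hcard := fun m i => lt_onesBefore_iff hl m i
  have hstep : onesBefore h k lam m ≤ onesBefore h k lam (m + 1) :=
    le_of_forall_lt fun i hi => by rw [hcard] at hi ⊢; omega
  unfold strOf
  simp only [Nat.add_sub_cancel]
  split_ifs with hex
  · obtain ⟨i, hi, him⟩ := hex
    have h1 : i < onesBefore h k lam (m + 1) := by rw [hcard]; omega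
    have h2 : ¬ i < onesBefore h k lam m := by rw [hcard]; omega
    have h3 : ¬ i + 1 < onesBefore h k lam (m + 1) := by
      rw [hcard]
      have := hl.1 (Nat.le_succ i)
      have := hl.le i
      simp only [Nat.succ_eq_add_one] at *
      omega
    have h4 : i ≤ onesBefore h k lam m := le_of_forall_lt fun i' hi' => by
      rw [hcard]
      have := hl.1 hi'.le
      have := hl.le i'
      omega
    simp only [Fin.val_one]; omega
  · simp only [Fin.val_zero, add_zero]
    refine le_antisymm (le_of_forall_lt fun i hi => ?_) hstep
    rw [hcard] at hi ⊢
    have hne : m ≠ h + i - lam i := fun he => hex ⟨i, hi.1, he⟩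
    omega

lemma onesBefore_mono (h k : ℕ) (lam : ℕ → ℕ) : Monotone (onesBefore h k lam) := by
  intro m m' hm
  exact Finset.card_le_card fun i hi => by
    simp only [Finset.mem_filter] at hi ⊢; exact ⟨hi.1, by omega⟩

/-- The gaps of the string of a partition are the differences of its consecutive parts. -/
lemma word_strOf (hl : IsRectPartition (h + k) k lam) :
    wordCount ((List.range (h + k)).map (strOf (h + k) k lam)) = k ∧
    (∀ i, wordMark ((List.range (h + k)).map (strOf (h + k) k lam)) i = 0) ∧
    wordGap ((List.range (h + k)).map (strOf (h + k) k lam)) 0 + lam 0 = h ∧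
    ∀ i, wordGap ((List.range (h + k)).map (strOf (h + k) k lam)) (i + 1) + lam (i + 1) =
      lam i := by
  obtain ⟨w, hc, hg, hm⟩ := exists_word k
    (fun i => if i = 0 then h - lam 0 else lam (i - 1) - lam i) (fun _ => 0) (by simp) (by simp)
    (fun i hi => by rw [if_neg (by omega), hl.2.2 _ (by omega : k ≤ i - 1), Nat.zero_sub])
  have hg0 : wordGap w 0 + lam 0 = h := by
    rw [hg]; simp [hl.le 0]
  have hg1 : ∀ i, wordGap w (i + 1) + lam (i + 1) = lam i := fun i => by
    rw [hg]; simp [hl.1 (Nat.le_succ i)]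
  have hsum : ∀ i, ∑ j ∈ Finset.range (i + 1), wordGap w j + lam i = h := by
    intro i
    induction i with
    | zero => simpa using hg0
    | succ i ih =>
      rw [Finset.sum_range_succ]
      have := hg1 i
      omega
  have hlen : w.length = h + k := by
    rw [word_length, hc]
    have := hsum k
    rw [hl.2.2 k le_rfl] at this
    omega
  suffices hw : w = (List.range (h + k)).map (strOf (h + k) k lam) by
    rw [← hw]; exact ⟨hc, hm, hg0, hg1⟩
  have htwo : ∀ z ∈ w, z ≠ 2 := by
    clear hlen hsum hg0 hg1 hg hc
    induction w with
    | nil => simp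
    | cons z w ih =>
      by_cases hz : z = 0
      · subst hz
        simp only [List.mem_cons, forall_eq_or_imp]
        exact ⟨by decide, ih fun i => by simpa using hm i⟩
      · simp only [List.mem_cons, forall_eq_or_imp]
        refine ⟨?_, ih fun i => by simpa [wordMark_letter_succ hz] using hm (i + 1)⟩
        rintro rfl
        simpa [wordMark] using hm 0
  refine List.ext_getElem (by simpa using hlen) fun p hp _ => ?_
  have hpos := getElem?_ne_zero_iff w p
  rw [List.getElem?_eq_getElem hp] at hpos
  simp only [Option.some.injEq, exists_eq_left', hc] at hpos
  have hex : (∃ i < k, p = i + ∑ j ∈ Finset.range (i + 1), wordGap w j) ↔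
      ∃ i, i < k ∧ p = h + k - k + i - lam i := by
    refine exists_congr fun i => and_congr_right fun _ => ?_
    have := hsum i
    omega
  rw [hex] at hpos
  have h2 := htwo _ (List.getElem_mem hp)
  simp only [List.getElem_map, List.getElem_range, strOf]
  generalize w[p] = z at *
  split_ifs with hq
  · have := hpos.2 hq
    fin_cases z <;> simp at *
  · have : ¬ z ≠ 0 := fun hz => hq (hpos.1 hz)
    simpa using this

end Ones

/-! ### Height functions -/

/-- The number of steps `t ≤ m` at which the mark `j` is set. -/
def heightContent (N : ℕ → ℕ → ℕ) (m j : ℕ) : ℕ :=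
  ∑ t ∈ Finset.range (m + 1), (N t (j + 1) - N t j)

/-- Height functions interpolate between puzzles and Littlewood–Richardson tableaux:
`N m j` counts the rows whose entry on the `m`-th diagonal is at most `j`. -/
structure IsHeight (h k : ℕ) (la lb lc : ℕ → ℕ) (N : ℕ → ℕ → ℕ) : Prop where
  bot : ∀ m, N m 0 = onesBefore h k la m
  top : ∀ m j, k ≤ j → N m j = onesBefore h k lc m
  mono_left : ∀ m j, N m j ≤ N (m + 1) j
  mono_right : ∀ m j, N m j ≤ N m (j + 1)
  diag : ∀ m j, N (m + 1) (j + 1) ≤ N m j + 1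
  lattice : ∀ m j, heightContent N (m + 1) (j + 1) ≤ heightContent N m j
  content : ∀ j, heightContent N (h + k) j = lb j

/-- The sequences of lines, parallel to the northeast side, of a puzzle. -/
def IsLineSeq (n : ℕ) (a b c : ℕ → Fin 3) (W : ℕ → List (Fin 3)) : Prop :=
  (∀ m, n < m → W m = []) ∧ W 0 = [] ∧
    (∀ m, m < n → Strip (c m) (a m) (W m) (W (m + 1))) ∧ W n = (List.range n).map b

/-- The word `w` is the `m`-th line attached to the height function `N`. -/
def Encodes (h k : ℕ) (la lc : ℕ → ℕ) (N : ℕ → ℕ → ℕ) (m : ℕ) (w : List (Fin 3)) : Prop :=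
  wordCount w = onesBefore h k lc m ∧
  (∀ i, wordMark w i = N m (i + 1) - N m i) ∧
  wordGap w 0 + heightContent N m 0 + onesBefore h k la m = m ∧
  ∀ i, wordGap w (i + 1) + heightContent N m (i + 1) + wordMark w i = heightContent N m i

lemma heightContent_succ (N : ℕ → ℕ → ℕ) (m j : ℕ) :
    heightContent N (m + 1) j = heightContent N m j + (N (m + 1) (j + 1) - N (m + 1) j) :=
  Finset.sum_range_succ _ _

lemma heightContent_zero (N : ℕ → ℕ → ℕ) (j : ℕ) :
    heightContent N 0 j = N 0 (j + 1) - N 0 j := by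
  simp [heightContent]

lemma Encodes.unique {h k : ℕ} {la lc : ℕ → ℕ} {N : ℕ → ℕ → ℕ} {m : ℕ} {w w' : List (Fin 3)}
    (hw : Encodes h k la lc N m w) (hw' : Encodes h k la lc N m w') : w = w' := by
  obtain ⟨h1, h2, h3, h4⟩ := hw
  obtain ⟨h1', h2', h3', h4'⟩ := hw'
  refine word_ext (h1.trans h1'.symm) (fun i => ?_) fun i => (h2 i).trans (h2' i).symm
  cases i with
  | zero => omega
  | succ i =>
    have := h4 i
    have := h4' i
    have := h2 i
    have := h2' i
    omega

namespace IsHeight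

variable {h k : ℕ} {la lb lc : ℕ → ℕ} {N : ℕ → ℕ → ℕ}

lemma le_top (hN : IsHeight h k la lb lc N) (m j : ℕ) : N m j ≤ onesBefore h k lc m := by
  rw [← hN.top m (j + k) (by omega)]
  exact monotone_nat_of_le_succ (hN.mono_right m) (by omega)

lemma bot_le (hN : IsHeight h k la lb lc N) (m j : ℕ) : onesBefore h k la m ≤ N m j := by
  rw [← hN.bot m]
  exact monotone_nat_of_le_succ (hN.mono_right m) (by omega)

lemma eq_of_le (hN : IsHeight h k la lb lc N) {m : ℕ} (hm : h + k ≤ m) (j : ℕ) : N m j = k := by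
  have h1 := hN.le_top m j
  have h2 := hN.bot_le m j
  rw [onesBefore_of_le h k _ hm] at h1 h2
  omega

lemma zero_left (hN : IsHeight h k la lb lc N) (j : ℕ) : N 0 j = 0 := by
  have h1 := hN.le_top 0 j
  rw [onesBefore_zero] at h1
  omega

lemma heightContent_eq_zero_of_stable {N : ℕ → ℕ → ℕ} {h k : ℕ} {lc : ℕ → ℕ} {m j : ℕ}
    (hs : ∀ t ≤ m, ∀ j, onesBefore h k lc t ≤ j → N t j = onesBefore h k lc t)
    (hj : onesBefore h k lc m ≤ j) : heightContent N m j = 0 := by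
  refine Finset.sum_eq_zero fun t ht => ?_
  have ht : t ≤ m := by rw [Finset.mem_range] at ht; omega
  have := onesBefore_mono h k lc ht
  rw [hs t ht j (by omega), hs t ht (j + 1) (by omega), Nat.sub_self]

lemma stable (hN : IsHeight h k la lb lc N) (hc : IsRectPartition (h + k) k lc) (m j : ℕ)
    (hj : onesBefore h k lc m ≤ j) : N m j = onesBefore h k lc m := by
  induction m using Nat.strong_induction_on generalizing j with
  | _ m ih =>
    cases m with
    | zero => rw [hN.zero_left, onesBefore_zero]
    | succ m =>
      have hs := onesBefore_succ hc m
      have h01 := strOf_ne_two (h + k) k lc m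
      generalize strOf (h + k) k lc m = z at hs h01
      have hz : z = 0 ∨ z = 1 := by fin_cases z <;> simp at h01 ⊢
      rcases hz with rfl | rfl
      · have h1 := hN.le_top (m + 1) j
        have h2 := hN.mono_left m j
        simp only [Fin.val_zero, add_zero] at hs
        rw [ih m (by omega) j (by omega)] at h2
        omega
      · simp only [Fin.val_one] at hs
        have hstep : ∀ i, onesBefore h k lc (m + 1) ≤ i → N (m + 1) (i + 1) ≤ N (m + 1) i := by
          intro i hi
          obtain ⟨i, rfl⟩ : ∃ i', i = i' + 1 := ⟨i - 1, by omega⟩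
          have h1 := hN.lattice m i
          rw [heightContent_eq_zero_of_stable (fun t ht => ih t (by omega))
            (by omega : onesBefore h k lc m ≤ i), heightContent_succ] at h1
          omega
        have hall : ∀ e, N (m + 1) (j + e) ≤ N (m + 1) j := by
          intro e
          induction e with
          | zero => rfl
          | succ e ihe => exact (hstep (j + e) (by omega)).trans ihe
        have h1 := hall k
        rw [hN.top (m + 1) (j + k) (by omega)] at h1
        exact le_antisymm (hN.le_top _ _) h1

lemma content_add_le (hN : IsHeight h k la lb lc N) (m : ℕ) :
    heightContent N m 0 + onesBefore h k la m ≤ m := by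
  induction m with
  | zero => simp [heightContent_zero, hN.zero_left, onesBefore_zero]
  | succ m ih =>
    have h1 := hN.diag m 0
    have h2 := hN.mono_right (m + 1) 0
    rw [heightContent_succ]
    simp only [hN.bot, zero_add] at *
    have := onesBefore_mono h k la (Nat.le_succ m)
    omega

lemma exists_encodes (hN : IsHeight h k la lb lc N) (hc : IsRectPartition (h + k) k lc)
    (m : ℕ) : ∃ w, Encodes h k la lc N m w := by
  have hle : ∀ i, N m (i + 1) - N m i ≤ 1 := by
    intro i
    cases m with
    | zero => simp [hN.zero_left]
    | succ m =>
      have := hN.diag m i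
      have := hN.mono_left m i
      omega
  have hst := hN.stable hc
  have hcz : ∀ i, onesBefore h k lc m ≤ i → heightContent N m i = 0 := fun i hi =>
    heightContent_eq_zero_of_stable (fun t _ => hst t) hi
  have hlat : ∀ i, N m (i + 1) - N m i + heightContent N m (i + 1) ≤ heightContent N m i := by
    intro i
    cases m with
    | zero => simp [hN.zero_left, heightContent_zero]
    | succ m =>
      have := hN.lattice m i
      rw [heightContent_succ N m i]
      omega
  obtain ⟨w, h1, h2, h3⟩ := exists_word (onesBefore h k lc m)
    (fun i => if i = 0 then m - onesBefore h k la m - heightContent N m 0 else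
      heightContent N m (i - 1) - (N m (i - 1 + 1) - N m (i - 1)) - heightContent N m i)
    (fun i => N m (i + 1) - N m i) hle
    (fun i hi => by rw [hst m i hi, hst m (i + 1) (by omega), Nat.sub_self])
    (fun i hi => by rw [if_neg (by omega), hcz (i - 1) (by omega)]; simp)
  refine ⟨w, h1, h3, ?_, fun i => ?_⟩
  · rw [h2, if_pos rfl]
    have := hN.content_add_le m
    omega
  · rw [h2, h3, if_neg (by omega)]
    have := hlat i
    simp only [Nat.add_sub_cancel]
    omega

lemma linked (hN : IsHeight h k la lb lc N) (ha : IsRectPartition (h + k) k la)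
    (hc : IsRectPartition (h + k) k lc) {m : ℕ} {w w' : List (Fin 3)}
    (hw : Encodes h k la lc N m w) (hw' : Encodes h k la lc N (m + 1) w') :
    Linked (strOf (h + k) k lc m) (strOf (h + k) k la m) (1 - (strOf (h + k) k la m).val) w w' := by
  obtain ⟨h1, h2, h3, h4⟩ := hw
  obtain ⟨h1', h2', h3', h4'⟩ := hw'
  have hca := onesBefore_succ ha m
  have hcc := onesBefore_succ hc m
  refine ⟨by omega, ⟨fun i => N (m + 1) i - N m i, ?_, fun i => ?_, fun i hi => ?_⟩, ?_,
    fun i => ?_⟩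
  · simp only [hN.bot]; omega
  · have := h2 i
    have := h2' i
    have := hN.mono_left m i
    have := hN.mono_left m (i + 1)
    have := hN.mono_right m i
    have := hN.mono_right (m + 1) i
    have := hN.diag m i
    simp only
    omega
  · have e1 := hN.stable hc m i (by omega)
    have e2 := hN.stable hc (m + 1) i (by omega)
    simp only
    omega
  · have hs := heightContent_succ N m 0
    have := h2' 0
    have := (strOf (h + k) k la m).isLt
    have := hN.content_add_le m
    have h01 : (strOf (h + k) k la m).val ≠ 2 := fun he => strOf_ne_two _ _ _ m (Fin.ext he)
    omega
  · have := heightContent_succ N m i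
    have := heightContent_succ N m (i + 1)
    have := h4 i
    have := h4' i
    have := h2' i
    have := h2' (i + 1)
    omega

end IsHeight

lemma natCard_subtype_eq_of_rel {α β : Type*} {P : α → Prop} {Q : β → Prop} (r : α → β → Prop)
    (hPQ : ∀ a, P a → ∃ b, Q b ∧ r a b) (hQP : ∀ b, Q b → ∃ a, P a ∧ r a b)
    (hl : ∀ a a' b, P a → P a' → Q b → r a b → r a' b → a = a')
    (hr : ∀ a b b', P a → Q b → Q b' → r a b → r a b' → b = b') :
    Nat.card {a // P a} = Nat.card {b // Q b} := by
  choose f hf using hPQ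
  refine Nat.card_eq_of_bijective
    (fun a : {a // P a} => (⟨f a.1 a.2, (hf a.1 a.2).1⟩ : {b // Q b}))
    ⟨fun a a' haa => ?_, fun b => ?_⟩
  · have h1 := (hf a.1 a.2).2
    have h2 := (hf a'.1 a'.2).2
    rw [Subtype.mk.injEq] at haa
    rw [← haa] at h2
    exact Subtype.ext (hl _ _ _ a.2 a'.2 (hf a.1 a.2).1 h1 h2)
  · obtain ⟨a, ha, hab⟩ := hQP b.1 b.2
    exact ⟨⟨a, ha⟩, Subtype.ext (hr _ _ _ ha (hf a ha).1 b.2 (hf a ha).2 hab)⟩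

section LineSeq

variable {h k : ℕ} {la lb lc : ℕ → ℕ}

lemma IsHeight.exists_isLineSeq {N : ℕ → ℕ → ℕ} (hN : IsHeight h k la lb lc N)
    (ha : IsRectPartition (h + k) k la) (hb : IsRectPartition (h + k) k lb)
    (hc : IsRectPartition (h + k) k lc) :
    ∃ W, IsLineSeq (h + k) (strOf (h + k) k la) (strOf (h + k) k lb) (strOf (h + k) k lc) W ∧
      ∀ m ≤ h + k, Encodes h k la lc N m (W m) := by
  choose f hf using hN.exists_encodes hc
  refine ⟨fun m => if m ≤ h + k then f m else [], ⟨fun m hm => if_neg (by omega), ?_,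
    fun m hm => ?_, ?_⟩, fun m hm => by simpa [hm] using hf m⟩
  · simp only [Nat.zero_le, if_true]
    refine (hf 0).unique ⟨?_, ?_, ?_, ?_⟩ <;>
      simp [onesBefore_zero, hN.zero_left, heightContent_zero]
  · simp only
    rw [if_pos (by omega), if_pos (by omega),
      strip_iff (strOf_ne_two _ _ _ _) (strOf_ne_two _ _ _ _)]
    exact hN.linked ha hc (hf m) (hf (m + 1))
  · simp only [le_refl, if_true]
    obtain ⟨h1, h2, h3, h4⟩ := word_strOf hb
    refine (hf (h + k)).unique ⟨?_, fun i => ?_, ?_, fun i => ?_⟩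
    · rw [h1, onesBefore_of_le _ _ _ le_rfl]
    · rw [h2, hN.eq_of_le le_rfl, hN.eq_of_le le_rfl, Nat.sub_self]
    · rw [hN.content, onesBefore_of_le _ _ _ le_rfl, h3]
    · rw [hN.content, hN.content, h2, add_zero, h4]

lemma IsLineSeq.exists_isHeight {W : ℕ → List (Fin 3)}
    (hW : IsLineSeq (h + k) (strOf (h + k) k la) (strOf (h + k) k lb) (strOf (h + k) k lc) W)
    (ha : IsRectPartition (h + k) k la) (hb : IsRectPartition (h + k) k lb)
    (hc : IsRectPartition (h + k) k lc) :
    ∃ N, IsHeight h k la lb lc N ∧ ∀ m ≤ h + k, Encodes h k la lc N m (W m) := by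
  obtain ⟨hW1, hW0, hWs, hWn⟩ := hW
  obtain ⟨hb1, hb2, hb3, hb4⟩ := word_strOf hb
  have hL := fun m (hm : m < h + k) =>
    (strip_iff (strOf_ne_two _ _ _ _) (strOf_ne_two _ _ _ _)).1 (hWs m hm)
  have hcount : ∀ m ≤ h + k, wordCount (W m) = onesBefore h k lc m := by
    intro m hm
    induction m with
    | zero => simp [hW0, onesBefore_zero]
    | succ m ih =>
      rw [(hL m (by omega)).1, ih (by omega), onesBefore_succ hc]
  have hmark : ∀ m i, h + k ≤ m → wordMark (W m) i = 0 := by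
    intro m i hm
    rcases hm.eq_or_lt with rfl | hm
    · rw [hWn, hb2]
    · rw [hW1 m hm, wordMark_nil]
  obtain ⟨N, hN⟩ : ∃ N : ℕ → ℕ → ℕ, ∀ m j,
      N m j = onesBefore h k la m + ∑ i ∈ Finset.range j, wordMark (W m) i := ⟨_, fun _ _ => rfl⟩
  have hN0 : ∀ m, N m 0 = onesBefore h k la m := fun m => by simp [hN]
  have hNs : ∀ m j, N m (j + 1) = N m j + wordMark (W m) j := fun m j => by
    rw [hN, hN, Finset.sum_range_succ, add_assoc]
  have hNk : ∀ m j, h + k ≤ m → N m j = k := by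
    intro m j hm
    induction j with
    | zero => rw [hN0, onesBefore_of_le _ _ _ hm]
    | succ j ih => rw [hNs, ih, hmark m j hm, add_zero]
  have hstep : ∀ m < h + k, ∀ j, ∃ x, N (m + 1) j = N m j + x ∧
      x + wordMark (W (m + 1)) j ≤ 1 ∧
      (onesBefore h k lc (m + 1) ≤ j → x = (strOf (h + k) k lc m).val) := by
    intro m hm j
    obtain ⟨-, ⟨X, hX0, hX, hXc⟩, -⟩ := hL m hm
    rw [hcount (m + 1) (by omega)] at hXc
    refine ⟨X j, ?_, (hX j).2, hXc j⟩
    induction j with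
    | zero => rw [hN0, hN0, onesBefore_succ ha, hX0]
    | succ j ih =>
      have := (hX j).1
      rw [hNs, hNs, ih]
      omega
  have hcont : ∀ m j, heightContent N (m + 1) j =
      heightContent N m j + wordMark (W (m + 1)) j := by
    intro m j
    rw [heightContent_succ, hNs, Nat.add_sub_cancel_left]
  have henc : ∀ m ≤ h + k, Encodes h k la lc N m (W m) := by
    intro m hm
    refine ⟨hcount m hm, fun i => by rw [hNs, Nat.add_sub_cancel_left], ?_, ?_⟩
    · induction m with
      | zero => simp [hW0, heightContent_zero, hNs, onesBefore_zero]
      | succ m ih =>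
        have := ih (by omega)
        have := (hL m (by omega)).2.2.1
        have h01 : (strOf (h + k) k la m).val ≠ 2 := fun he => strOf_ne_two _ _ _ m (Fin.ext he)
        have := onesBefore_succ ha m
        rw [hcont]
        omega
    · induction m with
      | zero => simp [hW0, heightContent_zero, hNs]
      | succ m ih =>
        intro i
        have := ih (by omega) i
        have := (hL m (by omega)).2.2.2 i
        rw [hcont, hcont]
        omega
  have hcont_end : ∀ m j, h + k ≤ m → heightContent N m j = heightContent N (h + k) j := by
    intro m j hm
    induction m, hm using Nat.le_induction with
    | base => rfl
    | succ m hm ih => rw [hcont, ih, hmark _ _ (by omega), add_zero]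
  refine ⟨N, ⟨hN0, fun m j hj => ?_, fun m j => ?_, fun m j => by rw [hNs]; omega, fun m j => ?_,
    fun m j => ?_, fun j => ?_⟩, henc⟩
  · rcases le_or_gt m (h + k) with hm | hm
    · induction m with
      | zero =>
        rw [hN]
        simp [hW0, onesBefore_zero]
      | succ m ih =>
        obtain ⟨x, h1, -, h3⟩ := hstep m (by omega) j
        rw [h1, ih (by omega), h3 ((onesBefore_le _ _ _ _).trans hj), onesBefore_succ hc]
    · rw [hNk m j hm.le, onesBefore_of_le _ _ _ hm.le]
  · rcases lt_or_ge m (h + k) with hm | hm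
    · obtain ⟨x, h1, -, -⟩ := hstep m hm j
      omega
    · rw [hNk m j hm, hNk _ j (by omega)]
  · rcases lt_or_ge m (h + k) with hm | hm
    · obtain ⟨x, h1, h2, -⟩ := hstep m hm j
      rw [hNs]
      omega
    · rw [hNk m j hm, hNk _ _ (by omega)]
      omega
  · rcases lt_or_ge m (h + k) with hm | hm
    · have := (henc (m + 1) (by omega)).2.2.2 j
      have := hcont m j
      omega
    · rw [hcont_end m j hm, hcont_end _ _ (by omega : h + k ≤ m + 1)]
      have := (henc (h + k) le_rfl).2.2.2 j
      omega
  · obtain ⟨-, -, h3, h4⟩ := henc (h + k) le_rfl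
    rw [hWn] at h3 h4
    rw [onesBefore_of_le _ _ _ le_rfl] at h3
    induction j with
    | zero => omega
    | succ j ih =>
      have := h4 j
      have := hb4 j
      have := hb2 j
      omega

lemma card_isHeight_eq_card_isLineSeq (ha : IsRectPartition (h + k) k la)
    (hb : IsRectPartition (h + k) k lb) (hc : IsRectPartition (h + k) k lc) :
    Nat.card {N // IsHeight h k la lb lc N} = Nat.card {W // IsLineSeq (h + k)
      (strOf (h + k) k la) (strOf (h + k) k lb) (strOf (h + k) k lc) W} := by
  refine natCard_subtype_eq_of_rel (fun N W => ∀ m ≤ h + k, Encodes h k la lc N m (W m))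
    (fun N hN => hN.exists_isLineSeq ha hb hc) (fun W hW => hW.exists_isHeight ha hb hc) ?_ ?_
  · intro N N' W hN hN' _ hr hr'
    funext m j
    rcases le_or_gt m (h + k) with hm | hm
    · induction j with
      | zero => rw [hN.bot, hN'.bot]
      | succ j ih =>
        have := (hr m hm).2.1 j
        have := (hr' m hm).2.1 j
        have := hN.mono_right m j
        have := hN'.mono_right m j
        omega
    · rw [hN.eq_of_le hm.le, hN'.eq_of_le hm.le]
  · intro N W W' _ hW hW' hr hr'
    funext m
    rcases le_or_gt m (h + k) with hm | hm
    · exact (hr m hm).unique (hr' m hm)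
    · rw [hW.1 m hm, hW'.1 m hm]

end LineSeq

/-! ### Puzzles and their sequences of lines -/

lemma ValidUp.bottom_unique {l r b b' : Fin 3} (hb : ValidUp l r b) (hb' : ValidUp l r b') :
    b = b' := by
  unfold ValidUp at *
  revert l r b b'
  decide

lemma ValidDown.right_unique {t l r r' : Fin 3} (hr : ValidDown t l r) (hr' : ValidDown t l r') :
    r = r' := by
  unfold ValidDown at *
  revert t l r r'
  decide

lemma Strip.length_eq {c x : Fin 3} {w w' : List (Fin 3)} (hs : Strip c x w w') :
    w'.length = w.length + 1 := by
  induction hs with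
  | nil => rfl
  | cons _ _ _ ih => simp [ih]

lemma strip_map_range_iff (c : Fin 3) (m : ℕ) (x : Fin 3) (w w' : ℕ → Fin 3) :
    Strip c x ((List.range m).map w) ((List.range (m + 1)).map w') ↔
      ∃ l t : ℕ → Fin 3, l 0 = x ∧ t m = c ∧ (∀ p ≤ m, ValidUp (l p) (w' p) (t p)) ∧
        ∀ p < m, ValidDown (t p) (w p) (l (p + 1)) := by
  induction m generalizing x w w' with
  | zero =>
    simp only [List.range_zero, List.map_nil, zero_add, List.range_one, List.map_cons,
      Nat.le_zero, not_lt_zero, false_imp_iff, implies_true, and_true]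
    constructor
    · rintro (h | _)
      exact ⟨fun _ => x, fun _ => c, rfl, rfl, fun p hp => hp ▸ h⟩
    · rintro ⟨l, t, rfl, rfl, h⟩
      exact .nil (h 0 rfl)
  | succ m ih =>
    rw [List.range_succ_eq_map, List.range_succ_eq_map (n := m + 1)]
    simp only [List.map_cons, List.map_map]
    constructor
    · rintro (_ | ⟨h1, h2, h3⟩)
      rename_i t0 x'
      obtain ⟨l, t, rfl, h5, h6, h7⟩ := (ih _ _ _).1 h3
      refine ⟨fun | 0 => x | p + 1 => l p, fun | 0 => t0 | p + 1 => t p, rfl, h5, ?_, ?_⟩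
      · rintro (_ | p) hp
        · exact h1
        · exact h6 p (by omega)
      · rintro (_ | p) hp
        · exact h2
        · exact h7 p (by omega)
    · rintro ⟨l, t, rfl, h5, h6, h7⟩
      exact .cons (h6 0 (by omega)) (h7 0 (by omega)) ((ih _ _ _).2
        ⟨fun p => l (p + 1), fun p => t (p + 1), rfl, h5, fun p hp => h6 (p + 1) (by omega),
          fun p hp => h7 (p + 1) (by omega)⟩)

section Puzzle

variable {n : ℕ} {a b c : ℕ → Fin 3}

/-- The `m`-th line parallel to the northeast side, counted from the southwest corner. -/
def puzzleLine (n : ℕ) (R : ℕ → ℕ → Fin 3) (m : ℕ) : List (Fin 3) :=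
  (List.range m).map fun p => R (n - m + p) p

lemma IsPuzzle.exists_isLineSeq {L R C : ℕ → ℕ → Fin 3} (hp : IsPuzzle n L R C a b c) :
    ∃ W, IsLineSeq n a b c W ∧ ∀ m ≤ n, W m = puzzleLine n R m := by
  obtain ⟨-, hu, hd, hbd⟩ := hp
  refine ⟨fun m => if m ≤ n then puzzleLine n R m else [], ⟨fun m hm => if_neg (by omega), ?_,
    fun m hm => ?_, ?_⟩, fun m hm => if_pos hm⟩
  · simp [puzzleLine]
  · simp only [if_pos hm.le, if_pos (Nat.succ_le_of_lt hm)]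
    refine (strip_map_range_iff _ _ _ _ _).2 ⟨fun p => L (n - (m + 1) + p) p,
      fun p => C (n - (m + 1) + p) p, ?_, ?_, fun p hpm => ?_, fun p hpm => ?_⟩
    · have := (hbd (n - (m + 1)) (by omega)).1
      rwa [show n - 1 - (n - (m + 1)) = m by omega] at this
    · have := (hbd m hm).2.2
      rwa [show n - 1 = n - (m + 1) + m by omega] at this
    · exact hu _ _ (by omega) (by omega)
    · have := hd (n - m + p) p (by omega) (by omega) (by omega)
      simp only
      rwa [show n - (m + 1) + (p + 1) = n - m + p by omega,
        ← show n - m + p - 1 = n - (m + 1) + p by omega]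
  · simp only [le_refl, if_true, puzzleLine, Nat.sub_self, zero_add]
    exact List.map_congr_left fun p hpn => (hbd p (List.mem_range.1 hpn)).2.1

lemma IsLineSeq.exists_isPuzzle {W : ℕ → List (Fin 3)} (hW : IsLineSeq n a b c W) :
    ∃ p : (ℕ → ℕ → Fin 3) × (ℕ → ℕ → Fin 3) × (ℕ → ℕ → Fin 3),
      IsPuzzle n p.1 p.2.1 p.2.2 a b c ∧ ∀ m ≤ n, W m = puzzleLine n p.2.1 m := by
  obtain ⟨-, hW0, hWs, hWn⟩ := hW
  have hlen : ∀ m ≤ n, (W m).length = m := by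
    intro m hm
    induction m with
    | zero => simp [hW0]
    | succ m ih => rw [(hWs m (by omega)).length_eq, ih (by omega)]
  obtain ⟨R, hR⟩ : ∃ R : ℕ → ℕ → Fin 3, ∀ r j,
    R r j = if j ≤ r ∧ r < n then (W (n - r + j)).getD j 0 else 0 := ⟨_, fun _ _ => rfl⟩
  have hline : ∀ m ≤ n, W m = puzzleLine n R m := by
    intro m hm
    refine List.ext_getElem (by simp [puzzleLine, hlen m hm]) fun p hp _ => ?_
    have hpm : p < m := by rwa [hlen m hm] at hp
    simp only [puzzleLine, List.getElem_map, List.getElem_range, hR]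
    rw [if_pos (by omega)]
    simp only [show n - (n - m + p) + p = m by omega]
    exact (List.getD_eq_getElem _ _ hp).symm
  have hex : ∀ m, ∃ l t : ℕ → Fin 3, m < n → l 0 = a m ∧ t m = c m ∧
      (∀ p ≤ m, ValidUp (l p) (R (n - (m + 1) + p) p) (t p)) ∧
      ∀ p < m, ValidDown (t p) (R (n - m + p) p) (l (p + 1)) := by
    intro m
    by_cases hm : m < n
    · have hs := hWs m hm
      rw [hline m hm.le, hline (m + 1) hm] at hs
      obtain ⟨l, t, hlt⟩ := (strip_map_range_iff _ _ _ _ _).1 hs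
      exact ⟨l, t, fun _ => hlt⟩
    · exact ⟨fun _ => 0, fun _ => 0, fun hm' => absurd hm' hm⟩
  choose l t hlt using hex
  refine ⟨(fun r j => if j ≤ r ∧ r < n then l (n - 1 - r + j) j else 0, R,
    fun r j => if j ≤ r ∧ r < n then t (n - 1 - r + j) j else 0),
    ⟨fun r j hrj => ⟨if_neg hrj, (hR r j).trans (if_neg hrj), if_neg hrj⟩, fun r j hj hr => ?_,
      fun r j h0 hr hj => ?_, fun r hr => ⟨?_, ?_, ?_⟩⟩, hline⟩
  · have := (hlt (n - 1 - r + j) (by omega)).2.2.1 j (by omega)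
    simp only [hj, hr, and_self, if_true]
    rwa [show n - (n - 1 - r + j + 1) + j = r by omega] at this
  · have := (hlt (n - r + j) (by omega)).2.2.2 j (by omega)
    simp only
    rw [if_pos (by omega), if_pos (by omega)]
    rwa [show n - 1 - (r - 1) + j = n - r + j by omega,
      show n - 1 - r + (j + 1) = n - r + j by omega,
      show n - (n - r + j) + j = r by omega] at *
  · have := (hlt (n - 1 - r) (by omega)).1
    simpa [hr] using this
  · have h1 := hline n le_rfl
    rw [hWn, puzzleLine, List.map_inj_left] at h1
    simpa using (h1 r (List.mem_range.2 hr)).symm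
  · have := (hlt r hr).2.1
    simp only
    rwa [if_pos (by omega), Nat.sub_self, zero_add]

lemma IsPuzzle.eq_of_puzzleLine_eq {L R C L' R' C' : ℕ → ℕ → Fin 3}
    (hp : IsPuzzle n L R C a b c) (hp' : IsPuzzle n L' R' C' a b c)
    (heq : ∀ m ≤ n, puzzleLine n R m = puzzleLine n R' m) : L = L' ∧ R = R' ∧ C = C' := by
  obtain ⟨h0, hu, hd, hbd⟩ := hp
  obtain ⟨h0', hu', hd', hbd'⟩ := hp'
  have hR : ∀ r j, R r j = R' r j := by
    intro r j
    by_cases hrj : j ≤ r ∧ r < n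
    · have h1 := heq (n - r + j) (by omega)
      rw [puzzleLine, puzzleLine, List.map_inj_left] at h1
      have := h1 j (List.mem_range.2 (by omega))
      rwa [show n - (n - r + j) + j = r by omega] at this
    · rw [(h0 r j hrj).2.1, (h0' r j hrj).2.1]
  have hC : ∀ r j, j ≤ r → r < n → L r j = L' r j → C r j = C' r j := by
    intro r j hj hr hL
    have h1 := hu r j hj hr
    rw [hL, hR] at h1
    exact h1.bottom_unique (hu' r j hj hr)
  have hL : ∀ j r, j ≤ r → r < n → L r j = L' r j := by
    intro j
    induction j with
    | zero => intro r _ hr; rw [(hbd r hr).1, (hbd' r hr).1]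
    | succ j ih =>
      intro r hj hr
      have h1 := hd r j (by omega) hr (by omega)
      rw [hR, hC _ _ (by omega) (by omega) (ih (r - 1) (by omega) (by omega))] at h1
      exact h1.right_unique (hd' r j (by omega) hr (by omega))
  refine ⟨?_, funext fun r => funext (hR r), ?_⟩ <;> funext r j <;>
    by_cases hrj : j ≤ r ∧ r < n
  · exact hL j r hrj.1 hrj.2
  · rw [(h0 r j hrj).1, (h0' r j hrj).1]
  · exact hC r j hrj.1 hrj.2 (hL j r hrj.1 hrj.2)
  · rw [(h0 r j hrj).2.2, (h0' r j hrj).2.2]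

lemma puzzleCount_eq_card_isLineSeq (n : ℕ) (a b c : ℕ → Fin 3) :
    puzzleCount n a b c = Nat.card {W // IsLineSeq n a b c W} := by
  refine natCard_subtype_eq_of_rel (fun p W => ∀ m ≤ n, W m = puzzleLine n p.2.1 m)
    (fun p hp => hp.exists_isLineSeq) (fun W hW => hW.exists_isPuzzle) ?_ ?_
  · rintro ⟨L, R, C⟩ ⟨L', R', C'⟩ W hp hp' - hr hr'
    obtain ⟨rfl, rfl, rfl⟩ := hp.eq_of_puzzleLine_eq hp' fun m hm => (hr m hm).symm.trans (hr' m hm)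
    rfl
  · intro p W W' _ hW hW' hr hr'
    funext m
    rcases le_or_gt m n with hm | hm
    · rw [hr m hm, hr' m hm]
    · rw [hW.1 m hm, hW'.1 m hm]

end Puzzle

/-! ### Reading words and diagonals -/

/-- `T` is a semistandard skew tableau of shape `ν/λ`, extended by zero. -/
structure IsSemistandard (lam nu : ℕ → ℕ) (T : ℕ × ℕ → ℕ) : Prop where
  pos_iff : ∀ x : ℕ × ℕ, 0 < T x ↔ InSkew lam nu x
  row : ∀ i j j', lam i ≤ j → j ≤ j' → j' < nu i → T (i, j) ≤ T (i, j')
  col : ∀ i i' j, i < i' → InSkew lam nu (i, j) → InSkew lam nu (i', j) → T (i, j) < T (i', j)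

/-- The cells of the `k × h` rectangle with entry `v` satisfying `p`. -/
noncomputable def cellsWith (h k : ℕ) (T : ℕ × ℕ → ℕ) (v : ℕ) (p : ℕ × ℕ → Prop) :
    Finset (ℕ × ℕ) :=
  (Finset.range k ×ˢ Finset.range h).filter fun x => T x = v ∧ p x

section Reading

variable {h k : ℕ} {lam nu : ℕ → ℕ} {T : ℕ × ℕ → ℕ}

lemma mem_cellsWith_iff {v : ℕ} {p : ℕ × ℕ → Prop} {x : ℕ × ℕ} :
    x ∈ cellsWith h k T v p ↔ (x.1 < k ∧ x.2 < h) ∧ T x = v ∧ p x := by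
  rw [cellsWith, Finset.mem_filter, Finset.mem_product, Finset.mem_range, Finset.mem_range]

lemma IsSemistandard.inSkew_of_eq (hT : IsSemistandard lam nu T) {x : ℕ × ℕ} {v : ℕ}
    (hx : T x = v + 1) : InSkew lam nu x := (hT.pos_iff x).1 (by omega)

lemma InSkew.mem_rect (hnu : IsRectPartition (h + k) k nu) {x : ℕ × ℕ} (hx : InSkew lam nu x) :
    x ∈ Finset.range k ×ˢ Finset.range h := by
  have h1 := hx.2
  have h2 := hnu.le x.1
  rw [Finset.mem_product, Finset.mem_range, Finset.mem_range]
  refine ⟨?_, by omega⟩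
  by_contra hk
  have := hnu.2.2 x.1 (by omega)
  omega

lemma mem_cellsWith (hnu : IsRectPartition (h + k) k nu) (hT : IsSemistandard lam nu T)
    {v : ℕ} {p : ℕ × ℕ → Prop} {x : ℕ × ℕ} :
    x ∈ cellsWith h k T (v + 1) p ↔ T x = v + 1 ∧ p x := by
  rw [cellsWith, Finset.mem_filter, and_iff_right_iff_imp]
  exact fun hx => (hT.inSkew_of_eq hx.1).mem_rect hnu

lemma IsSemistandard.card_diag_le (hT : IsSemistandard lam nu T)
    (hlam : Antitone lam) (hnu : IsRectPartition (h + k) k nu) (j : ℕ)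
    (hread : ∀ r c, (cellsWith h k T (j + 2) (ReadBefore r c)).card ≤
      (cellsWith h k T (j + 1) (ReadBefore r c)).card) (m : ℕ) :
    (cellsWith h k T (j + 2) fun x => h + x.1 - x.2 ≤ m + 1).card ≤
      (cellsWith h k T (j + 1) fun x => h + x.1 - x.2 ≤ m).card := by
  rcases Finset.eq_empty_or_nonempty (cellsWith h k T (j + 2) fun x => h + x.1 - x.2 ≤ m + 1)
    with he | hne
  · rw [he]; exact Nat.zero_le _
  obtain ⟨⟨r, c⟩, hrc, hmax⟩ := Finset.exists_max_image _ Prod.fst hne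
  simp only [mem_cellsWith hnu hT (v := j + 1)] at hrc hmax
  obtain ⟨hrcT, hrcd⟩ := hrc
  have hsk := hT.inSkew_of_eq hrcT
  have hch : c < h := (Finset.mem_range.1 (Finset.mem_product.1 (hsk.mem_rect hnu)).2)
  have hex : ∃ c0, T (r, c0) = j + 2 := ⟨c, hrcT⟩
  obtain ⟨c0, hc0, hc0min⟩ : ∃ c0, T (r, c0) = j + 2 ∧ ∀ c', T (r, c') = j + 2 → c0 ≤ c' :=
    ⟨Nat.find hex, Nat.find_spec hex, fun c' hc' => Nat.find_min' hex hc'⟩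
  have hsk0 := hT.inSkew_of_eq hc0
  have hlow : ((cellsWith h k T (j + 2) fun x => h + x.1 - x.2 ≤ m + 1).disjUnion
      ((cellsWith h k T (j + 1) fun x => x.1 < r ∧ m < h + x.1 - x.2).map
        ⟨fun x => (x.1 + 1, x.2), fun x y hxy => by
          simp only [Prod.mk.injEq, Nat.add_right_cancel_iff] at hxy
          exact Prod.ext hxy.1 hxy.2⟩) (by
        rw [Finset.disjoint_left]
        intro x hx hx'
        rw [mem_cellsWith hnu hT (v := j + 1)] at hx
        obtain ⟨y, hy, rfl⟩ := Finset.mem_map.1 hx'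
        rw [mem_cellsWith hnu hT] at hy
        have h1 : h + (y.1 + 1) - y.2 ≤ m + 1 := hx.2
        have h2 := hy.2
        omega)) ⊆ cellsWith h k T (j + 2) (ReadBefore r c0) := by
    intro x hx
    rw [mem_cellsWith hnu hT (v := j + 1)]
    rcases Finset.mem_disjUnion.1 hx with hx | hx
    · rw [mem_cellsWith hnu hT (v := j + 1)] at hx
      refine ⟨hx.1, ?_⟩
      rcases (hmax x hx).lt_or_eq with hlt | heq
      · exact Or.inl hlt
      · refine Or.inr ⟨heq, hc0min _ ?_⟩
        rw [← heq]
        exact hx.1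
    · obtain ⟨⟨i, c'⟩, hy, rfl⟩ := Finset.mem_map.1 hx
      rw [mem_cellsWith hnu hT] at hy
      obtain ⟨hyT, hir, hyd⟩ := hy
      change i < r at hir
      change T (i + 1, c') = j + 2 ∧ ReadBefore r c0 (i + 1, c')
      have hysk := hT.inSkew_of_eq hyT
      have hcc : c' < c := by omega
      have hskr : ∀ i', i ≤ i' → i' ≤ r → InSkew lam nu (i', c') := fun i' h1 h2 =>
        ⟨(hlam h1).trans hysk.1, (hcc.trans hsk.2).trans_le (hnu.1 h2)⟩
      have h1 := hT.col i (i + 1) c' (by omega) hysk (hskr _ (by omega) (by omega))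
      have h2 := hT.row r c' c (hskr r (by omega) le_rfl).1 hcc.le hsk.2
      rcases (show i + 1 ≤ r by omega).lt_or_eq with hlt | rfl
      · have h3 := hT.col (i + 1) r c' hlt (hskr _ (by omega) (by omega))
          (hskr r (by omega) le_rfl)
        omega
      · refine ⟨by omega, Or.inr ⟨rfl, hc0min c' (by omega)⟩⟩
  have hup : cellsWith h k T (j + 1) (ReadBefore r c0) ⊆
      (cellsWith h k T (j + 1) fun x => h + x.1 - x.2 ≤ m) ∪
        cellsWith h k T (j + 1) fun x => x.1 < r ∧ m < h + x.1 - x.2 := by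
    rintro ⟨i, c'⟩ hx
    rw [Finset.mem_union, mem_cellsWith hnu hT, mem_cellsWith hnu hT]
    rw [mem_cellsWith hnu hT] at hx
    obtain ⟨hxT, hx | ⟨hir, hx⟩⟩ := hx
    · simp only [hxT, true_and]
      simp only at hx
      omega
    · exfalso
      change i = r at hir
      subst hir
      have := hT.row i c0 c' hsk0.1 hx (hT.inSkew_of_eq hxT).2
      omega
  have h1 := Finset.card_le_card hlow
  have h2 := (Finset.card_le_card hup).trans (Finset.card_union_le _ _)
  rw [Finset.card_disjUnion, Finset.card_map] at h1
  have := hread r c0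
  omega

lemma IsSemistandard.card_readBefore_le (hT : IsSemistandard lam nu T)
    (hlam : Antitone lam) (hnu : IsRectPartition (h + k) k nu) (j : ℕ)
    (hdiag : ∀ m, (cellsWith h k T (j + 2) fun x => h + x.1 - x.2 ≤ m + 1).card ≤
      (cellsWith h k T (j + 1) fun x => h + x.1 - x.2 ≤ m).card) (r0 c0 : ℕ) :
    (cellsWith h k T (j + 2) (ReadBefore r0 c0)).card ≤
      (cellsWith h k T (j + 1) (ReadBefore r0 c0)).card := by
  rcases Finset.eq_empty_or_nonempty (cellsWith h k T (j + 2) (ReadBefore r0 c0)) with he | hne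
  · rw [he]; exact Nat.zero_le _
  obtain ⟨⟨r, c1⟩, hrc1, hmax⟩ := Finset.exists_max_image _ Prod.fst hne
  simp only [mem_cellsWith hnu hT (v := j + 1)] at hrc1 hmax
  have hex : ∃ c, T (r, c) = j + 2 ∧ ReadBefore r0 c0 (r, c) := ⟨c1, hrc1⟩
  obtain ⟨c, ⟨hcT, hcR⟩, hcmin⟩ : ∃ c, (T (r, c) = j + 2 ∧ ReadBefore r0 c0 (r, c)) ∧
      ∀ c', T (r, c') = j + 2 ∧ ReadBefore r0 c0 (r, c') → c ≤ c' :=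
    ⟨Nat.find hex, Nat.find_spec hex, fun c' hc' => Nat.find_min' hex hc'⟩
  have hsk := hT.inSkew_of_eq hcT
  have hch : c < h := (Finset.mem_range.1 (Finset.mem_product.1 (hsk.mem_rect hnu)).2)
  refine (Finset.card_le_card ?_).trans ((hdiag (h + r - c - 1)).trans (Finset.card_le_card ?_))
  · rintro ⟨i, c'⟩ hx
    rw [mem_cellsWith hnu hT (v := j + 1)] at hx ⊢
    refine ⟨hx.1, ?_⟩
    have hxr := hmax _ hx
    simp only at hxr ⊢
    rcases hxr.lt_or_eq with hlt | rfl
    · by_contra hcon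
      have hxsk := hT.inSkew_of_eq hx.1
      have hcc : c' < c := by omega
      have hsk' : InSkew lam nu (r, c') := ⟨(hlam hxr).trans hxsk.1, hcc.trans hsk.2⟩
      have h1 := hT.col i r c' hlt hxsk hsk'
      have h2 := hT.row r c' c hsk'.1 hcc.le hsk.2
      have := hx.1
      omega
    · have := hcmin c' hx
      omega
  · rintro ⟨i, c'⟩ hx
    rw [mem_cellsWith hnu hT] at hx ⊢
    obtain ⟨hxT, hxd⟩ := hx
    simp only at hxd
    refine ⟨hxT, Or.inl ?_⟩
    have hr : r ≤ r0 := by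
      rcases hcR with hcR | hcR
      · exact hcR.le
      · exact hcR.1.le
    refine lt_of_lt_of_le ?_ hr
    by_contra hri
    simp only [not_lt] at hri
    have hxsk := hT.inSkew_of_eq hxT
    have hcc : c ≤ c' := by omega
    have hsk' : InSkew lam nu (r, c') := ⟨hsk.1.trans hcc, hxsk.2.trans_le (hnu.1 hri)⟩
    have h1 := hT.row r c c' hsk.1 hcc hsk'.2
    rcases hri.lt_or_eq with hlt | rfl
    · have h2 := hT.col r i c' hlt hsk' hxsk
      omega
    · omega

end Reading

/-! ### Height functions and tableaux -/

/-- The height function `N` records, for each diagonal, the number of rows in which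
the entries of `T` are at most `j`. -/
structure IsHeightOf (h k : ℕ) (lc : ℕ → ℕ) (T : ℕ × ℕ → ℕ) (N : ℕ → ℕ → ℕ) : Prop where
  le : ∀ m j, N m j ≤ k
  lt_of_lt : ∀ i < k, ∀ m, h + i < m → ∀ j, i < N m j
  lt_iff : ∀ i < k, ∀ m c j, m + c = h + i → (i < N m j ↔ c < lc i ∧ T (i, c) ≤ j)

section Tableau

variable {h k : ℕ} {la lb lc : ℕ → ℕ} {T : ℕ × ℕ → ℕ} {N : ℕ → ℕ → ℕ}

lemma IsSemistandard.exists_isHeightOf (hT : IsSemistandard la lc T)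
    (ha : Antitone la) (hc : Antitone lc) : ∃ N, IsHeightOf h k lc T N := by
  have hdown : ∀ m j i, (∀ c, m + c = h + (i + 1) → c < lc (i + 1) ∧ T (i + 1, c) ≤ j) →
      ∀ c, m + c = h + i → c < lc i ∧ T (i, c) ≤ j := by
    intro m j i hQ c hmc
    obtain ⟨h1, h2⟩ := hQ (c + 1) (by omega)
    have h3 := hc (Nat.le_succ i)
    have h4 := ha (Nat.le_succ i)
    simp only [Nat.succ_eq_add_one] at h3 h4
    refine ⟨by omega, ?_⟩
    by_cases hsk : la i ≤ c
    · have h5 := hT.row i c (c + 1) hsk (by omega) (by omega)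
      have h6 := hT.col i (i + 1) (c + 1) (by omega) ⟨hsk.trans (by simp), h1.trans_le h3⟩
        ⟨h4.trans (hsk.trans (by simp)), h1⟩
      omega
    · have h5 : ¬ 0 < T (i, c) := fun h0 => hsk ((hT.pos_iff _).1 h0).1
      omega
  have hcard := fun m j => lt_card_filter_range_iff
    (p := fun i => ∀ c, m + c = h + i → c < lc i ∧ T (i, c) ≤ j) (hdown m j) k
  refine ⟨fun m j => ((Finset.range k).filter fun i =>
      ∀ c, m + c = h + i → c < lc i ∧ T (i, c) ≤ j).card, fun m j => ?_, fun i hi m hm j => ?_,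
    fun i hi m c j hmc => ?_⟩
  · exact (Finset.card_filter_le _ _).trans (by simp)
  · exact (hcard m j i).2 ⟨hi, fun c hc => by omega⟩
  · rw [hcard m j i]
    refine ⟨fun hQ => hQ.2 c hmc, fun hQ => ⟨hi, fun c' hc' => ?_⟩⟩
    obtain rfl : c = c' := by omega
    exact hQ


lemma IsHeightOf.left_unique {T' : ℕ × ℕ → ℕ} (hc : IsRectPartition (h + k) k lc)
    (hT : ∀ x, 0 < T x ↔ InSkew la lc x) (hT' : ∀ x, 0 < T' x ↔ InSkew la lc x)
    (hN : IsHeightOf h k lc T N) (hN' : IsHeightOf h k lc T' N) : T = T' := by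
  funext ⟨i, c⟩
  by_cases hsk : InSkew la lc (i, c)
  · obtain ⟨hi, hch⟩ := Finset.mem_product.1 (hsk.mem_rect hc)
    rw [Finset.mem_range] at hi hch
    have h1 := fun j => hN.lt_iff i hi (h + i - c) c j (by simp only at hch; omega)
    have h2 := fun j => hN'.lt_iff i hi (h + i - c) c j (by simp only at hch; omega)
    have hcl : c < lc i := hsk.2
    refine eq_of_forall_ge_iff fun j => ?_
    have h3 := h1 j
    have h4 := h2 j
    tauto
  · have h1 := mt (hT (i, c)).1 hsk
    have h2 := mt (hT' (i, c)).1 hsk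
    omega

lemma IsHeightOf.right_unique {N' : ℕ → ℕ → ℕ} (hN : IsHeightOf h k lc T N)
    (hN' : IsHeightOf h k lc T N') : N = N' := by
  funext m j
  refine eq_of_forall_lt_iff fun i => ?_
  have h1 := hN.le m j
  have h2 := hN'.le m j
  by_cases hi : i < k
  · rcases lt_or_ge (h + i) m with hm | hm
    · exact iff_of_true (hN.lt_of_lt i hi m hm j) (hN'.lt_of_lt i hi m hm j)
    · rw [hN.lt_iff i hi m (h + i - m) j (by omega), hN'.lt_iff i hi m (h + i - m) j (by omega)]
  · omega

/-- The entries of the tableau on a given diagonal are counted by the height function. -/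
lemma IsHeightOf.card_cellsWith (hN : IsHeightOf h k lc T N) (hT : ∀ x, 0 < T x ↔ InSkew la lc x)
    (hc : IsRectPartition (h + k) k lc) (m j : ℕ) :
    (cellsWith h k T (j + 1) fun x => h + x.1 - x.2 ≤ m).card = heightContent N m j := by
  rw [heightContent, Finset.card_eq_sum_card_fiberwise (f := fun x : ℕ × ℕ => h + x.1 - x.2)
    (t := Finset.range (m + 1))]
  · refine Finset.sum_congr rfl fun t ht => ?_
    rw [Finset.mem_range] at ht
    rw [← Nat.card_Ico]
    symm
    refine Finset.card_bij (fun i _ => (i, h + i - t)) (fun i hi => ?_)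
      (fun i _ i' _ hii => (Prod.mk.inj hii).1) fun x hx => ?_
    · rw [Finset.mem_Ico] at hi
      have hik : i < k := hi.2.trans_le (hN.le _ _)
      have htl : t ≤ h + i := by
        by_contra hcon
        exact absurd (hN.lt_of_lt i hik t (by omega) j) (by omega)
      have h1 := hN.lt_iff i hik t (h + i - t) j (by omega)
      have h2 := hN.lt_iff i hik t (h + i - t) (j + 1) (by omega)
      have h3 := h2.1 hi.2
      have h4 : ¬ i < N t j := by omega
      rw [h1] at h4
      have := hc.le i
      rw [Finset.mem_filter, mem_cellsWith_iff]
      refine ⟨⟨⟨hik, by omega⟩, ?_, by omega⟩, by omega⟩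
      have h5 : ¬ T (i, h + i - t) ≤ j := fun h5 => h4 ⟨h3.1, h5⟩
      omega
    · obtain ⟨i, c⟩ := x
      rw [Finset.mem_filter, mem_cellsWith_iff] at hx
      obtain ⟨⟨⟨hik, hch⟩, hTx, -⟩, hd⟩ := hx
      have hcl : c < lc i := ((hT (i, c)).1 (by omega)).2
      have h1 := hN.lt_iff i hik t c j (by omega)
      have h2 := hN.lt_iff i hik t c (j + 1) (by omega)
      refine ⟨i, ?_, Prod.ext rfl (by simp only; omega)⟩
      rw [Finset.mem_Ico]
      refine ⟨?_, h2.2 ⟨hcl, by omega⟩⟩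
      by_contra hcon
      have := (h1.1 (by omega)).2
      omega
  · intro x hx
    have := (mem_cellsWith_iff.1 hx).2.2
    simp only [Finset.coe_range, Set.mem_Iio]
    omega

lemma IsHeightOf.card_eq (hN : IsHeightOf h k lc T N) (hT : ∀ x, 0 < T x ↔ InSkew la lc x)
    (hc : IsRectPartition (h + k) k lc) (j : ℕ) :
    Nat.card {x : ℕ × ℕ // InSkew la lc x ∧ T x = j + 1} = heightContent N (h + k) j := by
  rw [← hN.card_cellsWith hT hc]
  refine Nat.subtype_card _ fun x => ?_
  rw [mem_cellsWith_iff]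
  constructor
  · exact fun hx => ⟨(hT x).1 (by omega), hx.2.1⟩
  · intro hx
    have h1 := hx.1.mem_rect hc
    rw [Finset.mem_product, Finset.mem_range, Finset.mem_range] at h1
    exact ⟨h1, hx.2, by omega⟩

lemma IsSemistandard.card_readBefore_eq (hT : IsSemistandard la lc T)
    (hc : IsRectPartition (h + k) k lc) (j r c : ℕ) :
    Nat.card {x : ℕ × ℕ // ReadBefore r c x ∧ InSkew la lc x ∧ T x = j + 1} =
      (cellsWith h k T (j + 1) (ReadBefore r c)).card := by
  refine Nat.subtype_card _ fun x => ?_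
  rw [mem_cellsWith hc hT]
  exact ⟨fun hx => ⟨hx.2, hT.inSkew_of_eq hx.1, hx.1⟩, fun hx => ⟨hx.2.2, hx.1⟩⟩

lemma isLRSkewTableau_iff (ha : Antitone la) (hc : IsRectPartition (h + k) k lc)
    (hT : IsSemistandard la lc T) (hN : IsHeightOf h k lc T N) :
    IsLRSkewTableau la lb lc T ↔ (∀ j, heightContent N (h + k) j = lb j) ∧
      ∀ m j, heightContent N (m + 1) (j + 1) ≤ heightContent N m j := by
  have hcells := hN.card_cellsWith hT.pos_iff hc
  constructor
  · rintro ⟨-, -, -, h4, h5⟩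
    refine ⟨fun j => ?_, fun m j => ?_⟩
    · rw [← hN.card_eq hT.pos_iff hc]
      exact h4 (j + 1) (by omega)
    · rw [← hcells, ← hcells]
      refine hT.card_diag_le ha hc j (fun r c => ?_) m
      rw [← hT.card_readBefore_eq hc (j + 1), ← hT.card_readBefore_eq hc j]
      exact h5 (j + 1) (by omega) r c
  · rintro ⟨h4, h5⟩
    refine ⟨hT.pos_iff, hT.row, hT.col, ?_, ?_⟩
    · rintro (_ | j) hm
      · omega
      · rw [hN.card_eq hT.pos_iff hc, h4, Nat.add_sub_cancel]
    · rintro (_ | j) hm r c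
      · omega
      · rw [hT.card_readBefore_eq hc, hT.card_readBefore_eq hc]
        refine hT.card_readBefore_le ha hc j (fun m => ?_) r c
        rw [hcells, hcells]
        exact h5 m j

lemma IsLRSkewTableau.isHeight (hT : IsLRSkewTableau la lb lc T) (hN : IsHeightOf h k lc T N)
    (ha : IsRectPartition (h + k) k la) (hb : IsRectPartition (h + k) k lb)
    (hc : IsRectPartition (h + k) k lc) (hle : ∀ i, la i ≤ lc i) : IsHeight h k la lb lc N := by
  have hS : IsSemistandard la lc T := ⟨hT.1, hT.2.1, hT.2.2.1⟩
  obtain ⟨hcontent, hlattice⟩ := (isLRSkewTableau_iff ha.1 hc hS hN).1 hT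
  have hbound : ∀ x, T x ≤ k := by
    intro x
    by_contra hx
    obtain ⟨v, hv⟩ : ∃ v, T x = v + 1 := ⟨T x - 1, by omega⟩
    have h1 := hcontent v
    rw [hb.2.2 v (by omega), ← hN.card_cellsWith hS.pos_iff hc, Finset.card_eq_zero] at h1
    have h2 := (hS.inSkew_of_eq hv).mem_rect hc
    have h3 : x ∈ cellsWith h k T (v + 1) fun x => h + x.1 - x.2 ≤ h + k := by
      rw [Finset.mem_product, Finset.mem_range, Finset.mem_range] at h2
      exact mem_cellsWith_iff.2 ⟨h2, hv, by omega⟩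
    rw [h1] at h3
    simp at h3
  refine ⟨fun m => ?_, fun m j hj => ?_, fun m j => ?_, fun m j => ?_, fun m j => ?_, hlattice,
    hcontent⟩
  · refine eq_of_forall_lt_iff fun i => ?_
    rw [lt_onesBefore_iff ha]
    have hla := ha.le i
    by_cases hi : i < k
    · rcases lt_or_ge (h + i) m with hm | hm
      · exact iff_of_true (hN.lt_of_lt i hi m hm 0) ⟨hi, by omega⟩
      · rw [hN.lt_iff i hi m (h + i - m) 0 (by omega)]
        have h1 := hS.pos_iff (i, h + i - m)
        have h2 := hle i
        simp only [InSkew] at h1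
        omega
    · have := hN.le m 0
      omega
  · refine eq_of_forall_lt_iff fun i => ?_
    rw [lt_onesBefore_iff hc]
    have hlc := hc.le i
    by_cases hi : i < k
    · rcases lt_or_ge (h + i) m with hm | hm
      · exact iff_of_true (hN.lt_of_lt i hi m hm j) ⟨hi, by omega⟩
      · rw [hN.lt_iff i hi m (h + i - m) j (by omega)]
        have h1 := hbound (i, h + i - m)
        omega
    · have := hN.le m j
      omega
  · refine le_of_forall_lt fun i hi => ?_
    have hik := hi.trans_le (hN.le m j)
    rcases lt_or_ge (h + i) (m + 1) with hm | hm
    · exact hN.lt_of_lt i hik _ hm j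
    · rw [hN.lt_iff i hik m (h + i - m) j (by omega)] at hi
      rw [hN.lt_iff i hik (m + 1) (h + i - (m + 1)) j (by omega)]
      refine ⟨by omega, ?_⟩
      by_cases hsk : la i ≤ h + i - (m + 1)
      · exact (hS.row i _ _ hsk (by omega) hi.1).trans hi.2
      · have h1 := hS.pos_iff (i, h + i - (m + 1))
        simp only [InSkew] at h1
        omega
  · refine le_of_forall_lt fun i hi => ?_
    have hik := hi.trans_le (hN.le m j)
    rcases lt_or_ge (h + i) m with hm | hm
    · exact hN.lt_of_lt i hik _ hm _
    · rw [hN.lt_iff i hik m (h + i - m) _ (by omega)] at hi ⊢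
      omega
  · have hsucc : ∀ i, i + 1 < N (m + 1) (j + 1) → i < N m j := by
      intro i hi
      have hik := hi.trans_le (hN.le _ _)
      rcases lt_or_ge (h + i) m with hm | hm
      · exact hN.lt_of_lt i (by omega) _ hm _
      · rw [hN.lt_iff (i + 1) hik (m + 1) (h + i - m) _ (by omega)] at hi
        rw [hN.lt_iff i (by omega) m (h + i - m) _ (by omega)]
        have h1 := hc.1 (Nat.le_succ i)
        have h2 := ha.1 (Nat.le_succ i)
        simp only [Nat.succ_eq_add_one] at h1 h2
        refine ⟨by omega, ?_⟩
        by_cases hsk : la i ≤ h + i - m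
        · have := hS.col i (i + 1) (h + i - m) (by omega) ⟨hsk, hi.1.trans_le h1⟩
            ⟨h2.trans hsk, hi.1⟩
          omega
        · have h1 := hS.pos_iff (i, h + i - m)
          simp only [InSkew] at h1
          omega
    by_contra hcon
    have := hsucc (N m j) (by omega)
    omega

lemma IsHeight.exists_isHeightOf (hN : IsHeight h k la lb lc N)
    (ha : IsRectPartition (h + k) k la) (hc : IsRectPartition (h + k) k lc)
    (hle : ∀ i, la i ≤ lc i) :
    ∃ T, (∀ x, 0 < T x ↔ InSkew la lc x) ∧ IsHeightOf h k lc T N := by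
  have hlt : ∀ x j, InSkew la lc x → (j < ((Finset.range k).filter
      fun j => N (h + x.1 - x.2) j ≤ x.1).card ↔ N (h + x.1 - x.2) j ≤ x.1) := by
    intro x j hx
    rw [lt_card_filter_range_iff (fun j hj => (hN.mono_right _ j).trans hj), and_iff_right_iff_imp]
    intro hj
    by_contra hkj
    rw [hN.top _ j (by omega)] at hj
    have h1 := lt_onesBefore_iff hc (h + x.1 - x.2) x.1
    have h2 := hx.mem_rect hc
    rw [Finset.mem_product, Finset.mem_range, Finset.mem_range] at h2
    have := hx.2
    have := hc.le x.1
    omega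
  have hpos : ∀ x, InSkew la lc x → N (h + x.1 - x.2) 0 ≤ x.1 := by
    intro x hx
    rw [hN.bot]
    by_contra hcon
    have h1 := ((lt_onesBefore_iff ha (h + x.1 - x.2) x.1).1 (by omega)).2
    have := hx.1
    omega
  refine ⟨fun x => if InSkew la lc x then ((Finset.range k).filter
    fun j => N (h + x.1 - x.2) j ≤ x.1).card else 0, fun x => ?_,
    fun m j => (hN.le_top m j).trans (onesBefore_le _ _ _ _),
    fun i hi m hm j => lt_of_lt_of_le ((lt_onesBefore_iff ha m i).2 ⟨hi, by omega⟩) (hN.bot_le m j),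
    fun i hi m c j hmc => ?_⟩
  · simp only
    split_ifs with hx
    · simp only [hx, iff_true]
      exact (hlt x 0 hx).2 (hpos x hx)
    · simp [hx]
  · simp only
    split_ifs with hx
    · have h1 := hlt _ j hx
      have h2 : c < lc i := hx.2
      simp only [show h + i - c = m by omega] at h1 ⊢
      omega
    · have h1 := hN.le_top m j
      have h2 := hN.bot_le m j
      have h3 := lt_onesBefore_iff ha m i
      have h4 := lt_onesBefore_iff hc m i
      have := ha.le i
      have := hc.le i
      have := hle i
      simp only [InSkew] at hx
      omega

lemma IsHeight.isSemistandard (hN : IsHeight h k la lb lc N) (ha : Antitone la)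
    (hc : IsRectPartition (h + k) k lc) (hT : ∀ x, 0 < T x ↔ InSkew la lc x)
    (hNT : IsHeightOf h k lc T N) : IsSemistandard la lc T := by
  have hrect : ∀ {i c}, InSkew la lc (i, c) → i < k ∧ c < h := fun hx => by
    simpa using hx.mem_rect hc
  have hadj : ∀ i c, InSkew la lc (i, c) → InSkew la lc (i + 1, c) → T (i, c) < T (i + 1, c) := by
    intro i c hx hx'
    obtain ⟨v, hv⟩ : ∃ v, T (i + 1, c) = v + 1 :=
      ⟨T (i + 1, c) - 1, by have := (hT _).2 hx'; omega⟩
    have h0 := hrect hx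
    have h1 := (hNT.lt_iff (i + 1) (hrect hx').1 (h + i - c + 1) c (v + 1) (by omega)).2
      ⟨hx'.2, hv.le⟩
    have h2 := hN.diag (h + i - c) v
    have h3 := ((hNT.lt_iff i h0.1 (h + i - c) c v (by omega)).1 (by omega)).2
    omega
  refine ⟨hT, fun i c c' h1 h2 h3 => ?_, fun i i' c hii hx hx' => ?_⟩
  · have hx' : InSkew la lc (i, c') := ⟨h1.trans h2, h3⟩
    obtain ⟨hi, hch⟩ := hrect hx'
    have h4 := (hNT.lt_iff i hi (h + i - c') c' (T (i, c')) (by omega)).2 ⟨h3, le_rfl⟩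
    refine ((hNT.lt_iff i hi (h + i - c) c (T (i, c')) (by omega)).1 (h4.trans_le ?_)).2
    exact monotone_nat_of_le_succ (fun m => hN.mono_left m _) (by omega)
  · induction i', hii using Nat.le_induction with
    | base => exact hadj i c hx hx'
    | succ i' hii ih =>
      have hx'' : InSkew la lc (i', c) :=
        ⟨(ha (Nat.le_of_succ_le hii)).trans hx.1, hx'.2.trans_le (hc.1 (Nat.le_succ i'))⟩
      exact (ih hx'').trans (hadj i' c hx'' hx')

lemma IsHeight.le_of_le (hN : IsHeight h k la lb lc N) (ha : IsRectPartition (h + k) k la)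
    (hc : IsRectPartition (h + k) k lc) (i : ℕ) : la i ≤ lc i := by
  by_contra hcon
  have hi : i < k := by
    by_contra hi
    have := ha.2.2 i (by omega)
    omega
  have h1 := (hN.bot_le (h + i - la i + 1) 0).trans (hN.le_top _ 0)
  have h2 := ha.le i
  have h3 := hc.le i
  have h4 := (lt_onesBefore_iff ha (h + i - la i + 1) i).2 ⟨hi, by omega⟩
  have h5 := (lt_onesBefore_iff hc (h + i - la i + 1) i).1 (by omega)
  omega

lemma lrCoeff_eq_card_isHeight (ha : IsRectPartition (h + k) k la)
    (hb : IsRectPartition (h + k) k lb) (hc : IsRectPartition (h + k) k lc) :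
    lrCoeff la lb lc = Nat.card {N // IsHeight h k la lb lc N} := by
  unfold lrCoeff
  split_ifs with hle
  · refine natCard_subtype_eq_of_rel (IsHeightOf h k lc) (fun T hT => ?_) (fun N hN => ?_)
      (fun T T' N hT hT' _ hr hr' => hr.left_unique hc hT.1 hT'.1 hr')
      fun T N N' _ _ _ hr hr' => hr.right_unique hr'
    · obtain ⟨N, hN⟩ := IsSemistandard.exists_isHeightOf (h := h) (k := k)
        ⟨hT.1, hT.2.1, hT.2.2.1⟩ ha.1 hc.1
      exact ⟨N, hT.isHeight hN ha hb hc hle, hN⟩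
    · obtain ⟨T, hT, hNT⟩ := hN.exists_isHeightOf ha hc hle
      exact ⟨T, (isLRSkewTableau_iff ha.1 hc (hN.isSemistandard ha.1 hc hT hNT) hNT).2
        ⟨hN.content, hN.lattice⟩, hNT⟩
  · have : IsEmpty {N // IsHeight h k la lb lc N} := ⟨fun N => hle fun i => N.2.le_of_le ha hc i⟩
    exact Nat.card_of_isEmpty.symm

end Tableau

/-- **The puzzle Littlewood–Richardson rule.**  For partitions
`λ(α), λ(β), λ(γ)` contained in the `k × (n-k)` rectangle, the number of
puzzles of size `n` whose boundary consists of the corresponding binary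
strings equals the Littlewood–Richardson coefficient
`c^{λ(γ)}_{λ(α), λ(β)}`. -/
theorem puzzleCount_eq_lrCoeff (n k : ℕ) (hkn : k ≤ n)
    (la lb lc : ℕ → ℕ)
    (ha : IsRectPartition n k la) (hb : IsRectPartition n k lb)
    (hc : IsRectPartition n k lc) :
    puzzleCount n (strOf n k la) (strOf n k lb) (strOf n k lc) =
      lrCoeff la lb lc := by
  obtain ⟨h, rfl⟩ : ∃ h, n = h + k := ⟨n - k, by omega⟩
  rw [puzzleCount_eq_card_isLineSeq, lrCoeff_eq_card_isHeight ha hb hc,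
    card_isHeight_eq_card_isLineSeq ha hb hc]
end

section
/- Let W be a 4-dimensional vector space over a field K, and let L_1, L_2, L_3, L_4 be 2-dimensional subspaces of W such that: L_1 ≠ L_2 and Q := L_1 ∩ L_2 is 1-dimensional, with P := L_1 + L_2 (so P is 3-dimensional); L_3 ∩ L_4 = 0; Q ∩ L_3 = 0 and Q ∩ L_4 = 0; L_3 ⊄ P and L_4 ⊄ P; and P ∩ L_3 ⊄ Q + L_4. Then there are exactly two 2-dimensional subspaces V of W satisfying V ∩ L_i ≠ 0 for all i = 1, 2, 3, 4, namely V_1 = (Q + L_3) ∩ (Q + L_4) and V_2 = (P ∩ L_3) + (P ∩ L_4), and V_1 ≠ V_2. -/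
/-!  The classical "four lines" count, in its degenerate configuration:
if `L₁, L₂` meet in a point `q = P(Q)` and span a plane `P(P)`, while
`L₃, L₄` are in suitably general position, then there are exactly two lines
in `P³` meeting all four, namely `P(V₁)` and `P(V₂)` below. -/

open Module

section Finrank

variable {K W : Type*} [Field K] [AddCommGroup W] [Module K W] [FiniteDimensional K W]

theorem Submodule.sup_eq_of_finrank_eq_two {V X Y : Submodule K W} (hV : finrank K V = 2)
    (hXV : X ≤ V) (hYV : Y ≤ V) (hX : X ≠ ⊥) (hY : Y ≠ ⊥) (hXY : X ⊓ Y = ⊥) : X ⊔ Y = V := by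
  refine Submodule.eq_of_le_of_finrank_le (sup_le hXV hYV) ?_
  have h := Submodule.finrank_sup_add_finrank_inf_eq X Y
  have hX' := Submodule.one_le_finrank_iff.mpr hX
  have hY' := Submodule.one_le_finrank_iff.mpr hY
  rw [hXY, finrank_bot] at h
  omega

theorem Submodule.inf_ne_bot_of_finrank_lt {X Y Z : Submodule K W} (hX : X ≤ Z) (hY : Y ≤ Z)
    (h : finrank K Z < finrank K X + finrank K Y) : X ⊓ Y ≠ ⊥ := by
  intro hXY
  have hsum := Submodule.finrank_sup_add_finrank_inf_eq X Y
  have hle := Submodule.finrank_mono (sup_le hX hY)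
  rw [hXY, finrank_bot] at hsum
  omega

theorem Submodule.le_of_finrank_eq_one_of_inf_ne_bot {X Y : Submodule K W}
    (hX : finrank K X = 1) (h : X ⊓ Y ≠ ⊥) : X ≤ Y := by
  have h' := Submodule.one_le_finrank_iff.mpr h
  exact inf_eq_left.mp (Submodule.eq_of_le_of_finrank_le inf_le_left (by omega))

/-- A plane not contained in a hyperplane of a 4-dimensional space meets it in a line. -/
theorem Submodule.finrank_inf_eq_one_of_not_le {P L : Submodule K W} (hW : finrank K W = 4)
    (hP : finrank K P = 3) (hL : finrank K L = 2) (h : ¬ L ≤ P) :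
    finrank K ↥(P ⊓ L) = 1 := by
  have hsum := Submodule.finrank_sup_add_finrank_inf_eq P L
  have hle := Submodule.finrank_le (P ⊔ L)
  have hlt := Submodule.finrank_lt_finrank_of_lt (inf_lt_right.mpr h)
  omega

end Finrank

theorem two_lines_meeting_four_lines
    (K W : Type*) [Field K] [AddCommGroup W] [Module K W]
    [FiniteDimensional K W] (hW : finrank K W = 4)
    (L₁ L₂ L₃ L₄ : Submodule K W)
    (h1 : finrank K L₁ = 2) (h2 : finrank K L₂ = 2)
    (h3 : finrank K L₃ = 2) (h4 : finrank K L₄ = 2)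
    (hne : L₁ ≠ L₂) (hQ : finrank K ↥(L₁ ⊓ L₂) = 1)
    (h34 : L₃ ⊓ L₄ = ⊥)
    (hQ3 : (L₁ ⊓ L₂) ⊓ L₃ = ⊥) (hQ4 : (L₁ ⊓ L₂) ⊓ L₄ = ⊥)
    (h3P : ¬ L₃ ≤ L₁ ⊔ L₂) (h4P : ¬ L₄ ≤ L₁ ⊔ L₂)
    (hgen : ¬ ((L₁ ⊔ L₂) ⊓ L₃ ≤ (L₁ ⊓ L₂) ⊔ L₄)) :
    {V : Submodule K W | finrank K ↥V = 2 ∧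
        V ⊓ L₁ ≠ ⊥ ∧ V ⊓ L₂ ≠ ⊥ ∧ V ⊓ L₃ ≠ ⊥ ∧ V ⊓ L₄ ≠ ⊥} =
      {((L₁ ⊓ L₂) ⊔ L₃) ⊓ ((L₁ ⊓ L₂) ⊔ L₄),
       ((L₁ ⊔ L₂) ⊓ L₃) ⊔ ((L₁ ⊔ L₂) ⊓ L₄)} ∧
    ((L₁ ⊓ L₂) ⊔ L₃) ⊓ ((L₁ ⊓ L₂) ⊔ L₄) ≠
      ((L₁ ⊔ L₂) ⊓ L₃) ⊔ ((L₁ ⊔ L₂) ⊓ L₄) := by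
  have hP : finrank K ↥(L₁ ⊔ L₂) = 3 := by
    have := Submodule.finrank_sup_add_finrank_inf_eq L₁ L₂
    omega
  have hQ1 : L₁ ⊓ L₂ ≤ L₁ := inf_le_left
  have hQ2 : L₁ ⊓ L₂ ≤ L₂ := inf_le_right
  have hL1 : L₁ ≤ L₁ ⊔ L₂ := le_sup_left
  have hL2 : L₂ ≤ L₁ ⊔ L₂ := le_sup_right
  have hVQ : ∀ V : Submodule K W, (V ⊓ L₁) ⊓ (V ⊓ L₂) = (L₁ ⊓ L₂) ⊓ V := fun V => by
    rw [← inf_inf_distrib_left, inf_comm]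
  generalize L₁ ⊓ L₂ = Q at *
  generalize L₁ ⊔ L₂ = P at *
  have hQbot : Q ≠ ⊥ := Submodule.one_le_finrank_iff.mp hQ.ge
  have hA : finrank K ↥(Q ⊔ L₃) = 3 := by
    have := Submodule.finrank_sup_add_finrank_inf_eq Q L₃
    rw [hQ3, finrank_bot] at this
    omega
  have hB : finrank K ↥(Q ⊔ L₄) = 3 := by
    have := Submodule.finrank_sup_add_finrank_inf_eq Q L₄
    rw [hQ4, finrank_bot] at this
    omega
  have hP3 := Submodule.finrank_inf_eq_one_of_not_le hW hP h3 h3P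
  have hP4 := Submodule.finrank_inf_eq_one_of_not_le hW hP h4 h4P
  have hV₁ : finrank K ↥((Q ⊔ L₃) ⊓ (Q ⊔ L₄)) = 2 := by
    have hsum := Submodule.finrank_sup_add_finrank_inf_eq (Q ⊔ L₃) (Q ⊔ L₄)
    have hle := Submodule.finrank_le ((Q ⊔ L₃) ⊔ (Q ⊔ L₄))
    have hlt := Submodule.finrank_lt_finrank_of_lt (inf_lt_left.mpr
      fun h : Q ⊔ L₃ ≤ Q ⊔ L₄ => hgen (inf_le_right.trans (le_sup_right.trans h)))
    omega
  have hV₂ : finrank K ↥((P ⊓ L₃) ⊔ (P ⊓ L₄)) = 2 := by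
    have hsum := Submodule.finrank_sup_add_finrank_inf_eq (P ⊓ L₃) (P ⊓ L₄)
    rw [← inf_inf_distrib_left, h34, inf_bot_eq, finrank_bot] at hsum
    omega
  have hP3bot : P ⊓ L₃ ≠ ⊥ := Submodule.one_le_finrank_iff.mp hP3.ge
  have hP4bot : P ⊓ L₄ ≠ ⊥ := Submodule.one_le_finrank_iff.mp hP4.ge
  have hV₂P : (P ⊓ L₃) ⊔ (P ⊓ L₄) ≤ P := sup_le inf_le_left inf_le_left
  refine ⟨?_, fun h => hgen (le_sup_left.trans (h.ge.trans inf_le_right))⟩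
  ext V
  simp only [Set.mem_ofPred_eq, Set.mem_insert_iff, Set.mem_singleton_iff]
  constructor
  · rintro ⟨hV, hV1, hV2, hV3, hV4⟩
    by_cases hQV : Q ≤ V
    · left
      have hle : ∀ L : Submodule K W, Q ⊓ L = ⊥ → V ⊓ L ≠ ⊥ → V ≤ Q ⊔ L := fun L hQL hVL => by
        rw [← Submodule.sup_eq_of_finrank_eq_two hV hQV inf_le_left hQbot hVL
          (by rw [inf_left_comm, hQL, inf_bot_eq])]
        exact sup_le_sup_left inf_le_right Q
      exact Submodule.eq_of_le_of_finrank_eq (le_inf (hle _ hQ3 hV3) (hle _ hQ4 hV4))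
        (hV.trans hV₁.symm)
    · right
      have hVP : V ≤ P := by
        rw [← Submodule.sup_eq_of_finrank_eq_two hV inf_le_left inf_le_left hV1 hV2 ?_]
        · exact sup_le (inf_le_right.trans hL1) (inf_le_right.trans hL2)
        · rw [hVQ]
          by_contra h
          exact hQV (Submodule.le_of_finrank_eq_one_of_inf_ne_bot hQ h)
      have hle : ∀ L : Submodule K W, finrank K ↥(P ⊓ L) = 1 → V ⊓ L ≠ ⊥ → P ⊓ L ≤ V :=
        fun L hPL hVL => Submodule.le_of_finrank_eq_one_of_inf_ne_bot hPL <| by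
          rwa [inf_right_comm, inf_eq_right.mpr hVP]
      exact (Submodule.eq_of_le_of_finrank_eq (sup_le (hle _ hP3 hV3) (hle _ hP4 hV4))
        (hV₂.trans hV.symm)).symm
  · rintro (rfl | rfl)
    · have hQV : Q ≤ (Q ⊔ L₃) ⊓ (Q ⊔ L₄) := le_inf le_sup_left le_sup_left
      exact ⟨hV₁, ne_bot_of_le_ne_bot hQbot (le_inf hQV hQ1),
        ne_bot_of_le_ne_bot hQbot (le_inf hQV hQ2),
        Submodule.inf_ne_bot_of_finrank_lt inf_le_left le_sup_right (by omega),
        Submodule.inf_ne_bot_of_finrank_lt inf_le_right le_sup_right (by omega)⟩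
    · exact ⟨hV₂, Submodule.inf_ne_bot_of_finrank_lt hV₂P hL1 (by omega),
        Submodule.inf_ne_bot_of_finrank_lt hV₂P hL2 (by omega),
        ne_bot_of_le_ne_bot hP3bot (le_inf le_sup_left inf_le_right),
        ne_bot_of_le_ne_bot hP4bot (le_inf le_sup_right inf_le_right)⟩
end

section
/- Let λ and μ be partitions contained in a k×(n−k) rectangle. There exists a partition ν contained in the k×(n−k) rectangle with Littlewood–Richardson coefficient c^ν_{λ,μ} ≥ 1 if and only if λ_i + μ_{k+1−i} ≤ n−k for every i = 1, …, k. -/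
/-!  The "must meet" (MM) rule: two Schubert classes `σ_λ`, `σ_μ` of `G(k,n)`
have a nonzero product, i.e. some Littlewood–Richardson coefficient
`c^ν_{λ,μ}` with `ν` in the `k×(n-k)` rectangle is positive, if and only if
`λ_i + μ_{k+1-i} ≤ n-k` for all `i = 1, …, k`. -/

open scoped Classical

open Finset in
/-- The number of columns `j < N` whose stack of `A j` empty cells followed by `B j` filled cells
`1, 2, …, B j` has in row `r` a cell with entry at most `m` (empty cells counting as `0`). -/
noncomputable def stackCount (N : ℕ) (A B : ℕ → ℕ) (r m : ℕ) : ℕ :=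
  #{j ∈ range N | r < A j + min m (B j)}

/-- The filling whose row `r` has entries at most `m` exactly in its first
`stackCount N A B r m` cells. -/
noncomputable def stackFilling (N : ℕ) (A B : ℕ → ℕ) (x : ℕ × ℕ) : ℕ :=
  sInf {m | x.2 < stackCount N A B x.1 m}

section Stack

variable {N : ℕ} {A B : ℕ → ℕ}

lemma stackCount_le (r m : ℕ) : stackCount N A B r m ≤ N := by
  exact (Finset.card_filter_le _ _).trans_eq (Finset.card_range N)

lemma stackCount_mono (r : ℕ) : Monotone (stackCount N A B r) := by
  intro m m' h
  refine Finset.card_le_card fun j hj => ?_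
  simp only [Finset.mem_filter, Finset.mem_range] at hj ⊢
  omega

lemma stackCount_succ_le {r r' : ℕ} (h : r < r') (m : ℕ) :
    stackCount N A B r' (m + 1) ≤ stackCount N A B r m := by
  refine Finset.card_le_card fun j hj => ?_
  simp only [Finset.mem_filter, Finset.mem_range] at hj ⊢
  omega

lemma stackCount_antitone (m : ℕ) : Antitone fun r => stackCount N A B r m := by
  intro r r' h
  refine Finset.card_le_card fun j hj => ?_
  simp only [Finset.mem_filter, Finset.mem_range] at hj ⊢
  omega

lemma stackFilling_eq_succ_iff (r c m : ℕ) :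
    stackFilling N A B (r, c) = m + 1 ↔
      stackCount N A B r m ≤ c ∧ c < stackCount N A B r (m + 1) := by
  unfold stackFilling
  constructor
  · intro h
    have hne : {m | c < stackCount N A B r m}.Nonempty := by
      by_contra hne
      rw [Set.not_nonempty_iff_eq_empty] at hne
      simp [hne] at h
    have h1 := Nat.sInf_mem hne
    have h2 : m ∉ {m | c < stackCount N A B r m} :=
      Nat.notMem_of_lt_sInf (by simp only at h; omega)
    simp only at h
    rw [h] at h1
    exact ⟨not_lt.mp h2, h1⟩
  · rintro ⟨h1, h2⟩
    refine le_antisymm (Nat.sInf_le h2) ?_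
    refine le_csInf ⟨_, h2⟩ fun b hb => ?_
    by_contra hlt
    have := stackCount_mono (N := N) (A := A) (B := B) r (show b ≤ m by omega)
    simp only [Set.mem_ofPred_eq] at hb
    omega

lemma stackFilling_le {r c m : ℕ} (h : c < stackCount N A B r m) :
    stackFilling N A B (r, c) ≤ m :=
  Nat.sInf_le h

lemma lt_stackCount_stackFilling {r c m : ℕ} (h : c < stackCount N A B r m) :
    c < stackCount N A B r (stackFilling N A B (r, c)) :=
  Nat.sInf_mem (s := {m | c < stackCount N A B r m}) ⟨m, h⟩

lemma stackFilling_pos_iff {k : ℕ} (hB : ∀ j, B j ≤ k) (r c : ℕ) :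
    0 < stackFilling N A B (r, c) ↔
      stackCount N A B r 0 ≤ c ∧ c < stackCount N A B r k := by
  constructor
  · intro h
    obtain ⟨m, hm⟩ := Nat.exists_eq_succ_of_ne_zero h.ne'
    obtain ⟨h1, h2⟩ := (stackFilling_eq_succ_iff r c m).mp hm
    refine ⟨(stackCount_mono r (Nat.zero_le m)).trans h1, h2.trans_le ?_⟩
    refine Finset.card_le_card fun j hj => ?_
    have := hB j
    simp only [Finset.mem_filter, Finset.mem_range] at hj ⊢
    omega
  · rintro ⟨h1, h2⟩
    by_contra h0
    have h3 := lt_stackCount_stackFilling h2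
    rw [Nat.eq_zero_of_not_pos h0] at h3
    omega

open Finset in
lemma card_stackFilling_row (r m : ℕ) :
    #{c ∈ range N | stackFilling N A B (r, c) = m + 1} =
      #{j ∈ {j ∈ range N | m < B j} | A j + m = r} := by
  have h1 : {c ∈ range N | stackFilling N A B (r, c) = m + 1} =
      Ico (stackCount N A B r m) (stackCount N A B r (m + 1)) := by
    ext c
    have := stackCount_le (N := N) (A := A) (B := B) r (m + 1)
    simp only [mem_filter, mem_range, mem_Ico, stackFilling_eq_succ_iff]
    omega
  rw [h1, Nat.card_Ico, stackCount, stackCount, ← card_sdiff_of_subset]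
  · congr 1
    ext j
    simp only [mem_filter, mem_range, mem_sdiff]
    omega
  · intro j hj
    simp only [mem_filter, mem_range] at hj ⊢
    omega

open Finset in
lemma card_stackFilling_rows (r m : ℕ) :
    #{x ∈ range r ×ˢ range N | stackFilling N A B x = m + 1} =
      #{j ∈ range N | m < B j ∧ A j + m < r} := by
  rw [card_filter, sum_product]
  simp only [← card_filter, card_stackFilling_row]
  rw [← filter_filter, card_eq_sum_card_fiberwise (f := fun j => A j + m) (t := range r)]
  · refine sum_congr rfl fun i hi => ?_
    rw [filter_filter, filter_filter, filter_filter]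
    congr 1
    ext j
    simp only [mem_filter, mem_range] at hi ⊢
    omega
  · intro j hj
    simpa using (mem_filter.mp hj).2

open Finset in
lemma stackFilling_isLRSkewTableau {k : ℕ} {mu : ℕ → ℕ} (hB : ∀ j, B j ≤ k)
    (hAB : ∀ j < N, A j + B j ≤ k) (hmu : ∀ m, #{j ∈ range N | m < B j} = mu m) :
    IsLRSkewTableau (fun r => stackCount N A B r 0) mu (fun r => stackCount N A B r k)
      (stackFilling N A B) := by
  have hpos : ∀ x : ℕ × ℕ, 0 < stackFilling N A B x ↔
      InSkew (fun r => stackCount N A B r 0) (fun r => stackCount N A B r k) x :=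
    fun x => stackFilling_pos_iff hB x.1 x.2
  have hskew : ∀ (x : ℕ × ℕ) (m : ℕ), stackFilling N A B x = m + 1 →
      InSkew (fun r => stackCount N A B r 0) (fun r => stackCount N A B r k) x ∧ x.2 < N :=
    fun x m h => by
      have := (hpos x).mp (by omega)
      exact ⟨this, this.2.trans_le (stackCount_le _ _)⟩
  have hrow : ∀ x : ℕ × ℕ,
      InSkew (fun r => stackCount N A B r 0) (fun r => stackCount N A B r k) x → x.1 < k := by
    intro x hx
    obtain ⟨j, hj⟩ := card_pos.mp (Nat.zero_lt_of_lt hx.2)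
    rw [mem_filter, mem_range] at hj
    have := hAB j hj.1
    omega
  refine ⟨hpos, ?_, ?_, ?_, ?_⟩
  · intro i j j' _ hjj' hj'
    exact stackFilling_le (hjj'.trans_lt (lt_stackCount_stackFilling hj'))
  · intro i i' j hii' _ hj'
    obtain ⟨m, hm⟩ := Nat.exists_eq_succ_of_ne_zero ((hpos (i', j)).mpr hj').ne'
    have h2 := ((stackFilling_eq_succ_iff i' j m).mp hm).2
    rw [hm]
    exact Nat.lt_succ_of_le (stackFilling_le (h2.trans_le (stackCount_succ_le hii' m)))
  · intro m hm
    obtain ⟨m, rfl⟩ := Nat.exists_eq_succ_of_ne_zero hm.ne'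
    rw [Nat.subtype_card {x ∈ range k ×ˢ range N | stackFilling N A B x = m + 1},
      card_stackFilling_rows, Nat.succ_sub_one, ← hmu]
    · congr 1
      ext j
      have := hAB j
      simp only [mem_filter, mem_range]
      omega
    · intro x
      simp only [mem_filter, mem_product, mem_range]
      refine ⟨fun h => ⟨(hskew x m h.2).1, h.2⟩, fun h => ⟨⟨hrow x h.1, (hskew x m h.2).2⟩, h.2⟩⟩
  · intro m hm r c
    obtain ⟨m, rfl⟩ := Nat.exists_eq_succ_of_ne_zero hm.ne'
    rw [Nat.subtype_card {x ∈ {x ∈ range (r + 1) ×ˢ range N |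
        stackFilling N A B x = m + 1 + 1} | ReadBefore r c x},
      Nat.subtype_card {x ∈ {x ∈ range (r + 1) ×ˢ range N |
        stackFilling N A B x = m + 1} | ReadBefore r c x}]
    · calc _ ≤ #{x ∈ range (r + 1) ×ˢ range N | stackFilling N A B x = m + 1 + 1} :=
            card_filter_le _ _
        _ ≤ #{x ∈ range r ×ˢ range N | stackFilling N A B x = m + 1} := by
            rw [card_stackFilling_rows, card_stackFilling_rows]
            refine card_le_card fun j hj => ?_
            simp only [mem_filter, mem_range] at hj ⊢
            omega
        _ ≤ _ := by
            refine card_le_card fun x hx => ?_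
            simp only [mem_filter, mem_product, mem_range] at hx ⊢
            exact ⟨⟨⟨by omega, hx.1.2⟩, hx.2⟩, Or.inl hx.1.1⟩
    all_goals
      intro x
      simp only [mem_filter, mem_product, mem_range]
      refine ⟨fun h => ⟨h.2, (hskew x _ h.1.2).1, h.1.2⟩,
        fun h => ⟨⟨⟨?_, (hskew x _ h.2.2).2⟩, h.2.2⟩, h.1⟩⟩
      rcases h.1 with h | h <;> omega

end Stack

lemma exists_conjugate {lam : ℕ → ℕ} {k : ℕ} (hlam : Antitone lam)
    (hk : ∀ i, k ≤ i → lam i = 0) :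
    ∃ A : ℕ → ℕ, (∀ j, A j ≤ k) ∧ ∀ r j, r < A j ↔ j < lam r := by
  have hex : ∀ j, ∃ i, lam i ≤ j := fun j => ⟨k, by simp [hk k le_rfl]⟩
  refine ⟨fun j => Nat.find (hex j), fun j => Nat.find_min' _ (by simp [hk k le_rfl]), ?_⟩
  intro r j
  rw [Nat.lt_find_iff]
  exact ⟨fun h => not_le.mp (h r le_rfl), fun h i hi => not_le.mpr (h.trans_le (hlam hi))⟩

section Tableau

variable {lam mu nu : ℕ → ℕ} {T : ℕ × ℕ → ℕ} {N k : ℕ}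

lemma InSkew.mem_box (hN : ∀ i, nu i ≤ N) (hk : ∀ i, k ≤ i → nu i = 0) {x : ℕ × ℕ}
    (hx : InSkew lam nu x) : x.1 < k ∧ x.2 < N := by
  refine ⟨?_, hx.2.trans_le (hN _)⟩
  by_contra h
  have := hk x.1 (not_lt.mp h)
  have := hx.2
  omega

open Finset in
lemma IsLRSkewTableau.card_content (hT : IsLRSkewTableau lam mu nu T) (hN : ∀ i, nu i ≤ N)
    (hk : ∀ i, k ≤ i → nu i = 0) (m : ℕ) :
    #{x ∈ range k ×ˢ range N | T x = m + 1} = mu m := by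
  have h := hT.2.2.2.1 (m + 1) m.succ_pos
  rw [Nat.subtype_card {x ∈ range k ×ˢ range N | T x = m + 1}] at h
  · exact h
  · intro x
    simp only [mem_filter, mem_product, mem_range]
    constructor
    · rintro ⟨_, h⟩
      exact ⟨(hT.1 x).mp (by omega), h⟩
    · rintro ⟨h, h'⟩
      exact ⟨h.mem_box hN hk, h'⟩

lemma IsLRSkewTableau.le (hT : IsLRSkewTableau lam mu nu T) (hN : ∀ i, nu i ≤ N)
    (hk : ∀ i, k ≤ i → nu i = 0) (hmu : ∀ i, k ≤ i → mu i = 0) (x : ℕ × ℕ) : T x ≤ k := by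
  by_contra h
  have hx := ((hT.1 x).mp (by omega)).mem_box hN hk
  have hc := hT.card_content hN hk (T x - 1)
  rw [hmu _ (by omega), Finset.card_eq_zero] at hc
  have : x ∈ {y ∈ Finset.range k ×ˢ Finset.range N | T y = T x - 1 + 1} := by
    simp only [Finset.mem_filter, Finset.mem_product, Finset.mem_range]
    omega
  rw [hc] at this
  simp at this

lemma finite_isLRSkewTableau (hN : ∀ i, nu i ≤ N)
    (hk : ∀ i, k ≤ i → nu i = 0) (hmu : ∀ i, k ≤ i → mu i = 0) :
    Finite {T : ℕ × ℕ → ℕ // IsLRSkewTableau lam mu nu T} := by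
  refine Finite.of_injective (β := Fin k × Fin N → Fin (k + 1))
    (fun T x => ⟨T.1 (x.1, x.2), Nat.lt_succ_of_le (T.2.le hN hk hmu _)⟩) ?_
  rintro ⟨T, hT⟩ ⟨T', hT'⟩ h
  ext x
  by_cases hx : InSkew lam nu x
  · obtain ⟨h1, h2⟩ := hx.mem_box hN hk
    simpa using congrFun h (⟨x.1, h1⟩, ⟨x.2, h2⟩)
  · have h1 := mt (hT.1 x).mp hx
    have h2 := mt (hT'.1 x).mp hx
    simp only
    omega

open Finset in
/-- Entries `m + 2` in the first `r + 1` rows are matched by entries `m + 1` in the first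
`r` rows. -/
lemma IsLRSkewTableau.card_rows_succ_le (hT : IsLRSkewTableau lam mu nu T)
    (hN : ∀ i, nu i ≤ N) (m r : ℕ) :
    #{x ∈ range (r + 1) ×ˢ range N | T x = m + 1 + 1} ≤
      #{x ∈ range r ×ˢ range N | T x = m + 1} := by
  have hskew : ∀ x m, T x = m + 1 → InSkew lam nu x := fun x m h => (hT.1 x).mp (by omega)
  obtain ⟨c, hc⟩ : ∃ c, ∀ j, (T (r, j) = m + 1 + 1 → c ≤ j) ∧ (T (r, j) = m + 1 → j < c) := by
    by_cases hex : ∃ j, T (r, j) = m + 1 + 1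
    · refine ⟨Nat.find hex, fun j => ⟨fun h => Nat.find_min' hex h, fun h => ?_⟩⟩
      by_contra hlt
      have h1 := hskew _ _ (Nat.find_spec hex)
      have h2 := hT.2.1 r _ j h1.1 (not_lt.mp hlt) (hskew _ _ h).2
      rw [Nat.find_spec hex] at h2
      omega
    · exact ⟨nu r, fun j => ⟨fun h => (hex ⟨j, h⟩).elim, fun h => (hskew _ _ h).2⟩⟩
  have h := hT.2.2.2.2 (m + 1) m.succ_pos r c
  rw [Nat.subtype_card {x ∈ range (r + 1) ×ˢ range N | T x = m + 1 + 1},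
    Nat.subtype_card {x ∈ range r ×ˢ range N | T x = m + 1}] at h
  · exact h
  · rintro ⟨i, j⟩
    simp only [mem_filter, mem_product, mem_range, ReadBefore]
    constructor
    · rintro ⟨h1, h2⟩
      exact ⟨Or.inl h1.1, hskew _ _ h2, h2⟩
    · rintro ⟨h1, h2, h3⟩
      refine ⟨⟨?_, h2.2.trans_le (hN _)⟩, h3⟩
      rcases h1 with h1 | ⟨rfl, h1⟩
      · exact h1
      · have := (hc j).2 h3
        omega
  · rintro ⟨i, j⟩
    simp only [mem_filter, mem_product, mem_range, ReadBefore]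
    constructor
    · rintro ⟨h1, h2⟩
      refine ⟨?_, hskew _ _ h2, h2⟩
      rcases Nat.lt_succ_iff_lt_or_eq.mp h1.1 with h | rfl
      · exact Or.inl h
      · exact Or.inr ⟨rfl, (hc j).1 h2⟩
    · rintro ⟨h1, h2, h3⟩
      exact ⟨⟨by omega, h2.2.trans_le (hN _)⟩, h3⟩

open Finset in
lemma IsLRSkewTableau.card_rows_add_le (hT : IsLRSkewTableau lam mu nu T)
    (hN : ∀ i, nu i ≤ N) (m r : ℕ) :
    #{x ∈ range (r + m) ×ˢ range N | T x = m + 1} ≤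
      #{x ∈ range r ×ˢ range N | T x = 1} := by
  induction m with
  | zero => rfl
  | succ m ih => exact (hT.card_rows_succ_le hN m (r + m)).trans ih

open Finset in
lemma IsLRSkewTableau.add_le (hT : IsLRSkewTableau lam mu nu T) (hlam : Antitone lam)
    (hlamN : ∀ i, lam i ≤ N) (hN : ∀ i, nu i ≤ N) (hk : ∀ i, k ≤ i → nu i = 0)
    {i : ℕ} (hi : i < k) : lam i + mu (k - 1 - i) ≤ N := by
  have h1 := hT.card_rows_add_le hN (k - 1 - i) (i + 1)
  rw [show i + 1 + (k - 1 - i) = k by omega, hT.card_content hN hk] at h1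
  have h2 : #{x ∈ range (i + 1) ×ˢ range N | T x = 1} ≤ #(Ico (lam i) N) := by
    refine card_le_card_of_injOn Prod.snd ?_ ?_
    · rintro x hx
      simp only [coe_filter, mem_product, mem_range, Set.mem_ofPred_eq] at hx
      have hs := ((hT.1 x).mp (by omega)).1
      have := hlam (show x.1 ≤ i by omega)
      simp only [coe_Ico, Set.mem_Ico]
      omega
    · rintro ⟨a, b⟩ hx ⟨a', b'⟩ hy hxy
      simp only [coe_filter, Set.mem_ofPred_eq] at hx hy hxy
      subst hxy
      have hsx := (hT.1 (a, b)).mp (by omega)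
      have hsy := (hT.1 (a', b)).mp (by omega)
      rcases lt_trichotomy a a' with h | h | h
      · have := hT.2.2.1 a a' b h hsx hsy
        omega
      · rw [h]
      · have := hT.2.2.1 a' a b h hsy hsx
        omega
  rw [Nat.card_Ico] at h2
  have := hlamN i
  omega

end Tableau

/-- **The MM rule.**  For partitions `λ, μ` in a `k × (n-k)` rectangle, there is
a partition `ν` in the rectangle with `c^ν_{λ,μ} ≥ 1` iff
`λ_i + μ_{k+1-i} ≤ n-k` for every `i = 1, …, k` (stated `0`-indexed:
`lam i + mu (k-1-i) ≤ n-k` for `i < k`). -/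
theorem exists_lrCoeff_pos_iff (n k : ℕ) (hk : k ≤ n)
    (lam mu : ℕ → ℕ)
    (hlam : IsRectPartition n k lam) (hmu : IsRectPartition n k mu) :
    (∃ nu : ℕ → ℕ, IsRectPartition n k nu ∧ 1 ≤ lrCoeff lam mu nu) ↔
      ∀ i, i < k → lam i + mu (k - 1 - i) ≤ n - k := by
  obtain ⟨hlam_anti, hlamN, hlamk⟩ := hlam
  obtain ⟨hmu_anti, hmuN, hmuk⟩ := hmu
  constructor
  · rintro ⟨nu, ⟨-, hnuN, hnuk⟩, hc⟩ i hi
    unfold lrCoeff at hc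
    split_ifs at hc
    · obtain ⟨T, hT⟩ := (Nat.card_pos_iff.mp hc).1
      exact hT.add_le hlam_anti hlamN hnuN hnuk hi
    · omega
  · intro h
    obtain ⟨A, hAk, hA⟩ := exists_conjugate hlam_anti hlamk
    obtain ⟨B, hBk, hB⟩ := exists_conjugate hmu_anti hmuk
    generalize hNdef : n - k = N at *
    let B' : ℕ → ℕ := fun j => B (N - 1 - j)
    have hAB : ∀ j < N, A j + B' j ≤ k := by
      intro j hj
      by_contra hlt
      have h1 : A j ≤ k := hAk j
      have h2 : B' j ≤ k := hBk _
      have h3 := (hA (A j - 1) j).mp (by omega)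
      have h4 := (hB (k - 1 - (A j - 1)) (N - 1 - j)).mp
        (show k - 1 - (A j - 1) < B' j by omega)
      have h5 := h (A j - 1) (by omega)
      omega
    have hmu : ∀ m, Finset.card {j ∈ Finset.range N | m < B' j} = mu m := by
      intro m
      have : {j ∈ Finset.range N | m < B' j} = Finset.Ico (N - mu m) N := by
        ext j
        have := hmuN m
        simp only [B', hB, Finset.mem_filter, Finset.mem_range, Finset.mem_Ico]
        omega
      rw [this, Nat.card_Ico]
      have := hmuN m
      omega
    have hlam : (fun r => stackCount N A B' r 0) = lam := by
      funext r
      have : {j ∈ Finset.range N | r < A j + min 0 (B' j)} = Finset.range (lam r) := by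
        ext j
        have := hlamN r
        simp only [Nat.zero_min, add_zero, hA, Finset.mem_filter, Finset.mem_range]
        omega
      rw [stackCount, this, Finset.card_range]
    have hT := stackFilling_isLRSkewTableau (fun j => hBk _) hAB hmu
    rw [hlam] at hT
    have hnuk : ∀ r, k ≤ r → stackCount N A B' r k = 0 := by
      intro r hr
      rw [stackCount, Finset.card_eq_zero, Finset.filter_eq_empty_iff]
      intro j hj
      have := hAB j (Finset.mem_range.mp hj)
      omega
    refine ⟨fun r => stackCount N A B' r k,
      ⟨stackCount_antitone k, fun r => hNdef ▸ stackCount_le r k, hnuk⟩, ?_⟩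
    rw [lrCoeff, if_pos fun r => (congrFun hlam r).symm.le.trans
      (stackCount_mono r (Nat.zero_le k))]
    have := finite_isLRSkewTableau (lam := lam) (mu := mu)
      (fun r => stackCount_le (N := N) (A := A) (B := B') r k) hnuk hmuk
    exact Nat.card_pos_iff.mpr ⟨⟨⟨_, hT⟩⟩, this⟩
end

section
/- Let α, β, γ be binary strings of length n, each containing exactly k ones. Then the number of puzzles of size n with boundary (α, β, γ) equals the number of puzzles of size n with boundary (β, α, γ). -/
/-!  Commutativity of puzzle counts: the number of puzzles with boundary
`(α, β, γ)` equals the number with boundary `(β, α, γ)`. -/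

open scoped Classical

section WeightedPuzzles

variable {R : Type*} [CommRing R]

/-- The crossing of a strand labelled `a` coming from the northwest with a strand labelled `b`
coming from the northeast: the weighted sum of `G c d` over the possible labels `c` of the first
and `d` of the second strand after the crossing. The parameter `u` is the weight of the
equivariant rhombus. -/
def cross (u : R) (a b : Fin 3) (G : Fin 3 → Fin 3 → R) : R :=
  match a, b with
  | 0, 0 => G 0 0 + G 2 1
  | 0, 1 => u * G 0 1
  | 0, 2 => G 0 2 + G 1 1
  | 1, 0 => G 1 0
  | 1, 1 => G 0 2 + G 1 1
  | 1, 2 => 0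
  | 2, 0 => 0
  | 2, 1 => G 0 0 + G 2 1
  | 2, 2 => 0

open Classical in
/-- The weight of an upward triangle on the south side. -/
noncomputable def fuse (l r b : Fin 3) : R := if ValidUp l r b then 1 else 0

/-- A strand with parameter `x` and label `h` coming from the northwest crosses the strands of a
list coming from the northeast and fuses with the last of them to the label `s`; `F` is evaluated
at the resulting list of northeast strands. -/
noncomputable def strip (x : R) (s : Fin 3) :
    Fin 3 → List (R × Fin 3) → (List (R × Fin 3) → R) → R
  | _, [], _ => 0
  | h, [e], F => fuse h e.2 s * F []
  | h, e :: e' :: es, F =>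
    cross (x - e.1) h e.2 fun c d => strip x s c (e' :: es) fun l => F ((e.1, d) :: l)

/-- A strand with parameter `y` and label `e` coming from the northeast crosses the strands of a
list coming from the northwest and fuses with the last of them to the label `s`. -/
noncomputable def coStrip (y : R) (s : Fin 3) :
    Fin 3 → List (R × Fin 3) → (List (R × Fin 3) → R) → R
  | _, [], _ => 0
  | e, [p], G => fuse p.2 e s * G []
  | e, p :: p' :: ps, G =>
    cross (p.1 - y) p.2 e fun c d => coStrip y s d (p' :: ps) fun l => G ((p.1, c) :: l)

/-- The weighted number of equivariant puzzles. The northwest side (with parameters) and the south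
side are read right to left, the northeast side (with parameters) left to right. -/
noncomputable def weightedCount :
    List (R × Fin 3) → List (R × Fin 3) → List (Fin 3) → R
  | [], [], [] => 1
  | p :: ps, μ, s :: ss => strip p.1 s p.2 μ fun l => weightedCount ps l ss
  | _, _, _ => 0

/-- The labels which the exchange operator swaps. -/
def Descends (a b : Fin 3) : Prop := (a = 1 ∧ b ≠ 1) ∨ (a = 2 ∧ b = 0)

instance (a b : Fin 3) : Decidable (Descends a b) := by unfold Descends; infer_instance

/-- The coefficient of the swap in the exchange operator. -/
def swapCoeff (x y : R) (a b : Fin 3) : R := if Descends a b then y - x else 0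

/-- The exchange operator at position `k` of the list, with coefficients `m`. -/
def exchange (m : R → R → Fin 3 → Fin 3 → R) :
    ℕ → (List (R × Fin 3) → R) → List (R × Fin 3) → R
  | 0, F, a :: b :: l =>
    F ((b.1, a.2) :: (a.1, b.2) :: l) + m a.1 b.1 a.2 b.2 * F ((b.1, b.2) :: (a.1, a.2) :: l)
  | k + 1, F, a :: l => exchange m k (fun l => F (a :: l)) l
  | _, _, _ => 0

/-- The swap coefficients for a list read from right to left. -/
def swapCoeffRev (x y : R) (a b : Fin 3) : R := swapCoeff y x b a

theorem fin_three_cases (a : Fin 3) : a = 0 ∨ a = 1 ∨ a = 2 := by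
  fin_cases a <;> simp

theorem cross_add_mul (u m : R) (a b : Fin 3) (G G' : Fin 3 → Fin 3 → R) :
    cross u a b (fun c d => G c d + m * G' c d) = cross u a b G + m * cross u a b G' := by
  rcases fin_three_cases a with rfl | rfl | rfl <;>
  rcases fin_three_cases b with rfl | rfl | rfl <;> simp only [cross] <;> ring

theorem cross_linearMap {β : Type*} (Λ : (β → R) →ₗ[R] R) (u : R) (a b : Fin 3)
    (G : β → Fin 3 → Fin 3 → R) :
    cross u a b (fun c d => Λ fun k => G k c d) = Λ fun k => cross u a b (G k) := by
  have hz : Λ (fun _ => 0) = 0 := map_zero Λ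
  have ha : ∀ f g : β → R, Λ (fun k => f k + g k) = Λ f + Λ g := fun f g => map_add Λ f g
  have hm : ∀ (r : R) (f : β → R), Λ (fun k => r * f k) = r * Λ f := fun r f => map_smul Λ r f
  rcases fin_three_cases a with rfl | rfl | rfl <;>
  rcases fin_three_cases b with rfl | rfl | rfl <;> simp only [cross, ha, hm, hz]

theorem strip_add_mul (x : R) (s : Fin 3) (m : R) (h : Fin 3) (l : List (R × Fin 3))
    (F F' : List (R × Fin 3) → R) :
    strip x s h l (fun l => F l + m * F' l) = strip x s h l F + m * strip x s h l F' := by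
  induction l generalizing h F F' with
  | nil => simp [strip]
  | cons e es ih =>
    cases es with
    | nil => simp only [strip]; ring
    | cons e' es => simp only [strip, ih, cross_add_mul]

theorem coStrip_add_mul (y : R) (s : Fin 3) (m : R) (h : Fin 3) (l : List (R × Fin 3))
    (F F' : List (R × Fin 3) → R) :
    coStrip y s h l (fun l => F l + m * F' l) = coStrip y s h l F + m * coStrip y s h l F' := by
  induction l generalizing h F F' with
  | nil => simp [coStrip]
  | cons e es ih =>
    cases es with
    | nil => simp only [coStrip]; ring
    | cons e' es => simp only [coStrip, ih, cross_add_mul]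

theorem strip_linearMap {β : Type*} (Λ : (β → R) →ₗ[R] R) (x : R) (s h : Fin 3)
    (l : List (R × Fin 3)) (F : β → List (R × Fin 3) → R) :
    strip x s h l (fun l => Λ fun k => F k l) = Λ fun k => strip x s h l (F k) := by
  induction l generalizing h F with
  | nil => exact (map_zero Λ).symm
  | cons e es ih =>
    cases es with
    | nil => exact (map_smul Λ _ _).symm
    | cons e' es => simp only [strip, ih, cross_linearMap]

theorem strip_zero (x : R) (s h : Fin 3) (l : List (R × Fin 3)) :
    strip x s h l (fun _ => 0) = 0 := by
  simpa using strip_linearMap (0 : (Unit → R) →ₗ[R] R) x s h l fun _ _ => 0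

theorem coStrip_zero (y : R) (s e : Fin 3) (l : List (R × Fin 3)) :
    coStrip y s e l (fun _ => 0) = 0 := by
  simpa using coStrip_add_mul y s (-1) e l (fun _ => 0) (fun _ => 0)

/-- `coStrip` as a linear functional. -/
noncomputable def coStripLinear (y : R) (s e : Fin 3) (l : List (R × Fin 3)) :
    (List (R × Fin 3) → R) →ₗ[R] R where
  toFun := coStrip y s e l
  map_add' F F' := by
    have := coStrip_add_mul y s 1 e l F F'
    simp only [one_mul] at this
    exact this
  map_smul' m F := by
    have := coStrip_add_mul y s m e l (fun _ => 0) F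
    simp only [coStrip_zero, zero_add] at this
    exact this

/-- `strip` as a linear functional. -/
noncomputable def stripLinear (x : R) (s h : Fin 3) (l : List (R × Fin 3)) :
    (List (R × Fin 3) → R) →ₗ[R] R where
  toFun := strip x s h l
  map_add' F F' := by
    have := strip_add_mul x s 1 h l F F'
    simp only [one_mul] at this
    exact this
  map_smul' m F := by
    have := strip_add_mul x s m h l (fun _ => 0) F
    simp only [strip_zero, zero_add] at this
    exact this

theorem strip_coStrip (x : R) (s h : Fin 3) (l : List (R × Fin 3)) (y : R) (t e : Fin 3)
    (ps : List (R × Fin 3)) (F : List (R × Fin 3) → List (R × Fin 3) → R) :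
    strip x s h l (fun l => coStrip y t e ps fun k => F k l) =
      coStrip y t e ps fun k => strip x s h l (F k) :=
  strip_linearMap (coStripLinear y t e ps) x s h l F

theorem exchange_linearMap {β : Type*} (Λ : (β → R) →ₗ[R] R) (m : R → R → Fin 3 → Fin 3 → R)
    (k : ℕ) (l : List (R × Fin 3)) (F : β → List (R × Fin 3) → R) :
    exchange m k (fun l => Λ fun i => F i l) l = Λ fun i => exchange m k (F i) l := by
  induction k generalizing l F with
  | zero =>
    match l with
    | [] => exact (map_zero Λ).symm
    | [_] => exact (map_zero Λ).symm
    | a :: b :: l =>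
      have := map_add Λ (fun i => F i ((b.1, a.2) :: (a.1, b.2) :: l))
        (m a.1 b.1 a.2 b.2 • fun i => F i ((b.1, b.2) :: (a.1, a.2) :: l))
      rw [map_smul] at this
      exact this.symm
  | succ k ih =>
    match l with
    | [] => exact (map_zero Λ).symm
    | a :: l => exact ih l fun i l => F i (a :: l)

theorem exchange_congr (m : R → R → Fin 3 → Fin 3 → R) (k : ℕ) (l : List (R × Fin 3))
    {F F' : List (R × Fin 3) → R} (hF : ∀ l', l'.length = l.length → F l' = F' l') :
    exchange m k F l = exchange m k F' l := by
  induction k generalizing l F F' with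
  | zero =>
    match l with
    | [] => rfl
    | [_] => rfl
    | a :: b :: l => simp only [exchange]; rw [hF _ (by simp), hF _ (by simp)]
  | succ k ih =>
    match l with
    | [] => rfl
    | a :: l => exact ih l fun l' hl' => hF _ (by simp [hl'])

theorem strip_congr (x : R) (s h : Fin 3) (l : List (R × Fin 3)) (F F' : List (R × Fin 3) → R)
    (hF : ∀ k, k.map Prod.fst = (l.map Prod.fst).dropLast → F k = F' k) :
    strip x s h l F = strip x s h l F' := by
  induction l generalizing h F F' with
  | nil => rfl
  | cons e es ih =>
    cases es with
    | nil => simp only [strip]; rw [hF [] (by simp)]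
    | cons e' es =>
      simp only [strip]
      congr 1
      funext c d
      exact ih _ _ _ fun k hk => hF _ (by simp [hk])

theorem coStrip_congr (y : R) (s h : Fin 3) (l : List (R × Fin 3)) (F F' : List (R × Fin 3) → R)
    (hF : ∀ k, k.map Prod.fst = (l.map Prod.fst).dropLast → F k = F' k) :
    coStrip y s h l F = coStrip y s h l F' := by
  induction l generalizing h F F' with
  | nil => rfl
  | cons e es ih =>
    cases es with
    | nil => simp only [coStrip]; rw [hF [] (by simp)]
    | cons e' es =>
      simp only [coStrip]
      congr 1
      funext c d
      exact ih _ _ _ fun k hk => hF _ (by simp [hk])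

/-- The weighted count can be computed by removing the strip along the northwest side. -/
theorem weightedCount_concat (ps es : List (R × Fin 3)) (ss : List (Fin 3)) (e : R × Fin 3)
    (s : Fin 3) (hps : ps.length = es.length + 1) (hss : ss.length = es.length) :
    weightedCount ps (e :: es) (ss ++ [s]) =
      coStrip e.1 s e.2 ps fun l => weightedCount l es ss := by
  induction ps generalizing e es ss with
  | nil => simp at hps
  | cons p ps ih =>
    match es, ss, hss with
    | [], [], _ =>
      obtain rfl : ps = [] := by simpa using hps
      simp [weightedCount, strip, coStrip]
    | e' :: es, s' :: ss, hss =>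
      match ps, hps with
      | p' :: ps, hps =>
        simp only [List.cons_append, weightedCount, strip, coStrip]
        congr 1
        funext c d
        rw [← strip_coStrip]
        apply strip_congr
        intro k hk
        have hk' := congrArg List.length hk
        simp only [List.length_map, List.length_dropLast, List.length_cons] at hk' hps hss
        exact ih k ss (e.1, d) (by simp; omega) (by omega)

theorem cross_exchange_strip (x p q : R) (h a b : Fin 3) (G : Fin 3 → Fin 3 → Fin 3 → R) :
    cross (x - q) h a (fun c d => cross (x - p) c b fun c' d' => G c' d d') +
      swapCoeff p q a b *
        cross (x - q) h b (fun c d => cross (x - p) c a fun c' d' => G c' d d') =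
    cross (x - p) h a fun c d => cross (x - q) c b fun c' d' =>
      G c' d d' + swapCoeff p q d d' * G c' d' d := by
  rcases fin_three_cases h with rfl | rfl | rfl <;>
  rcases fin_three_cases a with rfl | rfl | rfl <;>
  rcases fin_three_cases b with rfl | rfl | rfl <;>
  simp [cross, swapCoeff, Descends] <;> ring

theorem cross_exchange_coStrip (y p q : R) (e a b : Fin 3) (G : Fin 3 → Fin 3 → Fin 3 → R) :
    cross (q - y) a e (fun c d => cross (p - y) b d fun c' d' => G d' c c') +
      swapCoeffRev p q a b *
        cross (q - y) b e (fun c d => cross (p - y) a d fun c' d' => G d' c c') =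
    cross (p - y) a e fun c d => cross (q - y) b d fun c' d' =>
      G d' c c' + swapCoeffRev p q c c' * G d' c' c := by
  rcases fin_three_cases e with rfl | rfl | rfl <;>
  rcases fin_three_cases a with rfl | rfl | rfl <;>
  rcases fin_three_cases b with rfl | rfl | rfl <;>
  simp [cross, swapCoeffRev, swapCoeff, Descends] <;> ring

/-- `cross` as a linear functional. -/
def crossLinear (u : R) (a b : Fin 3) : (Fin 3 × Fin 3 → R) →ₗ[R] R where
  toFun f := cross u a b fun c d => f (c, d)
  map_add' f g := by
    have := cross_add_mul u 1 a b (fun c d => f (c, d)) (fun c d => g (c, d))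
    simp only [one_mul] at this
    exact this
  map_smul' m f := by
    have := cross_add_mul u m a b (fun _ _ => 0) (fun c d => f (c, d))
    have h0 : cross u a b (fun _ _ => 0) = 0 := by
      simpa using cross_linearMap (0 : (Unit → R) →ₗ[R] R) u a b fun _ _ _ => 0
    simp only [h0, zero_add] at this
    exact this

/-- The Yang–Baxter equation for a strand from the northwest. -/
theorem exchange_strip (x : R) (s h : Fin 3) (k : ℕ) (l : List (R × Fin 3))
    (hl : k + 3 ≤ l.length) (F : List (R × Fin 3) → R) :
    exchange swapCoeff k (fun l => strip x s h l F) l =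
      strip x s h l (exchange swapCoeff k F) := by
  induction k generalizing h l F with
  | zero =>
    match l, hl with
    | a :: b :: c :: l, _ =>
      simp only [exchange, strip, strip_add_mul]
      exact cross_exchange_strip x a.1 b.1 h a.2 b.2 fun h' a' b' =>
        strip x s h' (c :: l) fun l => F ((b.1, a') :: (a.1, b') :: l)
  | succ k ih =>
    match l, hl with
    | a :: b :: l, hl =>
      simp only [exchange, strip]
      have ih' := fun c d => ih c (b :: l) (by simp at hl ⊢; omega) fun l => F ((a.1, d) :: l)
      simp only [← ih']
      rw [← exchange_congr swapCoeff k (b :: l)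
        (F' := fun l => strip x s h (a :: l) F)]
      · exact exchange_linearMap (crossLinear (x - a.1) h a.2) swapCoeff k (b :: l)
          fun i l => strip x s i.1 l fun l => F ((a.1, i.2) :: l)
      · intro l' hl'
        match l', hl' with
        | b' :: l', _ => rfl

/-- The Yang–Baxter equation for a strand from the northeast. -/
theorem exchange_coStrip (y : R) (s e : Fin 3) (k : ℕ) (l : List (R × Fin 3))
    (hl : k + 3 ≤ l.length) (F : List (R × Fin 3) → R) :
    exchange swapCoeffRev k (fun l => coStrip y s e l F) l =
      coStrip y s e l (exchange swapCoeffRev k F) := by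
  induction k generalizing e l F with
  | zero =>
    match l, hl with
    | a :: b :: c :: l, _ =>
      simp only [exchange, coStrip, coStrip_add_mul]
      exact cross_exchange_coStrip y a.1 b.1 e a.2 b.2 fun e' a' b' =>
        coStrip y s e' (c :: l) fun l => F ((b.1, a') :: (a.1, b') :: l)
  | succ k ih =>
    match l, hl with
    | a :: b :: l, hl =>
      simp only [exchange, coStrip]
      have ih' := fun c d => ih d (b :: l) (by simp at hl ⊢; omega) fun l => F ((a.1, c) :: l)
      simp only [← ih']
      rw [← exchange_congr swapCoeffRev k (b :: l)
        (F' := fun l => coStrip y s e (a :: l) F)]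
      · exact exchange_linearMap (crossLinear (a.1 - y) a.2 e) swapCoeffRev k (b :: l)
          fun i l => coStrip y s i.2 l fun l => F ((a.1, i.1) :: l)
      · intro l' hl'
        match l', hl' with
        | b' :: l', _ => rfl

theorem exchange_append (m : R → R → Fin 3 → Fin 3 → R) (F : List (R × Fin 3) → R)
    (l₁ l₂ : List (R × Fin 3)) (x y : R) (a b : Fin 3) :
    exchange m l₁.length F (l₁ ++ (x, a) :: (y, b) :: l₂) =
      F (l₁ ++ (y, a) :: (x, b) :: l₂) + m x y a b * F (l₁ ++ (y, b) :: (x, a) :: l₂) := by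
  induction l₁ generalizing F with
  | nil => rfl
  | cons p l₁ ih => exact ih fun l => F (p :: l)

theorem weightedCount_exchange_two (x₁ x₂ : R) (a b c d s t : Fin 3) (hs : s ≠ 2) (ht : t ≠ 2) :
    exchange swapCoeff 0 (fun μ => exchange swapCoeffRev 0
      (fun l => weightedCount l μ [s, t]) [(x₂, a), (x₁, b)]) [(x₁, c), (x₂, d)] =
    weightedCount [(x₂, a), (x₁, b)] [(x₁, c), (x₂, d)] [s, t] +
      swapCoeff x₁ x₂ s t *
        weightedCount [(x₂, a), (x₁, b)] [(x₁, c), (x₂, d)] [t, s] := by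
  have h0 := fin_three_cases s
  have h1 := fin_three_cases t
  simp only [hs, ht, or_false] at h0 h1
  simp only [exchange, weightedCount, strip, swapCoeffRev]
  rcases h0 with rfl | rfl <;> rcases h1 with rfl | rfl <;>
  rcases fin_three_cases a with rfl | rfl | rfl <;>
  rcases fin_three_cases b with rfl | rfl | rfl <;>
  rcases fin_three_cases c with rfl | rfl | rfl <;>
  rcases fin_three_cases d with rfl | rfl | rfl <;>
  simp [cross, fuse, ValidUp, swapCoeff, Descends]

theorem weightedCount_exchange_last (Y₁ X₂ : List R) (x₁ x₂ : R) (l μ : List (R × Fin 3))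
    (n₂ : List (Fin 3)) (s t : Fin 3) (hs : s ≠ 2) (ht : t ≠ 2)
    (hl : l.map Prod.fst = x₂ :: x₁ :: X₂) (hμ : μ.map Prod.fst = Y₁ ++ [x₁, x₂])
    (hX : X₂.length = Y₁.length) (hn : n₂.length = X₂.length) :
    exchange swapCoeff Y₁.length (fun μ => exchange swapCoeffRev 0
      (fun l => weightedCount l μ (s :: t :: n₂)) l) μ =
    weightedCount l μ (s :: t :: n₂) +
      swapCoeff x₁ x₂ s t * weightedCount l μ (t :: s :: n₂) := by
  induction Y₁ generalizing X₂ l μ n₂ with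
  | nil =>
    obtain rfl : X₂ = [] := by simpa using hX
    obtain rfl : n₂ = [] := by simpa using hn
    simp only [List.map_eq_cons_iff, List.map_eq_nil_iff, List.nil_append] at hl hμ
    obtain ⟨⟨_, a⟩, _, rfl, rfl, ⟨_, b⟩, _, rfl, rfl, rfl⟩ := hl
    obtain ⟨⟨_, c⟩, _, rfl, rfl, ⟨_, d⟩, _, rfl, rfl, rfl⟩ := hμ
    exact weightedCount_exchange_two _ _ a b c d s t hs ht
  | cons y Y₁ ih =>
    have hlen := congrArg List.length hl
    rw [List.cons_append, List.map_eq_cons_iff] at hμ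
    obtain ⟨⟨y, e⟩, μ, rfl, rfl, hμ⟩ := hμ
    have hlen' := congrArg List.length hμ
    simp only [List.length_map, List.length_cons, List.length_append, List.length_nil] at *
    obtain ⟨n₂, s', rfl⟩ : ∃ n s', n₂ = n ++ [s'] := by
      rcases List.eq_nil_or_concat' n₂ with rfl | h
      · simp only [List.length_nil] at hn; omega
      · exact h
    simp only [List.length_append, List.length_cons, List.length_nil] at hn
    have key : ∀ s t : Fin 3, ∀ l' μ' : List (R × Fin 3), l'.length = l.length →
        μ'.length = μ.length → weightedCount l' ((y, e) :: μ') (s :: t :: (n₂ ++ [s'])) =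
          coStrip y s' e l' fun k => weightedCount k μ' (s :: t :: n₂) := fun s t l' μ' h h' =>
      weightedCount_concat l' μ' (s :: t :: n₂) (y, e) s' (by omega) (by simp; omega)
    calc
      _ = exchange swapCoeff Y₁.length (fun μ => coStrip y s' e l
            fun k => exchange swapCoeffRev 0 (fun l => weightedCount l μ (s :: t :: n₂)) k) μ := by
        refine exchange_congr (swapCoeff (R := R)) Y₁.length μ fun μ' hμ' => ?_
        refine Eq.trans ?_ (exchange_coStrip y s' e 0 l (by omega) _)
        exact exchange_congr _ _ _ fun l' hl' => key s t l' μ' hl' hμ'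
      _ = coStrip y s' e l fun k => exchange swapCoeff Y₁.length
            (fun μ => exchange swapCoeffRev 0 (fun l => weightedCount l μ (s :: t :: n₂)) k) μ :=
        exchange_linearMap (coStripLinear y s' e l) _ _ _ _
      _ = coStrip y s' e l fun k => weightedCount k μ (s :: t :: n₂) +
            swapCoeff x₁ x₂ s t * weightedCount k μ (t :: s :: n₂) := by
        refine coStrip_congr _ _ _ _ _ _ fun k hk => ?_
        have hX₂ : X₂ ≠ [] := by rintro rfl; simp at hX
        refine ih X₂.dropLast k μ n₂ ?_ hμ (by simp; omega) (by simp; omega)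
        rw [hk, hl, List.dropLast_cons_of_ne_nil (by simp), List.dropLast_cons_of_ne_nil hX₂]
      _ = _ := by rw [coStrip_add_mul, key _ _ _ _ rfl rfl, key _ _ _ _ rfl rfl]

/-- The exchange relation: exchanging two adjacent parameters of all weights. -/
theorem weightedCount_exchange (X₁ X₂ Y₁ Y₂ : List R) (x₁ x₂ : R) (l μ : List (R × Fin 3))
    (n₁ n₂ : List (Fin 3)) (s t : Fin 3) (hs : s ≠ 2) (ht : t ≠ 2)
    (hl : l.map Prod.fst = X₁ ++ x₂ :: x₁ :: X₂) (hμ : μ.map Prod.fst = Y₁ ++ x₁ :: x₂ :: Y₂)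
    (hX₁ : X₁.length = Y₂.length) (hX₂ : X₂.length = Y₁.length)
    (hn₁ : n₁.length = X₁.length) (hn₂ : n₂.length = X₂.length) :
    exchange swapCoeff Y₁.length (fun μ => exchange swapCoeffRev X₁.length
      (fun l => weightedCount l μ (n₁ ++ s :: t :: n₂)) l) μ =
    weightedCount l μ (n₁ ++ s :: t :: n₂) +
      swapCoeff x₁ x₂ s t * weightedCount l μ (n₁ ++ t :: s :: n₂) := by
  induction X₁ generalizing Y₂ l μ n₁ with
  | nil =>
    obtain rfl : Y₂ = [] := by simpa using hX₁.symm
    obtain rfl : n₁ = [] := by simpa using hn₁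
    exact weightedCount_exchange_last Y₁ X₂ x₁ x₂ l μ n₂ s t hs ht hl hμ hX₂ hn₂
  | cons x X₁ ih =>
    have hlen := congrArg List.length hμ
    rw [List.cons_append, List.map_eq_cons_iff] at hl
    obtain ⟨⟨x, h⟩, l, rfl, rfl, hl⟩ := hl
    match n₁, hn₁ with
    | s' :: n₁, hn₁ =>
      simp only [List.length_map, List.length_cons, List.length_append, Nat.add_right_cancel_iff]
        at hlen hX₁ hn₁
      calc
        _ = exchange swapCoeff Y₁.length (fun μ => strip x s' h μ fun k =>
              exchange swapCoeffRev X₁.length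
                (fun l => weightedCount l k (n₁ ++ s :: t :: n₂)) l) μ :=
          exchange_congr _ _ _ fun μ' _ => exchange_linearMap (stripLinear x s' h μ') _ _ _ _
        _ = strip x s' h μ fun k => weightedCount l k (n₁ ++ s :: t :: n₂) +
              swapCoeff x₁ x₂ s t * weightedCount l k (n₁ ++ t :: s :: n₂) := by
          rw [exchange_strip _ _ _ _ _ (by omega)]
          refine strip_congr _ _ _ _ _ _ fun k hk => ?_
          have hY₂ : Y₂ ≠ [] := by rintro rfl; simp at hX₁
          refine ih Y₂.dropLast l k n₁ hl ?_ (by simp; omega) hn₁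
          rw [hk, hμ, List.dropLast_append_of_ne_nil (by simp),
            List.dropLast_cons_of_ne_nil (by simp), List.dropLast_cons_of_ne_nil hY₂]
        _ = _ := strip_add_mul _ _ _ _ _ _ _

/-- The weighted count with south side `ν` is symmetric in the other two sides, for all choices of
distinct parameters. -/
def SymmetricAt (R : Type*) [CommRing R] (ν : List (Fin 3)) : Prop :=
  ∀ (X : List R) (α β : List (Fin 3)), X.Nodup → X.length = ν.length → α.length = ν.length →
    β.length = ν.length → 2 ∉ α → 2 ∉ β →
    weightedCount (X.zip α).reverse (X.zip β) ν = weightedCount (X.zip β).reverse (X.zip α) ν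

theorem exchange_swapCoeff_zip (F : List (R × Fin 3) → R) (X₁ X₂ : List R) (x₁ x₂ : R)
    (A₁ A₂ : List (Fin 3)) (a b : Fin 3) (hA : A₁.length = X₁.length) :
    exchange swapCoeff X₁.length F ((X₁ ++ x₁ :: x₂ :: X₂).zip (A₁ ++ a :: b :: A₂)) =
      F ((X₁ ++ x₂ :: x₁ :: X₂).zip (A₁ ++ a :: b :: A₂)) +
        swapCoeff x₁ x₂ a b * F ((X₁ ++ x₂ :: x₁ :: X₂).zip (A₁ ++ b :: a :: A₂)) := by
  have := exchange_append swapCoeff F (X₁.zip A₁) (X₂.zip A₂) x₁ x₂ a b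
  rw [List.length_zip, hA, min_self] at this
  simpa [List.zip_append hA.symm] using this

theorem exchange_swapCoeffRev_zip (F : List (R × Fin 3) → R) (X₁ X₂ : List R) (x₁ x₂ : R)
    (A₁ A₂ : List (Fin 3)) (a b : Fin 3) (hA : A₁.length = X₁.length)
    (hA₂ : A₂.length = X₂.length) :
    exchange swapCoeffRev X₂.length F
        ((X₁ ++ x₁ :: x₂ :: X₂).zip (A₁ ++ a :: b :: A₂)).reverse =
      F ((X₁ ++ x₂ :: x₁ :: X₂).zip (A₁ ++ a :: b :: A₂)).reverse +
        swapCoeff x₁ x₂ a b * F ((X₁ ++ x₂ :: x₁ :: X₂).zip (A₁ ++ b :: a :: A₂)).reverse := by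
  have := exchange_append swapCoeffRev F (X₂.zip A₂).reverse (X₁.zip A₁).reverse x₂ x₁ b a
  rw [List.length_reverse, List.length_zip, hA₂, min_self] at this
  simpa [List.zip_append hA.symm, swapCoeffRev] using this

theorem List.exists_eq_append_pair_of_length {γ : Type*} (l : List γ) (i j : ℕ)
    (hl : l.length = i + (j + 2)) :
    ∃ l₁ a b l₂, l = l₁ ++ a :: b :: l₂ ∧ l₁.length = i ∧ l₂.length = j := by
  match h : l.drop i with
  | [] => have := congrArg List.length h; simp at this; omega
  | [_] => have := congrArg List.length h; simp at this; omega
  | a :: b :: l₂ =>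
    refine ⟨l.take i, a, b, l₂, ?_, by simp; omega, ?_⟩
    · rw [← h, List.take_append_drop]
    · have := congrArg List.length h
      simp at this
      omega

theorem SymmetricAt.swap [IsDomain R] {n₁ n₂ : List (Fin 3)}
    (h : SymmetricAt R (n₁ ++ 1 :: 0 :: n₂)) : SymmetricAt R (n₁ ++ 0 :: 1 :: n₂) := by
  intro X α β hX hXl hα hβ hα2 hβ2
  simp only [List.length_append, List.length_cons] at hXl hα hβ
  obtain ⟨X₁, x₁, x₂, X₂, rfl, hX₁, hX₂⟩ :=
    X.exists_eq_append_pair_of_length n₂.length n₁.length (by omega)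
  obtain ⟨A₁, a, a', A₂, rfl, hA₁, hA₂⟩ :=
    α.exists_eq_append_pair_of_length n₂.length n₁.length (by omega)
  obtain ⟨B₁, b, b', B₂, rfl, hB₁, hB₂⟩ :=
    β.exists_eq_append_pair_of_length n₂.length n₁.length (by omega)
  have hne : x₂ - x₁ ≠ 0 := by
    intro h0
    rw [sub_eq_zero.mp h0] at hX
    simp [List.nodup_append] at hX
  have hX' : (X₁ ++ x₂ :: x₁ :: X₂).Nodup :=
    ((List.Perm.swap x₁ x₂ X₂).append_left X₁).nodup_iff.mpr hX
  have key : ∀ (A₁ A₂ B₁ B₂ : List (Fin 3)) (a a' b b' : Fin 3), A₁.length = n₂.length →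
      A₂.length = n₁.length → B₁.length = n₂.length → B₂.length = n₁.length → _ :=
    fun A₁ A₂ B₁ B₂ a a' b b' hA₁ hA₂ hB₁ hB₂ => weightedCount_exchange X₂.reverse X₁.reverse X₁ X₂
      x₁ x₂ ((X₁ ++ x₁ :: x₂ :: X₂).zip (A₁ ++ a :: a' :: A₂)).reverse
      ((X₁ ++ x₁ :: x₂ :: X₂).zip (B₁ ++ b :: b' :: B₂)) n₁ n₂ 1 0 (by decide) (by decide)
      (by rw [List.map_reverse, List.map_fst_zip (by simp; omega)]; simp)
      (by rw [List.map_fst_zip (by simp; omega)])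
      (by simp) (by simp) (by simp; omega) (by simp; omega)
  have hsym : ∀ A B : List (Fin 3), A.length = n₁.length + (n₂.length + 2) →
      B.length = n₁.length + (n₂.length + 2) → 2 ∉ A → 2 ∉ B → _ :=
    fun A B hA hB hA2 hB2 => h (X₁ ++ x₂ :: x₁ :: X₂) A B hX'
      (by simp; omega) (by simp; omega) (by simp; omega) hA2 hB2
  have h1 := key A₁ A₂ B₁ B₂ a a' b b' hA₁ hA₂ hB₁ hB₂
  have h2 := key B₁ B₂ A₁ A₂ b b' a a' hB₁ hB₂ hA₁ hA₂
  rw [List.length_reverse, exchange_swapCoeff_zip _ _ _ _ _ _ _ _ _ (by omega)] at h1 h2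
  simp only [exchange_swapCoeffRev_zip _ _ _ _ _ _ _ _ _ (hA₁.trans hX₁.symm)
    (hA₂.trans hX₂.symm), exchange_swapCoeffRev_zip _ _ _ _ _ _ _ _ _ (hB₁.trans hX₁.symm)
    (hB₂.trans hX₂.symm)] at h1 h2
  have hdes : swapCoeff x₁ x₂ 1 0 = x₂ - x₁ := by simp [swapCoeff, Descends]
  rw [hdes] at h1 h2
  have hα' : 2 ∉ A₁ ++ a' :: a :: A₂ := by simp at hα2 ⊢; tauto
  have hβ' : 2 ∉ B₁ ++ b' :: b :: B₂ := by simp at hβ2 ⊢; tauto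
  have e0 := h (X₁ ++ x₁ :: x₂ :: X₂) _ _ hX (by simp; omega) (by simp; omega) (by simp; omega)
    hα2 hβ2
  have e1 := hsym _ _ (by simp; omega) (by simp; omega) hα2 hβ2
  have e2 := hsym _ _ (by simp; omega) (by simp; omega) hα' hβ2
  have e3 := hsym _ _ (by simp; omega) (by simp; omega) hα2 hβ'
  have e4 := hsym _ _ (by simp; omega) (by simp; omega) hα' hβ'
  apply mul_left_cancel₀ hne
  linear_combination h2 + swapCoeff x₁ x₂ a a' * e2 + swapCoeff x₁ x₂ b b' * e3 +
    swapCoeff x₁ x₂ a a' * swapCoeff x₁ x₂ b b' * e4 - h1 - e0 + e1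

/-- A northeast strand that does not start as `0` cannot end in a south label `0`. -/
theorem coStrip_zero_of_ne (y : R) (e : Fin 3) (he : e ≠ 0) (l : List (R × Fin 3))
    (hl : 2 ∉ l.map Prod.snd) (G : List (R × Fin 3) → R) : coStrip y 0 e l G = 0 := by
  induction l generalizing e G with
  | nil => rfl
  | cons p l ih =>
    obtain ⟨x, a⟩ := p
    have h : 2 ∉ l.map Prod.snd := fun h => hl (by simp at h ⊢; tauto)
    have ha : a ≠ 2 := by rintro rfl; simp at hl
    have ih1 := fun G => ih 1 (by decide) h G
    have ih2 := fun G => ih 2 (by decide) h G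
    match l with
    | [] =>
      rcases fin_three_cases a with rfl | rfl | rfl <;>
      rcases fin_three_cases e with rfl | rfl | rfl <;> simp_all [coStrip, fuse, ValidUp]
    | q :: l =>
      rcases fin_three_cases a with rfl | rfl | rfl <;>
      rcases fin_three_cases e with rfl | rfl | rfl <;> simp_all [coStrip, cross]

theorem coStrip_zero_concat (y x : R) (a : Fin 3) (ha : a ≠ 2) (l : List (R × Fin 3))
    (hl : 2 ∉ l.map Prod.snd) (G : List (R × Fin 3) → R) :
    coStrip y 0 0 (l ++ [(x, a)]) G = if a = 0 then G l else 0 := by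
  induction l generalizing G with
  | nil =>
    rcases fin_three_cases a with rfl | rfl | rfl <;> simp_all [coStrip, fuse, ValidUp]
  | cons p l ih =>
    obtain ⟨z, b⟩ := p
    have h : 2 ∉ l.map Prod.snd := fun h => hl (by simp at h ⊢; tauto)
    have hb : b ≠ 2 := by rintro rfl; simp at hl
    have ih1 := fun G => coStrip_zero_of_ne y 1 (by decide) (l ++ [(x, a)])
      (by simp at h ⊢; tauto) G
    have ih0 := fun G => ih h G
    obtain ⟨q, l', hq⟩ := List.exists_cons_of_ne_nil (l := l ++ [(x, a)]) (by simp)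
    rw [hq] at ih0 ih1
    rw [List.cons_append, hq]
    rcases fin_three_cases b with rfl | rfl | rfl
    · simp [coStrip, cross, ih0, ih1]
    · simp [coStrip, cross, ih0]
    · exact absurd rfl hb

/-- A northwest strand that does not start as `1` cannot end in a south label `1`. -/
theorem strip_one_of_ne (x : R) (h : Fin 3) (hh : h ≠ 1) (l : List (R × Fin 3))
    (hl : 2 ∉ l.map Prod.snd) (F : List (R × Fin 3) → R) : strip x 1 h l F = 0 := by
  induction l generalizing h F with
  | nil => rfl
  | cons p l ih =>
    obtain ⟨y, a⟩ := p
    have hl' : 2 ∉ l.map Prod.snd := fun h => hl (by simp at h ⊢; tauto)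
    have ha : a ≠ 2 := by rintro rfl; simp at hl
    have ih1 := fun F => ih 0 (by decide) hl' F
    have ih2 := fun F => ih 2 (by decide) hl' F
    match l with
    | [] =>
      rcases fin_three_cases a with rfl | rfl | rfl <;>
      rcases fin_three_cases h with rfl | rfl | rfl <;> simp_all [strip, fuse, ValidUp]
    | q :: l =>
      rcases fin_three_cases a with rfl | rfl | rfl <;>
      rcases fin_three_cases h with rfl | rfl | rfl <;> simp_all [strip, cross]

theorem strip_one_concat (x y : R) (a : Fin 3) (ha : a ≠ 2) (l : List (R × Fin 3))
    (hl : 2 ∉ l.map Prod.snd) (F : List (R × Fin 3) → R) :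
    strip x 1 1 (l ++ [(y, a)]) F = if a = 1 then F l else 0 := by
  induction l generalizing F with
  | nil =>
    rcases fin_three_cases a with rfl | rfl | rfl <;> simp_all [strip, fuse, ValidUp]
  | cons p l ih =>
    obtain ⟨z, b⟩ := p
    have h : 2 ∉ l.map Prod.snd := fun h => hl (by simp at h ⊢; tauto)
    have hb : b ≠ 2 := by rintro rfl; simp at hl
    have ih1 := fun F => strip_one_of_ne x 0 (by decide) (l ++ [(y, a)])
      (by simp at h ⊢; tauto) F
    have ih0 := fun F => ih h F
    obtain ⟨q, l', hq⟩ := List.exists_cons_of_ne_nil (l := l ++ [(y, a)]) (by simp)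
    rw [hq] at ih0 ih1
    rw [List.cons_append, hq]
    rcases fin_three_cases b with rfl | rfl | rfl
    · simp [strip, cross, ih0]
    · simp [strip, cross, ih0, ih1]
    · exact absurd rfl hb

theorem two_notMem_map_snd_zip {γ : Type*} (X : List γ) (α : List (Fin 3)) (h : 2 ∉ α) :
    2 ∉ (X.zip α).map Prod.snd := by
  simp only [List.mem_map, Prod.exists, exists_eq_right, not_exists]
  exact fun x hx => h (List.of_mem_zip hx).2

theorem SymmetricAt.append_zero {ν : List (Fin 3)} (h : SymmetricAt R ν) :
    SymmetricAt R (ν ++ [0]) := by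
  intro X α β hX hXl hα hβ hα2 hβ2
  simp only [List.length_append, List.length_singleton] at hXl hα hβ
  match X, α, β with
  | x :: X, a :: α, b :: β =>
    simp only [List.length_cons, Nat.add_right_cancel_iff] at hXl hα hβ
    simp only [List.mem_cons, not_or] at hα2 hβ2
    have key : ∀ (a b : Fin 3) (α β : List (Fin 3)), 2 ≠ a → 2 ∉ α → α.length = ν.length →
        β.length = ν.length → weightedCount ((x :: X).zip (a :: α)).reverse
          ((x :: X).zip (b :: β)) (ν ++ [0]) =
        if a = 0 ∧ b = 0 then weightedCount (X.zip α).reverse (X.zip β) ν else 0 := by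
      intro a b α β ha hα2 hα hβ
      rw [List.zip_cons_cons, List.zip_cons_cons,
        weightedCount_concat _ _ _ _ _ (by simp; omega) (by simp; omega), List.reverse_cons]
      have h2 : 2 ∉ (X.zip α).reverse.map Prod.snd := by
        simpa using two_notMem_map_snd_zip X α hα2
      by_cases hb : b = 0
      · subst hb
        rw [coStrip_zero_concat _ _ _ ha.symm _ h2]
        simp
      · rw [coStrip_zero_of_ne _ _ hb _ (by
          rw [List.map_append, List.mem_append]; simpa using ⟨by simpa using h2, ha⟩)]
        simp [hb]
    rw [key a b α β hα2.1 hα2.2 hα hβ, key b a β α hβ2.1 hβ2.2 hβ hα,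
      h X α β (List.nodup_cons.mp hX).2 hXl hα hβ hα2.2 hβ2.2]
    simp only [and_comm]

theorem SymmetricAt.cons_one {ν : List (Fin 3)} (h : SymmetricAt R ν) :
    SymmetricAt R (1 :: ν) := by
  intro X α β hX hXl hα hβ hα2 hβ2
  simp only [List.length_cons] at hXl hα hβ
  obtain ⟨X, x, rfl⟩ := (List.eq_nil_or_concat' X).resolve_left (by rintro rfl; simp at hXl)
  obtain ⟨α, a, rfl⟩ := (List.eq_nil_or_concat' α).resolve_left (by rintro rfl; simp at hα)
  obtain ⟨β, b, rfl⟩ := (List.eq_nil_or_concat' β).resolve_left (by rintro rfl; simp at hβ)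
  simp only [List.length_append, List.length_singleton, Nat.add_right_cancel_iff] at hXl hα hβ
  simp only [List.mem_append, List.mem_singleton, not_or] at hα2 hβ2
  have key : ∀ (a b : Fin 3) (α β : List (Fin 3)), 2 ≠ b → 2 ∉ β → α.length = ν.length →
      β.length = ν.length → weightedCount ((X ++ [x]).zip (α ++ [a])).reverse
        ((X ++ [x]).zip (β ++ [b])) (1 :: ν) =
      if a = 1 ∧ b = 1 then weightedCount (X.zip α).reverse (X.zip β) ν else 0 := by
    intro a b α β hb hβ2 hα hβ
    rw [List.zip_append (by omega), List.zip_append (by omega), List.reverse_append]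
    simp only [List.zip_cons_cons, List.zip_nil_left, List.reverse_singleton,
      List.singleton_append, weightedCount]
    have h2 := two_notMem_map_snd_zip X β hβ2
    by_cases ha : a = 1
    · subst ha
      rw [strip_one_concat _ _ _ hb.symm _ h2]
      simp
    · rw [strip_one_of_ne _ _ ha _ (by
        rw [List.map_append, List.mem_append]; simpa using ⟨by simpa using h2, hb⟩)]
      simp [ha]
  rw [key a b α β hβ2.2 hβ2.1 hα hβ, key b a β α hα2.2 hα2.1 hβ hα,
    h X α β (List.nodup_append.mp hX).1 hXl hα hβ hα2.1 hβ2.1]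
  simp only [and_comm]

theorem SymmetricAt.move_one [IsDomain R] (u : List (Fin 3)) (hu : 2 ∉ u) (n : List (Fin 3))
    (h : SymmetricAt R (n ++ 1 :: u)) : SymmetricAt R (n ++ u ++ [1]) := by
  induction u generalizing n with
  | nil => simpa using h
  | cons a u ih =>
    simp only [List.mem_cons, not_or] at hu
    have : SymmetricAt R ((n ++ [a]) ++ 1 :: u) := by
      rw [List.append_assoc, List.singleton_append]
      rcases fin_three_cases a with rfl | rfl | rfl
      · exact h.swap
      · exact h
      · exact absurd rfl hu.1
    simpa using ih hu.2 _ this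

theorem symmetricAt [IsDomain R] (ν : List (Fin 3)) (hν : 2 ∉ ν) : SymmetricAt R ν := by
  induction ν using List.reverseRecOn with
  | nil =>
    intro X α β _ hX hα hβ _ _
    rw [List.length_nil, List.length_eq_zero_iff] at hX hα hβ
    rw [hX, hα, hβ]
  | append_singleton u a ih =>
    simp only [List.mem_append, List.mem_singleton, not_or] at hν
    rcases fin_three_cases a with rfl | rfl | rfl
    · exact (ih hν.1).append_zero
    · exact (ih hν.1).cons_one.move_one u hν.1 []
    · exact absurd rfl hν.2

section Specialization

variable {S : Type*} [CommRing S] (φ : R →+* S)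

theorem map_cross (u : R) (a b : Fin 3) (G : Fin 3 → Fin 3 → R) :
    φ (cross u a b G) = cross (φ u) a b fun c d => φ (G c d) := by
  rcases fin_three_cases a with rfl | rfl | rfl <;>
  rcases fin_three_cases b with rfl | rfl | rfl <;> simp [cross]

theorem map_strip (x : R) (s h : Fin 3) (l : List (R × Fin 3)) (F : List (R × Fin 3) → R)
    (F' : List (S × Fin 3) → S) (hF : ∀ k, φ (F k) = F' (k.map (Prod.map φ id))) :
    φ (strip x s h l F) = strip (φ x) s h (l.map (Prod.map φ id)) F' := by
  induction l generalizing h F F' with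
  | nil => simp [strip]
  | cons e l ih =>
    match l with
    | [] => simp [strip, fuse, hF, apply_ite φ]
    | e' :: l =>
      simp only [strip, List.map_cons, map_cross, Prod.map_fst, Prod.map_snd, id, map_sub]
      congr 1
      funext c d
      exact ih c _ _ fun k => hF _

theorem map_weightedCount (l μ : List (R × Fin 3)) (ν : List (Fin 3)) :
    φ (weightedCount l μ ν) =
      weightedCount (l.map (Prod.map φ id)) (μ.map (Prod.map φ id)) ν := by
  induction l generalizing μ ν with
  | nil => cases μ <;> cases ν <;> simp [weightedCount]
  | cons p l ih =>
    cases ν with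
    | nil => simp [weightedCount]
    | cons s ν => exact map_strip φ _ _ _ _ _ _ fun k => ih k ν

end Specialization

/-- With all parameters equal to zero, the weighted count is symmetric. -/
theorem weightedCount_zero_comm (α β ν : List (Fin 3)) (hα : α.length = ν.length)
    (hβ : β.length = ν.length) (hα2 : 2 ∉ α) (hβ2 : 2 ∉ β) (hν2 : 2 ∉ ν) :
    weightedCount (α.map (Prod.mk (0 : ℤ))).reverse (β.map (Prod.mk 0)) ν =
      weightedCount (β.map (Prod.mk (0 : ℤ))).reverse (α.map (Prod.mk 0)) ν := by
  let X : List (MvPolynomial ℕ ℤ) := (List.range ν.length).map MvPolynomial.X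
  have hX : X.length = ν.length := by simp [X]
  have key : ∀ α : List (Fin 3), α.length = ν.length →
      (X.zip α).map (Prod.map (MvPolynomial.constantCoeff (σ := ℕ) (R := ℤ)) id) =
        α.map (Prod.mk 0) := by
    intro α hα
    apply List.ext_getElem
    · simp [hX, hα]
    · intro i h₁ h₂
      simp [X]
  have := congrArg (MvPolynomial.constantCoeff (σ := ℕ) (R := ℤ))
    (symmetricAt ν hν2 X α β (List.nodup_range.map (MvPolynomial.X_injective)) hX hα hβ hα2 hβ2)
  simpa only [map_weightedCount, List.map_reverse, key _ hα, key _ hβ] using this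

end WeightedPuzzles


section Counting

theorem validUp_iff (l r b : Fin 3) :
    ValidUp l r b ↔ b = -(l + r) ∧ ValidUp l r (-(l + r)) := by
  unfold ValidUp
  revert l r b
  decide

/-- The labels `H` and `E` of the edges parallel to the northwest and northeast side in the strip
along the northeast side of a puzzle of size `n + 1`. This strip has northeast labels `e`,
northwest label `h` and south label `s`. -/
def IsStrip (n : ℕ) (h s : Fin 3) (e H E : ℕ → Fin 3) : Prop :=
  H 0 = h ∧ (∀ q, n < q → H q = 0) ∧ (∀ q, n ≤ q → E q = 0) ∧
  (∀ q, q < n → ValidUp (H q) (e q) (-(H q + e q)) ∧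
    ValidDown (-(H q + e q)) (E q) (H (q + 1))) ∧
  ValidUp (H n) (e n) s

/-- A sequence with a given first term and given further terms. -/
def natCons {γ : Type*} (a : γ) (f : ℕ → γ) : ℕ → γ
  | 0 => a
  | n + 1 => f n

theorem natCons_eta {γ : Type*} (f : ℕ → γ) : natCons (f 0) (fun n => f (n + 1)) = f := by
  funext n
  cases n <;> rfl

theorem isStrip_succ_iff (n : ℕ) (h s : Fin 3) (e H E : ℕ → Fin 3) :
    IsStrip (n + 1) h s e H E ↔
      (H 0 = h ∧ ValidUp h (e 0) (-(h + e 0)) ∧ ValidDown (-(h + e 0)) (E 0) (H 1)) ∧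
        IsStrip n (H 1) s (fun q => e (q + 1)) (fun q => H (q + 1)) (fun q => E (q + 1)) := by
  constructor
  · rintro ⟨rfl, h1, h2, h3, h4⟩
    exact ⟨⟨rfl, h3 0 (by omega)⟩, rfl, fun q hq => h1 _ (by omega), fun q hq => h2 _ (by omega),
      fun q hq => h3 _ (by omega), h4⟩
  · rintro ⟨⟨rfl, h0⟩, -, h1, h2, h3, h4⟩
    refine ⟨rfl, fun q hq => ?_, fun q hq => ?_, fun q hq => ?_, h4⟩
    · obtain ⟨q, rfl⟩ := Nat.exists_eq_succ_of_ne_zero (show q ≠ 0 by omega)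
      exact h1 q (by omega)
    · obtain ⟨q, rfl⟩ := Nat.exists_eq_succ_of_ne_zero (show q ≠ 0 by omega)
      exact h2 q (by omega)
    · rcases q with _ | q
      · exact h0
      · exact h3 q (by omega)

/-- The strips of a puzzle, together with an element of `β` satisfying a predicate that depends on
the labels passed on to the rest of the puzzle. -/
abbrev StripWith {β : Type*} (n : ℕ) (h s : Fin 3) (e : ℕ → Fin 3)
    (Q : (ℕ → Fin 3) → β → Prop) : Type _ :=
  { t : ((ℕ → Fin 3) × (ℕ → Fin 3)) × β // IsStrip n h s e t.1.1 t.1.2 ∧ Q t.1.2 t.2 }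

/-- Removing the first rhombus of a strip. -/
def stripWithSuccEquiv {β : Type*} (n : ℕ) (h s : Fin 3) (e : ℕ → Fin 3)
    (Q : (ℕ → Fin 3) → β → Prop) :
    StripWith (n + 1) h s e Q ≃
      Σ i : { i : Fin 3 × Fin 3 //
          ValidUp h (e 0) (-(h + e 0)) ∧ ValidDown (-(h + e 0)) i.2 i.1 },
        StripWith n i.1.1 s (fun q => e (q + 1)) fun E => Q (natCons i.1.2 E) where
  toFun t := ⟨⟨(t.1.1.1 1, t.1.1.2 0), ((isStrip_succ_iff ..).mp t.2.1).1.2⟩,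
    ⟨((fun q => t.1.1.1 (q + 1), fun q => t.1.1.2 (q + 1)), t.1.2),
      ((isStrip_succ_iff ..).mp t.2.1).2, by simpa only [natCons_eta] using t.2.2⟩⟩
  invFun t := ⟨((natCons h t.2.1.1.1, natCons t.1.1.2 t.2.1.1.2), t.2.1.2), by
    obtain ⟨⟨⟨c, d⟩, hi⟩, ⟨⟨⟨H, E⟩, P⟩, hs, hQ⟩⟩ := t
    refine ⟨(isStrip_succ_iff ..).mpr ⟨⟨rfl, hi.1, ?_⟩, ?_⟩, hQ⟩
    · have h0 : H 0 = c := hs.1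
      simpa [natCons, h0] using hi.2
    · have h0 : H 0 = c := hs.1
      simpa [natCons, h0] using hs⟩
  left_inv := by
    rintro ⟨⟨⟨H, E⟩, P⟩, hs, hQ⟩
    have h0 : H 0 = h := hs.1
    subst h0
    simp only [natCons_eta]
  right_inv := by
    rintro ⟨⟨⟨c, d⟩, hi⟩, ⟨⟨⟨H, E⟩, P⟩, hs, hQ⟩⟩
    have h0 : H 0 = c := hs.1
    subst h0
    rfl

theorem cross_zero_eq_sum {R : Type*} [CommRing R] (a b : Fin 3) (G : Fin 3 → Fin 3 → R)
    [Fintype { i : Fin 3 × Fin 3 // ValidUp a b (-(a + b)) ∧ ValidDown (-(a + b)) i.2 i.1 }] :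
    ∑ i : { i : Fin 3 × Fin 3 // ValidUp a b (-(a + b)) ∧ ValidDown (-(a + b)) i.2 i.1 },
      G i.1.1 i.1.2 = cross 0 a b G := by
  rw [← Finset.sum_subtype (Finset.univ.filter fun i : Fin 3 × Fin 3 =>
    ValidUp a b (-(a + b)) ∧ ValidDown (-(a + b)) i.2 i.1) (by simp) fun i => G i.1 i.2,
    Finset.sum_filter, Fintype.sum_prod_type]
  simp only [Fin.sum_univ_three]
  rcases fin_three_cases a with rfl | rfl | rfl <;>
  rcases fin_three_cases b with rfl | rfl | rfl <;>
  simp [cross, ValidUp, ValidDown, show (-1 : Fin 3) = 2 from rfl, show (-2 : Fin 3) = 1 from rfl,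
    show (1 + 1 : Fin 3) = 2 from rfl, show (1 + 2 : Fin 3) = 0 from rfl,
    show (2 + 1 : Fin 3) = 0 from rfl, show (2 + 2 : Fin 3) = 1 from rfl]

/-- The northeast labels as a list, with parameters zero. -/
def labelList (n : ℕ) (e : ℕ → Fin 3) : List (ℤ × Fin 3) :=
  ((List.range n).map e).map (Prod.mk 0)

theorem labelList_succ' (n : ℕ) (e : ℕ → Fin 3) :
    labelList (n + 1) e = (0, e 0) :: labelList n fun i => e (i + 1) := by
  simp [labelList, List.range_succ_eq_map, Function.comp_def]

theorem card_stripWith {β : Type*} (n : ℕ) (h s : Fin 3) (e : ℕ → Fin 3)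
    (Q : (ℕ → Fin 3) → β → Prop) (F : List (ℤ × Fin 3) → ℤ)
    (hfin : ∀ E, Finite { P // Q E P })
    (hF : ∀ E, (Nat.card { P // Q E P } : ℤ) = F (labelList n E)) :
    Finite (StripWith n h s e Q) ∧
      (Nat.card (StripWith n h s e Q) : ℤ) = strip 0 s h (labelList (n + 1) e) F := by
  induction n generalizing h e Q F with
  | zero =>
    by_cases hv : ValidUp h (e 0) s
    · have f : StripWith 0 h s e Q ≃ { P // Q 0 P } :=
        { toFun := fun t => ⟨t.1.2, by
            have : t.1.1.2 = 0 := funext fun q => t.2.1.2.2.1 q (Nat.zero_le q)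
            rw [← this]; exact t.2.2⟩
          invFun := fun P => ⟨((natCons h 0, 0), P.1), ⟨rfl, fun q hq => by
            obtain ⟨q, rfl⟩ := Nat.exists_eq_succ_of_ne_zero hq.ne'
            rfl, fun _ _ => rfl, fun q hq => absurd hq (Nat.not_lt_zero q), hv⟩, P.2⟩
          left_inv := by
            rintro ⟨⟨⟨H, E⟩, P⟩, hs, hQ⟩
            have hE : E = 0 := funext fun q => hs.2.2.1 q (Nat.zero_le q)
            have hH : H = natCons h 0 := by
              funext q
              rcases q with _ | q
              · exact hs.1
              · exact hs.2.1 _ (Nat.succ_pos q)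
            simp only [hE, hH]
          right_inv := fun _ => rfl }
      have := hfin 0
      refine ⟨Finite.of_equiv _ f.symm, ?_⟩
      rw [Nat.card_congr f, hF]
      simp [labelList, strip, fuse, hv]
    · have : IsEmpty (StripWith 0 h s e Q) := ⟨fun t => by
        have := t.2.1.2.2.2.2
        rw [t.2.1.1] at this
        exact hv this⟩
      refine ⟨inferInstance, ?_⟩
      simp [labelList, strip, fuse, hv]
  | succ n ih =>
    have ih' := fun c d => ih c (fun q => e (q + 1)) (fun E => Q (natCons d E))
      (fun l => F ((0, d) :: l)) (fun E => hfin _) fun E => by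
        rw [hF, labelList_succ']
        rfl
    have := fun c d => (ih' c d).1
    have f := stripWithSuccEquiv n h s e Q
    refine ⟨Finite.of_equiv _ f.symm, ?_⟩
    let _ := Fintype.ofFinite { i : Fin 3 × Fin 3 //
      ValidUp h (e 0) (-(h + e 0)) ∧ ValidDown (-(h + e 0)) i.2 i.1 }
    rw [Nat.card_congr f, Nat.card_sigma, Nat.cast_sum, labelList_succ', labelList_succ']
    simp only [(ih' _ _).2, strip, sub_zero]
    rw [← labelList_succ' n (fun i => e (i + 1))]
    exact cross_zero_eq_sum h (e 0) fun c d =>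
      strip 0 s c (labelList (n + 1) fun q => e (q + 1)) fun l => F ((0, d) :: l)

/-- The triangular array with a given diagonal whose other entries come from an array shifted down
by one row. -/
def addDiagonal (D : ℕ → Fin 3) (A : ℕ → ℕ → Fin 3) : ℕ → ℕ → Fin 3
  | 0, 0 => D 0
  | 0, _ + 1 => 0
  | r + 1, j => if j = r + 1 then D (r + 1) else A r j

/-- Removing the diagonal of a triangular array. -/
def removeDiagonal (A : ℕ → ℕ → Fin 3) (r j : ℕ) : Fin 3 := if j ≤ r then A (r + 1) j else 0

theorem addDiagonal_self (D : ℕ → Fin 3) (A : ℕ → ℕ → Fin 3) (r : ℕ) :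
    addDiagonal D A r r = D r := by
  cases r <;> simp [addDiagonal]

theorem addDiagonal_succ (D : ℕ → Fin 3) (A : ℕ → ℕ → Fin 3) {r j : ℕ} (h : j ≠ r + 1) :
    addDiagonal D A (r + 1) j = A r j := by
  simp [addDiagonal, h]

theorem addDiagonal_removeDiagonal (A : ℕ → ℕ → Fin 3) (hA : ∀ r j, r < j → A r j = 0) :
    addDiagonal (fun q => A q q) (removeDiagonal A) = A := by
  funext r j
  rcases r with _ | r
  · rcases j with _ | j
    · rfl
    · exact (hA _ _ (Nat.succ_pos j)).symm
  · by_cases h : j = r + 1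
    · simp [addDiagonal, h]
    · rw [addDiagonal_succ _ _ h, removeDiagonal]
      split_ifs with h'
      · rfl
      · exact (hA _ _ (by omega)).symm

theorem removeDiagonal_addDiagonal (D : ℕ → Fin 3) (A : ℕ → ℕ → Fin 3)
    (hA : ∀ r j, r < j → A r j = 0) : removeDiagonal (addDiagonal D A) = A := by
  funext r j
  rw [removeDiagonal]
  split_ifs with h
  · exact addDiagonal_succ _ _ (by omega)
  · exact (hA _ _ (by omega)).symm

theorem addDiagonal_eq_zero (D : ℕ → Fin 3) (A : ℕ → ℕ → Fin 3) (n : ℕ)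
    (hD : ∀ q, n < q → D q = 0) (hA : ∀ r j, ¬(j ≤ r ∧ r < n) → A r j = 0) (r j : ℕ)
    (h : ¬(j ≤ r ∧ r < n + 1)) : addDiagonal D A r j = 0 := by
  rcases r with _ | r
  · rcases j with _ | j
    · omega
    · rfl
  · by_cases hj : j = r + 1
    · subst hj
      rw [addDiagonal_self]
      exact hD _ (by omega)
    · rw [addDiagonal_succ _ _ hj]
      exact hA _ _ (by omega)

theorem IsPuzzle.isStrip {n : ℕ} {L R C : ℕ → ℕ → Fin 3} {a b c : ℕ → Fin 3}
    (h : IsPuzzle (n + 1) L R C a b c) :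
    IsStrip n (a n) (c n) b (fun q => L q q) (fun q => R (q + 1) q) := by
  obtain ⟨h0, hu, hd, hb⟩ := h
  have hC : ∀ q, q < n + 1 → ValidUp (L q q) (b q) (C q q) := fun q hq => by
    rw [← (hb q hq).2.1]; exact hu q q le_rfl hq
  refine ⟨by simpa using (hb 0 (by omega)).1, fun q hq => (h0 q q (by omega)).1,
    fun q hq => (h0 (q + 1) q (by omega)).2.1, fun q hq => ?_, ?_⟩
  · have h1 := (validUp_iff _ _ _).mp (hC q (by omega))
    refine ⟨h1.2, ?_⟩
    rw [← h1.1]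
    exact hd (q + 1) q (by omega) (by omega) (by omega)
  · have h1 := hC n (by omega)
    rwa [show C n n = c n from (hb n (by omega)).2.2] at h1

theorem IsPuzzle.removeDiagonal {n : ℕ} {L R C : ℕ → ℕ → Fin 3} {a b c : ℕ → Fin 3}
    (h : IsPuzzle (n + 1) L R C a b c) :
    IsPuzzle n (removeDiagonal L) (removeDiagonal R) (removeDiagonal C) a
      (fun q => R (q + 1) q) c := by
  obtain ⟨h0, hu, hd, hb⟩ := h
  refine ⟨fun r j hrj => ?_, fun r j hj hr => ?_, fun r j h0 hr hj => ?_, fun r hr => ?_⟩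
  · simp only [_root_.removeDiagonal]
    split_ifs with h
    · exact h0 _ _ (by omega)
    · exact ⟨rfl, rfl, rfl⟩
  · simp only [_root_.removeDiagonal, if_pos hj]
    exact hu _ _ (by omega) (by omega)
  · have h2 := hd (r + 1) j (by omega) (by omega) (by omega)
    simp only [_root_.removeDiagonal]
    rw [if_pos (by omega), if_pos (by omega), if_pos (by omega), Nat.sub_add_cancel h0]
    exact h2
  · have h1 := hb (r + 1) (by omega)
    have h2 := hb r (by omega)
    simp only [_root_.removeDiagonal]
    rw [if_pos (Nat.zero_le r), if_pos le_rfl, if_pos (by omega),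
      Nat.sub_add_cancel (show 1 ≤ n by omega)]
    refine ⟨?_, rfl, h2.2.2⟩
    rw [h1.1]
    congr 1
    omega

theorem IsPuzzle.addDiagonal {n : ℕ} {L R C : ℕ → ℕ → Fin 3} {a b c H E : ℕ → Fin 3}
    (hs : IsStrip n (a n) (c n) b H E) (h : IsPuzzle n L R C a E c) :
    IsPuzzle (n + 1) (addDiagonal H L) (addDiagonal (fun q => if q ≤ n then b q else 0) R)
      (addDiagonal (fun q => if q ≤ n then -(H q + b q) else 0) C) a b c := by
  obtain ⟨hs0, hs1, hs2, hs3, hs4⟩ := hs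
  obtain ⟨h0, hu, hd, hb⟩ := h
  have hs5 := (validUp_iff _ _ _).mp hs4
  refine ⟨fun r j hrj => ⟨?_, ?_, ?_⟩, fun r j hj hr => ?_, fun r j hr0 hr hj => ?_,
    fun r hr => ⟨?_, ?_, ?_⟩⟩
  · exact addDiagonal_eq_zero _ _ n hs1 (fun r j h => (h0 r j h).1) r j hrj
  · exact addDiagonal_eq_zero _ _ n (fun q hq => if_neg (by omega))
      (fun r j h => (h0 r j h).2.1) r j hrj
  · exact addDiagonal_eq_zero _ _ n (fun q hq => if_neg (by omega))
      (fun r j h => (h0 r j h).2.2) r j hrj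
  · rcases hj.eq_or_lt with rfl | hj
    · simp only [addDiagonal_self]
      rw [if_pos (by omega), if_pos (by omega)]
      rcases (Nat.lt_succ_iff.mp hr).eq_or_lt with rfl | hr
      · exact hs5.2
      · exact (hs3 j hr).1
    · obtain ⟨r, rfl⟩ := Nat.exists_eq_succ_of_ne_zero (show r ≠ 0 by omega)
      rw [addDiagonal_succ _ _ hj.ne, addDiagonal_succ _ _ hj.ne, addDiagonal_succ _ _ hj.ne]
      exact hu r j (by omega) (by omega)
  · obtain ⟨r, rfl⟩ := Nat.exists_eq_succ_of_ne_zero hr0.ne'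
    rw [Nat.succ_eq_add_one, Nat.add_sub_cancel, addDiagonal_succ _ R (by omega)]
    rcases (Nat.lt_succ_iff.mp hj).eq_or_lt with rfl | hj
    · rw [addDiagonal_self, addDiagonal_self, if_pos (by omega), (hb j (by omega)).2.1]
      exact (hs3 j (by omega)).2
    · obtain ⟨r, rfl⟩ := Nat.exists_eq_succ_of_ne_zero (show r ≠ 0 by omega)
      rw [Nat.succ_eq_add_one, addDiagonal_succ _ C (by omega), addDiagonal_succ _ L (by omega)]
      exact hd (r + 1) j (by omega) (by omega) (by omega)
  · rcases r with _ | r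
    · rw [addDiagonal_self, hs0]
      simp
    · rw [addDiagonal_succ _ _ (by omega), (hb r (by omega)).1]
      congr 1
      omega
  · rw [addDiagonal_self, if_pos (by omega)]
  · rw [Nat.add_sub_cancel]
    rcases (Nat.lt_succ_iff.mp hr).eq_or_lt with rfl | hr
    · rw [addDiagonal_self, if_pos le_rfl, hs5.1]
    · obtain ⟨n, rfl⟩ := Nat.exists_eq_succ_of_ne_zero (show n ≠ 0 by omega)
      rw [Nat.succ_eq_add_one, addDiagonal_succ _ _ (by omega)]
      exact (hb r hr).2.2

/-- A puzzle consists of the strip along its northeast side and a smaller puzzle. -/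
def puzzleSuccEquiv (n : ℕ) (a b c : ℕ → Fin 3) :
    { p : (ℕ → ℕ → Fin 3) × (ℕ → ℕ → Fin 3) × (ℕ → ℕ → Fin 3) //
      IsPuzzle (n + 1) p.1 p.2.1 p.2.2 a b c } ≃
    StripWith n (a n) (c n) b
      fun E (p : (ℕ → ℕ → Fin 3) × (ℕ → ℕ → Fin 3) × (ℕ → ℕ → Fin 3)) =>
        IsPuzzle n p.1 p.2.1 p.2.2 a E c where
  toFun p := ⟨((fun q => p.1.1 q q, fun q => p.1.2.1 (q + 1) q),
    (removeDiagonal p.1.1, removeDiagonal p.1.2.1, removeDiagonal p.1.2.2)),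
    p.2.isStrip, p.2.removeDiagonal⟩
  invFun t := ⟨(addDiagonal t.1.1.1 t.1.2.1,
    addDiagonal (fun q => if q ≤ n then b q else 0) t.1.2.2.1,
    addDiagonal (fun q => if q ≤ n then -(t.1.1.1 q + b q) else 0) t.1.2.2.2),
    t.2.2.addDiagonal t.2.1⟩
  left_inv := by
    rintro ⟨⟨L, R, C⟩, h⟩
    have h0 := h.1
    have hR : (fun q => if q ≤ n then b q else 0) = fun q => R q q := by
      funext q
      split_ifs with hq
      · exact ((h.2.2.2 q (by omega)).2.1).symm
      · exact (h0 q q (by omega)).2.1.symm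
    have hC : (fun q => if q ≤ n then -(L q q + b q) else 0) = fun q => C q q := by
      funext q
      split_ifs with hq
      · have h1 := h.2.1 q q le_rfl (by omega)
        rw [(h.2.2.2 q (by omega)).2.1] at h1
        exact ((validUp_iff _ _ _).mp h1).1.symm
      · exact (h0 q q (by omega)).2.2.symm
    simp only [hR, hC, Subtype.mk.injEq, Prod.mk.injEq]
    exact ⟨addDiagonal_removeDiagonal _ fun r j hrj => (h0 r j (by omega)).1,
      addDiagonal_removeDiagonal _ fun r j hrj => (h0 r j (by omega)).2.1,
      addDiagonal_removeDiagonal _ fun r j hrj => (h0 r j (by omega)).2.2⟩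
  right_inv := by
    rintro ⟨⟨⟨H, E⟩, L, R, C⟩, hs, hp⟩
    have h0 := hp.1
    simp only [Subtype.mk.injEq, Prod.mk.injEq, addDiagonal_self, true_and]
    refine ⟨?_, removeDiagonal_addDiagonal _ _ fun r j hrj => (h0 r j (by omega)).1,
      removeDiagonal_addDiagonal _ _ fun r j hrj => (h0 r j (by omega)).2.1,
      removeDiagonal_addDiagonal _ _ fun r j hrj => (h0 r j (by omega)).2.2⟩
    funext q
    rw [addDiagonal_succ _ _ (by omega)]
    by_cases hq : q < n
    · exact (hp.2.2.2 q hq).2.1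
    · exact (h0 q q (by omega)).2.1.trans (hs.2.2.1 q (by omega)).symm

theorem finite_and_card_isPuzzle (n : ℕ) (a b c : ℕ → Fin 3) :
    Finite { p : (ℕ → ℕ → Fin 3) × (ℕ → ℕ → Fin 3) × (ℕ → ℕ → Fin 3) //
      IsPuzzle n p.1 p.2.1 p.2.2 a b c } ∧
    (puzzleCount n a b c : ℤ) =
      weightedCount (labelList n a).reverse (labelList n b) ((List.range n).map c).reverse := by
  induction n generalizing b with
  | zero =>
    have : Unique { p : (ℕ → ℕ → Fin 3) × (ℕ → ℕ → Fin 3) × (ℕ → ℕ → Fin 3) //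
        IsPuzzle 0 p.1 p.2.1 p.2.2 a b c } :=
      { default := ⟨0, by simp [IsPuzzle]⟩
        uniq := by
          rintro ⟨⟨L, R, C⟩, h, -⟩
          have h' := fun r j => h r j (by omega)
          apply Subtype.ext
          refine Prod.ext ?_ (Prod.ext ?_ ?_) <;> funext r j
          exacts [(h' r j).1, (h' r j).2.1, (h' r j).2.2] }
    refine ⟨inferInstance, ?_⟩
    rw [puzzleCount, Nat.card_unique]
    simp [labelList, weightedCount]
  | succ n ih =>
    have f := puzzleSuccEquiv n a b c
    have key := card_stripWith n (a n) (c n) b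
      (fun E (p : (ℕ → ℕ → Fin 3) × (ℕ → ℕ → Fin 3) × (ℕ → ℕ → Fin 3)) =>
        IsPuzzle n p.1 p.2.1 p.2.2 a E c)
      (fun l => weightedCount (labelList n a).reverse l ((List.range n).map c).reverse)
      (fun E => (ih E).1) fun E => (ih E).2
    have := key.1
    refine ⟨Finite.of_equiv _ f.symm, ?_⟩
    rw [puzzleCount, Nat.card_congr f, key.2]
    simp [labelList, List.range_succ, weightedCount]

end Counting


/-- **Commutativity.**  For binary strings `α, β, γ` of length `n`, each with
exactly `k` ones, the number of puzzles with boundary `(α, β, γ)` equals the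
number of puzzles with boundary `(β, α, γ)`. -/
theorem puzzleCount_comm (n k : ℕ) (a b c : ℕ → Fin 3)
    (ha01 : ∀ i, i < n → a i = 0 ∨ a i = 1)
    (hb01 : ∀ i, i < n → b i = 0 ∨ b i = 1)
    (hc01 : ∀ i, i < n → c i = 0 ∨ c i = 1)
    (hak : Nat.card {i : ℕ // i < n ∧ a i = 1} = k)
    (hbk : Nat.card {i : ℕ // i < n ∧ b i = 1} = k)
    (hck : Nat.card {i : ℕ // i < n ∧ c i = 1} = k) :
    puzzleCount n a b c = puzzleCount n b a c := by
  have h2 : ∀ f : ℕ → Fin 3, (∀ i, i < n → f i = 0 ∨ f i = 1) → 2 ∉ (List.range n).map f := by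
    intro f hf h
    obtain ⟨i, hi, h⟩ := List.mem_map.mp h
    rcases hf i (List.mem_range.mp hi) with h' | h' <;> rw [h'] at h <;> exact absurd h (by decide)
  have hab := (finite_and_card_isPuzzle n a b c).2
  have hba := (finite_and_card_isPuzzle n b a c).2
  have key := weightedCount_zero_comm ((List.range n).map a) ((List.range n).map b)
    ((List.range n).map c).reverse (by simp) (by simp) (h2 a ha01) (h2 b hb01)
    (by rw [List.mem_reverse]; exact h2 c hc01)
  exact_mod_cast hab.trans (key.trans hba.symm)
end
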